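/- arXiv:2402.01581 — 3 statements merged into one kernel-verified Lean document; each statement's English description precedes it below -/
import Mathlib

section
/- Solvability of linear ODE systems with asymptotically hyperbolic coefficients and linear constraints: Let n ≥ 1 and 0 ≤ m ≤ n. Let A : ℝ → ℝ^{n×n} be bounded and continuous, let ℓ₁, …, ℓ_m ∈ ℝⁿ be linearly independent, and consider the problem u′(x) = A(x) u(x) + f(x) on ℝ with the constraints ℓᵢ · u(0) = cᵢ, i = 1, …, m. Assume: (1) there exist hyperbolic matrices A₋, A₊ ∈ ℝ^{n×n} and constants C₀, η > 0 with ‖A(x) − A₋‖ ≤ C₀ e^{ηx} for all x ≤ 0 and ‖A(x) − A₊‖ ≤ C₀ e^{−ηx} for all x ≥ 0; (2) dim_ℂ E^u(A₋) + dim_ℂ E^s(A₊) = n + m; (3) the only bounded, locally absolutely continuous u : ℝ → ℝⁿ with u′(x) = A(x) u(x) for almost every x and ℓᵢ · u(0) = 0 for all i is u ≡ 0. Then for every f ∈ L^∞(ℝ, ℝⁿ) and every (c₁, …, c_m) ∈ ℝ^m there exists a unique bounded, locally absolutely continuous u : ℝ → ℝⁿ with u′(x) = A(x) u(x) + f(x)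 for almost every x ∈ ℝ and ℓᵢ · u(0) = cᵢ for all i. -/
noncomputable section

open Matrix MeasureTheory intervalIntegral

/-- The complexification of a real matrix, acting on `ℂⁿ`. -/
def endOf {n : ℕ} (M : Matrix (Fin n) (Fin n) ℝ) : Module.End ℂ (Fin n → ℂ) :=
  Matrix.mulVecLin (M.map Complex.ofReal)

/-- A real square matrix is hyperbolic if (viewed over `ℂ`) it has no purely
imaginary eigenvalue. -/
def IsHyperbolicMat {n : ℕ} (M : Matrix (Fin n) (Fin n) ℝ) : Prop :=
  ∀ μ : ℂ, Module.End.HasEigenvalue (endOf M) μ → μ.re ≠ 0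

/-- The generalized eigenspace of an endomorphism of `ℂⁿ` at `μ`. -/
def genEig {n : ℕ} (f : Module.End ℂ (Fin n → ℂ)) (μ : ℂ) : Submodule ℂ (Fin n → ℂ) :=
  ⨆ k : ℕ, LinearMap.ker ((f - μ • 1) ^ k)

/-- The stable subspace of a matrix: the sum of the generalized eigenspaces for
eigenvalues with negative real part. -/
def stableSubspace {n : ℕ} (M : Matrix (Fin n) (Fin n) ℝ) : Submodule ℂ (Fin n → ℂ) :=
  ⨆ μ ∈ {μ : ℂ | μ.re < 0}, genEig (endOf M) μ

/-- The unstable subspace of a matrix: the sum of the generalized eigenspaces for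
eigenvalues with positive real part. -/
def unstableSubspace {n : ℕ} (M : Matrix (Fin n) (Fin n) ℝ) : Submodule ℂ (Fin n → ℂ) :=
  ⨆ μ ∈ {μ : ℂ | 0 < μ.re}, genEig (endOf M) μ

/-- "Bounded solution" of `u' = A u + f`, in the integrated (locally absolutely
continuous) sense: `u` is continuous, bounded, and satisfies
`u(x) = u(0) + ∫₀ˣ (A(s) u(s) + f(s)) ds` for all `x`. -/
def IsBddSol {n : ℕ} (A : ℝ → Matrix (Fin n) (Fin n) ℝ)
    (f : ℝ → Fin n → ℝ) (u : ℝ → Fin n → ℝ) : Prop :=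
  Continuous u ∧ (∃ C : ℝ, ∀ x, ‖u x‖ ≤ C) ∧
    ∀ x : ℝ, u x = u 0 + ∫ s in (0 : ℝ)..x, (A s *ᵥ u s + f s)


section generic
set_option linter.unusedSectionVars false
open Set Filter Topology BoundedContinuousFunction

variable {E : Type*} [NormedAddCommGroup E] [NormedSpace ℂ E] [CompleteSpace E]

/-- Scalar resolvent, stable case. -/
lemma exists_resolvent_neg (l : ℂ) (hl : l.re < 0) :
    ∃ R : (ℝ →ᵇ E) →L[ℂ] (ℝ →ᵇ E), ∀ f x, HasDerivAt (R f) (l • R f x + f x) x := by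
  have hIntg : ∀ (f : ℝ →ᵇ E) (x : ℝ),
      IntegrableOn (fun s : ℝ => Complex.exp (-(l * s)) • f s) (Iic x) := by
    intro f x
    have h1 : IntegrableOn (fun s : ℝ => Real.exp ((-l.re) * s)) (Iic x) :=
      integrableOn_exp_mul_Iic (by linarith) x
    refine (h1.mul_const ‖f‖).mono' ?_ ?_
    · exact (Continuous.smul (by fun_prop) f.continuous).aestronglyMeasurable
    · refine Eventually.of_forall fun s => ?_
      rw [norm_smul, Complex.norm_exp]
      simp only [Complex.neg_re, Complex.mul_re, Complex.ofReal_re, Complex.ofReal_im, mul_zero,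
        sub_zero, neg_mul]
      gcongr
      exact f.norm_coe_le_norm s
  let w : (ℝ →ᵇ E) → ℝ → E := fun f x =>
    Complex.exp (l * x) • ∫ s in Iic x, Complex.exp (-(l * s)) • f s
  have hder : ∀ f x, HasDerivAt (w f) (l • w f x + f x) x := by
    intro f x
    have h1 : HasDerivAt (fun y : ℝ => ∫ s in Iic y, Complex.exp (-(l * s)) • f s)
        (Complex.exp (-(l * x)) • f x) x := by
      have h2 : (fun y : ℝ => ∫ s in Iic y, Complex.exp (-(l * s)) • f s) =
          fun y => (∫ s in Iic (0:ℝ), Complex.exp (-(l * s)) • f s) +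
            ∫ s in (0:ℝ)..y, Complex.exp (-(l * s)) • f s := by
        funext y
        rw [← integral_Iic_sub_Iic (hIntg f 0) (hIntg f y)]
        abel
      rw [h2]
      have hc : Continuous (fun s : ℝ => Complex.exp (-(l * s)) • f s) :=
        Continuous.smul (by fun_prop) f.continuous
      exact (integral_hasDerivAt_right (hc.intervalIntegrable _ _)
        (hc.stronglyMeasurableAtFilter _ _) hc.continuousAt).const_add _
    have h3 : HasDerivAt (fun y : ℝ => Complex.exp (l * y)) (Complex.exp (l * x) * (l * 1)) x :=
      (((hasDerivAt_id (x:ℝ)).ofReal_comp).const_mul l).cexp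
    have h4 := h3.smul h1
    refine HasDerivAt.congr_deriv (f := w f) h4 ?_
    rw [smul_smul, ← Complex.exp_add]
    simp only [add_neg_cancel, Complex.exp_zero, one_smul, mul_one, w, smul_smul]
    rw [add_comm, mul_comm]
  have hbd : ∀ f x, ‖w f x‖ ≤ (-l.re)⁻¹ * ‖f‖ := by
    intro f x
    have h1 : IntegrableOn (fun s : ℝ => Real.exp ((-l.re) * s)) (Iic x) :=
      integrableOn_exp_mul_Iic (by linarith) x
    have h2 : ‖∫ s in Iic x, Complex.exp (-(l * s)) • f s‖ ≤
        ∫ s in Iic x, Real.exp ((-l.re) * s) * ‖f‖ := by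
      refine norm_integral_le_of_norm_le (h1.mul_const ‖f‖) ?_
      refine Eventually.of_forall fun s => ?_
      rw [norm_smul, Complex.norm_exp]
      simp only [Complex.neg_re, Complex.mul_re, Complex.ofReal_re, Complex.ofReal_im, mul_zero,
        sub_zero, neg_mul]
      gcongr
      exact f.norm_coe_le_norm s
    rw [MeasureTheory.integral_mul_const, integral_exp_mul_Iic (by linarith) x] at h2
    simp only [w]
    rw [norm_smul, Complex.norm_exp]
    calc _ ≤ Real.exp (l * x).re * (Real.exp (-l.re * x) / -l.re * ‖f‖) := by gcongr
      _ = (Real.exp (l * x).re * Real.exp (-l.re * x)) * ((-l.re)⁻¹ * ‖f‖) := by ring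
      _ = _ := by
        rw [← Real.exp_add]
        simp
  have hcont : ∀ f, Continuous (w f) := fun f =>
    continuous_iff_continuousAt.2 fun x => (hder f x).continuousAt
  refine ⟨LinearMap.mkContinuous
    { toFun := fun f => BoundedContinuousFunction.ofNormedAddCommGroup (w f) (hcont f) _ (hbd f)
      map_add' := ?_
      map_smul' := ?_ } (-l.re)⁻¹ ?_, ?_⟩
  · intro f g
    ext x
    simp only [coe_ofNormedAddCommGroup, BoundedContinuousFunction.coe_add, Pi.add_apply, w,
      smul_add]
    rw [integral_add (hIntg f x) (hIntg g x), smul_add]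
  · intro c f
    ext x
    simp only [coe_ofNormedAddCommGroup, BoundedContinuousFunction.coe_smul, w, RingHom.id_apply]
    simp_rw [smul_comm _ c]
    rw [MeasureTheory.integral_smul, smul_comm]
  · intro f
    refine norm_ofNormedAddCommGroup_le _ ?_ (hbd f)
    have : 0 < (-l.re)⁻¹ := by
      rw [inv_pos]; linarith
    positivity
  · intro f x
    exact hder f x

/-- Reflection of bounded continuous functions. -/
def reflB : (ℝ →ᵇ E) →L[ℂ] (ℝ →ᵇ E) :=
  LinearMap.mkContinuous
    { toFun := fun f => f.compContinuous ⟨fun x => -x, continuous_neg⟩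
      map_add' := fun f g => by ext; simp
      map_smul' := fun c f => by ext; simp } 1 (by
      intro f
      rw [one_mul]
      refine (BoundedContinuousFunction.norm_le (norm_nonneg _)).2 fun x => ?_
      exact f.norm_coe_le_norm _)

lemma reflB_apply (f : ℝ →ᵇ E) (x : ℝ) : reflB f x = f (-x) := rfl

lemma exists_resolvent (l : ℂ) (hl : l.re ≠ 0) :
    ∃ R : (ℝ →ᵇ E) →L[ℂ] (ℝ →ᵇ E), ∀ f x, HasDerivAt (R f) (l • R f x + f x) x := by
  rcases lt_or_gt_of_ne hl with h | h
  · exact exists_resolvent_neg l h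
  · obtain ⟨R, hR⟩ := exists_resolvent_neg (E := E) (-l) (by simpa using h)
    refine ⟨-(reflB.comp (R.comp reflB)), fun f x => ?_⟩
    have h1 := (hR (reflB f) (-x)).scomp x (hasDerivAt_neg x)
    have h2 := h1.neg
    refine HasDerivAt.congr_deriv
      (f := ⇑((-(reflB.comp (R.comp reflB)) : (ℝ →ᵇ E) →L[ℂ] (ℝ →ᵇ E)) f)) h2 ?_
    simp [reflB_apply]
    abel

/-- Pointwise action of a continuous bounded operator field on bounded functions. -/
lemma exists_mulOp (B : ℝ → E →L[ℂ] E) (hB : Continuous B) (C : ℝ) (hC : 0 ≤ C)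
    (hBC : ∀ x, ‖B x‖ ≤ C) :
    ∃ M : (ℝ →ᵇ E) →L[ℂ] (ℝ →ᵇ E), ‖M‖ ≤ C ∧ ∀ f x, M f x = B x (f x) := by
  have hb : ∀ (f : ℝ →ᵇ E) x, ‖B x (f x)‖ ≤ C * ‖f‖ := fun f x =>
    ((B x).le_opNorm _).trans (mul_le_mul (hBC x) (f.norm_coe_le_norm x) (norm_nonneg _) hC)
  refine ⟨LinearMap.mkContinuous
    { toFun := fun f => BoundedContinuousFunction.ofNormedAddCommGroup (fun x => B x (f x))
        (hB.clm_apply f.continuous) _ (hb f)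
      map_add' := fun f g => by ext; simp
      map_smul' := fun c f => by ext; simp } C ?_, ?_, ?_⟩
  · intro f
    exact norm_ofNormedAddCommGroup_le _ (by positivity) (hb f)
  · exact LinearMap.mkContinuous_norm_le _ hC _
  · intro f x
    rfl

/-- Green operator up to a polynomial. -/
lemma exists_green_aux (L : E →L[ℂ] E) (s : Multiset ℂ) (hs : ∀ l ∈ s, l.re ≠ 0) :
    ∃ G V : (ℝ →ᵇ E) →L[ℂ] (ℝ →ᵇ E), ∀ f x, HasDerivAt (G f)
      (L (G f x) + f x -
        (Polynomial.aeval L (s.map fun l => Polynomial.X - Polynomial.C l).prod) (V f x)) x := by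
  induction s using Multiset.induction with
  | empty =>
    refine ⟨0, ContinuousLinearMap.id ℂ _, fun f x => ?_⟩
    simp
  | cons l s ih =>
    obtain ⟨G, V, h⟩ := ih fun l hl => hs l (Multiset.mem_cons_of_mem hl)
    obtain ⟨R, hR⟩ := exists_resolvent (E := E) l (hs l (Multiset.mem_cons_self l s))
    set P := (Polynomial.aeval L (s.map fun l => Polynomial.X - Polynomial.C l).prod) with hP
    refine ⟨G + (P.compLeftContinuousBounded ℝ).comp (R.comp V), R.comp V, fun f x => ?_⟩
    have h1 := (P.restrictScalars ℝ).hasFDerivAt.comp_hasDerivAt x (hR (V f) x)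
    have h2 := (h f x).add h1
    have hcomm : ∀ y, L (P y) = P (L y) := by
      intro y
      have : L * P = P * L := by
        have := Polynomial.aeval_X (R := ℂ) L
        conv_lhs => rw [← this]
        conv_rhs => rw [← this]
        rw [hP, ← map_mul, ← map_mul, mul_comm]
      exact congrArg (fun Q : E →L[ℂ] E => Q y) this
    refine HasDerivAt.congr_deriv
      (f := ⇑((G + (P.compLeftContinuousBounded ℝ).comp (R.comp V)) f)) h2 ?_
    rw [Multiset.map_cons, Multiset.prod_cons, mul_comm, map_mul, ← hP]
    simp [hcomm]
    abel
/-- Stable subspace of an endomorphism. -/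
def stabE {F : Type*} [AddCommGroup F] [Module ℂ F] (L : Module.End ℂ F) : Submodule ℂ F :=
  ⨆ μ ∈ {μ : ℂ | μ.re < 0}, ⨆ k : ℕ, LinearMap.ker ((L - μ • 1) ^ k)

lemma exists_green [FiniteDimensional ℂ E] (L : E →L[ℂ] E)
    (hL : ∀ μ : ℂ, Module.End.HasEigenvalue (L : E →ₗ[ℂ] E) μ → μ.re ≠ 0) :
    ∃ G : (ℝ →ᵇ E) →L[ℂ] (ℝ →ᵇ E), ∀ f x, HasDerivAt (G f) (L (G f x) + f x) x := by
  obtain ⟨G, V, h⟩ := exists_green_aux L (L : E →ₗ[ℂ] E).charpoly.roots (by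
    intro l hl
    apply hL
    rw [Module.End.hasEigenvalue_iff_isRoot_charpoly]
    exact Polynomial.isRoot_of_mem_roots hl)
  refine ⟨G, fun f x => ?_⟩
  have h0 : Polynomial.aeval L
      ((L : E →ₗ[ℂ] E).charpoly.roots.map fun l => Polynomial.X - Polynomial.C l).prod = 0 := by
    have h1 := (IsAlgClosed.splits (L : E →ₗ[ℂ] E).charpoly).eq_prod_roots_of_monic
      (LinearMap.charpoly_monic _)
    rw [← h1]
    have h2 := LinearMap.aeval_self_charpoly (L : E →ₗ[ℂ] E)
    let φ : (E →L[ℂ] E) →ₐ[ℂ] (E →ₗ[ℂ] E) :=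
      { (ContinuousLinearMap.toLinearMapRingHom : (E →L[ℂ] E) →+* (E →ₗ[ℂ] E)) with
        commutes' := fun r => rfl }
    have h3 := Polynomial.aeval_algHom_apply φ L
      (L : E →ₗ[ℂ] E).charpoly
    have h4 : φ
      (Polynomial.aeval L (L : E →ₗ[ℂ] E).charpoly) = 0 := by
      rw [← h3]; exact h2
    ext y
    exact congrArg (fun Q : E →ₗ[ℂ] E => Q y) h4
  have := h f x
  rw [h0] at this
  simpa using this

/-- Solution operator for a small perturbation. -/
lemma exists_pert (L : E →L[ℂ] E) (G : (ℝ →ᵇ E) →L[ℂ] (ℝ →ᵇ E))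
    (hG : ∀ f x, HasDerivAt (G f) (L (G f x) + f x) x) (B : ℝ → E →L[ℂ] E) (hB : Continuous B)
    (ε : ℝ) (hε : 0 ≤ ε) (hεG : ‖G‖ * ε ≤ 1 / 2) (hBL : ∀ x, ‖B x - L‖ ≤ ε) :
    ∃ W : (ℝ →ᵇ E) →L[ℂ] (ℝ →ᵇ E), (∀ f, ‖W f‖ ≤ 2 * ‖G‖ * ‖f‖) ∧
      ∀ f x, HasDerivAt (W f) (B x (W f x) + f x) x := by
  obtain ⟨M, hM, hMf⟩ := exists_mulOp (fun x => B x - L) (hB.sub continuous_const) ε hε hBL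
  have hN : ‖G * M‖ ≤ 1 / 2 := (norm_mul_le _ _).trans
    ((mul_le_mul_of_nonneg_left hM (norm_nonneg _)).trans hεG)
  have hN1 : ‖G * M‖ < 1 := by linarith
  obtain ⟨U, hU⟩ := isUnit_one_sub_of_norm_lt_one hN1
  have key : ∀ f, (↑U⁻¹ * G : (ℝ →ᵇ E) →L[ℂ] (ℝ →ᵇ E)) f =
      G (M ((↑U⁻¹ * G : (ℝ →ᵇ E) →L[ℂ] (ℝ →ᵇ E)) f) + f) := by
    intro f
    have h1 : (1 - G * M) * (↑U⁻¹ * G) = G := by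
      rw [← hU, ← mul_assoc, Units.mul_inv, one_mul]
    have h2 := congrArg (fun Q : (ℝ →ᵇ E) →L[ℂ] (ℝ →ᵇ E) => Q f) h1
    simp only [sub_mul, one_mul, _root_.sub_apply] at h2
    rw [map_add]
    rw [sub_eq_iff_eq_add] at h2
    rw [add_comm]
    exact h2
  refine ⟨↑U⁻¹ * G, fun f => ?_, fun f x => ?_⟩
  · set w := (↑U⁻¹ * G : (ℝ →ᵇ E) →L[ℂ] (ℝ →ᵇ E)) f
    have h1 : w = (G * M) w + G f := by
      have := key f
      rw [map_add] at this
      exact this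
    have h2 : ‖w‖ ≤ ‖(G * M) w‖ + ‖G f‖ := by
      conv_lhs => rw [h1]
      exact norm_add_le _ _
    have h3 := (G * M).le_opNorm w
    have h4 := G.le_opNorm f
    have h5 : ‖G * M‖ * ‖w‖ ≤ 1 / 2 * ‖w‖ := by gcongr
    linarith
  · set w := (↑U⁻¹ * G : (ℝ →ᵇ E) →L[ℂ] (ℝ →ᵇ E)) f
    have h1 := hG (M w + f) x
    rw [← key f] at h1
    refine h1.congr_deriv ?_
    change L (w x) + (M w x + f x) = B x (w x) + f x
    rw [hMf, _root_.sub_apply]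
    abel

/-- vectors with bounded forward orbit -/
def bddSub (L : E →L[ℂ] E) : Submodule ℂ E where
  carrier := {p | ∃ C : ℝ, ∀ x : ℝ, 0 ≤ x → ‖NormedSpace.exp (x • L) p‖ ≤ C}
  add_mem' := by
    rintro a b ⟨C, hC⟩ ⟨D, hD⟩
    refine ⟨C + D, fun x hx => ?_⟩
    rw [map_add]
    exact (norm_add_le _ _).trans (add_le_add (hC x hx) (hD x hx))
  zero_mem' := ⟨0, fun x hx => by simp⟩
  smul_mem' := by
    rintro c a ⟨C, hC⟩
    refine ⟨‖c‖ * C, fun x hx => ?_⟩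
    rw [map_smul, norm_smul]
    exact mul_le_mul_of_nonneg_left (hC x hx) (norm_nonneg _)

lemma hasDerivAt_expL (L : E →L[ℂ] E) (p : E) (x : ℝ) :
    HasDerivAt (fun x : ℝ => NormedSpace.exp (x • L) p) (L (NormedSpace.exp (x • L) p)) x := by
  have h := hasDerivAt_exp_smul_const' (𝕂 := ℝ) L x
  exact ((ContinuousLinearMap.apply ℂ E p).restrictScalars ℝ).hasFDerivAt.comp_hasDerivAt x h

lemma hasDerivAt_expL' (L : E →L[ℂ] E) (p : E) (x : ℝ) :
    L (NormedSpace.exp (x • L) p) = NormedSpace.exp (x • L) (L p) := by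
  have h : Commute L (NormedSpace.exp (x • L)) := ((Commute.refl L).smul_right x).exp_right
  exact congrArg (fun Q : E →L[ℂ] E => Q p) h.eq

lemma stabE_le_bddSub (L : E →L[ℂ] E) : stabE (L : E →ₗ[ℂ] E) ≤ bddSub L := by
  refine iSup₂_le fun μ hμ => iSup_le fun k => ?_
  replace hμ : μ.re < 0 := hμ
  induction k with
  | zero =>
    intro p hp
    have : p = 0 := by simpa using hp
    rw [this]
    exact zero_mem _
  | succ k ih =>
    intro p hp
    set q : E := L p - μ • p with hq
    have hqmem : q ∈ bddSub L := by
      apply ih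
      rw [LinearMap.mem_ker, pow_succ] at hp
      rw [LinearMap.mem_ker]
      exact hp
    obtain ⟨C, hC⟩ := hqmem
    have hcont : Continuous (fun x : ℝ => NormedSpace.exp (x • L) q) :=
      continuous_iff_continuousAt.2 fun x => (hasDerivAt_expL L q x).continuousAt
    let f : ℝ →ᵇ E := BoundedContinuousFunction.ofNormedAddCommGroup
      (fun x : ℝ => NormedSpace.exp (max x 0 • L) q)
      (hcont.comp (continuous_id.max continuous_const)) C (fun x => hC _ (le_max_right _ _))
    obtain ⟨R, hR⟩ := exists_resolvent_neg (E := E) μ hμ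
    let z : ℝ → E := fun x => Complex.exp (-(μ * x)) • (NormedSpace.exp (x • L) p - R f x)
    have hz : ∀ x : ℝ, 0 ≤ x → HasDerivAt z 0 x := by
      intro x hx
      have h3 : HasDerivAt (fun y : ℝ => Complex.exp (-(μ * y)))
          (Complex.exp (-(μ * x)) * (-(μ * 1))) x :=
        (((hasDerivAt_id (x:ℝ)).ofReal_comp).const_mul μ).neg.cexp
      have h4 := h3.smul ((hasDerivAt_expL L p x).sub (hR f x))
      refine HasDerivAt.congr_deriv (f := z) h4 ?_
      have hf : f x = NormedSpace.exp (x • L) q := by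
        simp [f, max_eq_left hx]
      rw [hf, hq, map_sub, map_smul, hasDerivAt_expL']
      simp only [Pi.sub_apply]
      module
    have hz0 : ∀ x : ℝ, 0 ≤ x → z x = z 0 := by
      intro x hx
      refine constant_of_has_deriv_right_zero (a := 0) (b := x) ?_ ?_ x ⟨hx, le_rfl⟩
      · intro y hy
        exact (hz y hy.1).continuousAt.continuousWithinAt
      · intro y hy
        exact (hz y hy.1).hasDerivWithinAt
    refine ⟨‖z 0‖ + ‖R f‖, fun x hx => ?_⟩
    have h1 : NormedSpace.exp (x • L) p = Complex.exp (μ * x) • z 0 + R f x := by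
      rw [← hz0 x hx]
      simp [z, smul_smul, ← Complex.exp_add]
    rw [h1]
    refine (norm_add_le _ _).trans (add_le_add ?_ ((R f).norm_coe_le_norm x))
    rw [norm_smul, Complex.norm_exp]
    refine mul_le_of_le_one_left (norm_nonneg _) ?_
    rw [Real.exp_le_one_iff]
    simp
    exact mul_nonpos_of_nonpos_of_nonneg hμ.le hx

lemma exists_orbitMap [FiniteDimensional ℂ E] (L : E →L[ℂ] E) :
    ∃ Z : stabE (L : E →ₗ[ℂ] E) →L[ℂ] (ℝ →ᵇ E),
      ∀ p x, 0 ≤ x → Z p x = NormedSpace.exp (x • L) (p : E) := by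
  have hcont : ∀ q : E, Continuous (fun x : ℝ => NormedSpace.exp (x • L) q) := fun q =>
      continuous_iff_continuousAt.2 fun x => (hasDerivAt_expL L q x).continuousAt
  choose C hC using fun p : stabE (L : E →ₗ[ℂ] E) => stabE_le_bddSub L p.2
  let Z0 : stabE (L : E →ₗ[ℂ] E) →ₗ[ℂ] (ℝ →ᵇ E) :=
    { toFun := fun p => BoundedContinuousFunction.ofNormedAddCommGroup
        (fun x : ℝ => NormedSpace.exp (max x 0 • L) (p : E))
        ((hcont p).comp (continuous_id.max continuous_const)) (C p)
          (fun x => hC p _ (le_max_right _ _))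
      map_add' := fun p q => by ext x; simp
      map_smul' := fun c p => by ext x; simp }
  refine ⟨LinearMap.toContinuousLinearMap Z0, fun p x hx => ?_⟩
  simp [Z0, max_eq_left hx]

lemma small_pert [FiniteDimensional ℂ E] (L : E →L[ℂ] E)
    (hL : ∀ μ : ℂ, Module.End.HasEigenvalue (L : E →ₗ[ℂ] E) μ → μ.re ≠ 0) :
    ∃ ε : ℝ, 0 < ε ∧ ∀ B : ℝ → E →L[ℂ] E, Continuous B → (∀ x, ‖B x - L‖ ≤ ε) →
      (∀ f : ℝ →ᵇ E, ∃ w : ℝ →ᵇ E, ∀ x, HasDerivAt w (B x (w x) + f x) x) ∧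
      ∃ J : stabE (L : E →ₗ[ℂ] E) →ₗ[ℂ] E, Function.Injective J ∧
        ∀ p, ∃ u : ℝ → E, u 0 = J p ∧ (∀ x, 0 ≤ x → HasDerivAt u (B x (u x)) x) ∧
          ∃ C : ℝ, ∀ x, 0 ≤ x → ‖u x‖ ≤ C := by
  obtain ⟨G, hG⟩ := exists_green L hL
  obtain ⟨Z, hZ⟩ := exists_orbitMap L
  refine ⟨1 / (4 * (‖G‖ + 1) * (‖Z‖ + 1)), by positivity, fun B hB hBL => ?_⟩
  set ε := 1 / (4 * (‖G‖ + 1) * (‖Z‖ + 1)) with hε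
  have hε0 : 0 < ε := by positivity
  have hG0 := norm_nonneg G
  have hZ0 := norm_nonneg Z
  have hε1 : ε * (4 * (‖G‖ + 1) * (‖Z‖ + 1)) = 1 := by
    rw [hε]; field_simp
  have hp1 : 0 ≤ ε * ‖G‖ := by positivity
  have hp2 : 0 ≤ ε * ‖Z‖ := by positivity
  have hp3 : 0 ≤ ε * ‖G‖ * ‖Z‖ := by positivity
  obtain ⟨W, hW, hWd⟩ := exists_pert L G hG B hB ε hε0.le (by nlinarith) hBL
  obtain ⟨M, hM, hMf⟩ := exists_mulOp (fun x => B x - L) (hB.sub continuous_const) ε hε0.le hBL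
  refine ⟨fun f => ⟨W f, hWd f⟩, ?_⟩
  let J : stabE (L : E →ₗ[ℂ] E) →ₗ[ℂ] E :=
    { toFun := fun p => W (M (Z p)) 0 + (p : E)
      map_add' := fun p q => by simp; abel
      map_smul' := fun c p => by simp }
  refine ⟨J, ?_, fun p => ?_⟩
  · rw [injective_iff_map_eq_zero]
    intro p hp
    have h1 : ‖W (M (Z p)) 0‖ = ‖p‖ := by
      have : W (M (Z p)) 0 = -(p : E) := eq_neg_of_add_eq_zero_left hp
      rw [this, norm_neg]; rfl
    have h2 : ‖W (M (Z p)) 0‖ ≤ 2 * ‖G‖ * (ε * (‖Z‖ * ‖p‖)) := by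
      refine ((W (M (Z p))).norm_coe_le_norm 0).trans ((hW _).trans ?_)
      gcongr
      refine (M.le_opNorm _).trans ?_
      gcongr
      exact Z.le_opNorm p
    rw [h1] at h2
    have h3 : 2 * ‖G‖ * (ε * (‖Z‖ * ‖p‖)) ≤ 1 / 2 * ‖p‖ := by
      have : 2 * ‖G‖ * (ε * (‖Z‖ * ‖p‖)) = (2 * (ε * ‖G‖ * ‖Z‖)) * ‖p‖ := by ring
      rw [this]
      gcongr
      nlinarith
    have h4 := norm_nonneg p
    exact norm_eq_zero.1 (by linarith)
  · refine ⟨fun x => W (M (Z p)) x + NormedSpace.exp (x • L) (p : E), ?_, ?_, ?_⟩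
    · simp [J]
    · intro x hx
      refine ((hWd (M (Z p)) x).add (hasDerivAt_expL L p x)).congr_deriv ?_
      rw [hMf, hZ p x hx, _root_.sub_apply, map_add]
      abel
    · refine ⟨‖W (M (Z p))‖ + ‖Z p‖, fun x hx => (norm_add_le _ _).trans ?_⟩
      rw [← hZ p x hx]
      exact add_le_add (BoundedContinuousFunction.norm_coe_le_norm _ _)
        (BoundedContinuousFunction.norm_coe_le_norm _ _)

lemma abs_integral_exp_abs (K : ℝ) (hK : 0 < K) (x : ℝ) :
    |∫ s in (0:ℝ)..x, Real.exp (K * |s|)| ≤ Real.exp (K * |x|) / K := by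
  have hpos : ∀ y : ℝ, 0 ≤ y → |∫ s in (0:ℝ)..y, Real.exp (K * |s|)| ≤ Real.exp (K * |y|) / K := by
    intro y hy
    have h1 : ∫ s in (0:ℝ)..y, Real.exp (K * |s|) = ∫ s in (0:ℝ)..y, Real.exp (K * s) := by
      refine intervalIntegral.integral_congr fun s hs => ?_
      rw [uIcc_of_le hy] at hs
      simp [abs_of_nonneg hs.1]
    rw [h1, intervalIntegral.integral_comp_mul_left (fun s => Real.exp s) hK.ne', integral_exp,
      abs_of_nonneg hy, mul_zero, Real.exp_zero, smul_eq_mul, abs_of_nonneg]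
    · rw [inv_mul_eq_div]
      gcongr
      linarith
    · have : 1 ≤ Real.exp (K * y) := Real.one_le_exp (by positivity)
      have h2 : 0 ≤ Real.exp (K * y) - 1 := by linarith
      positivity
  rcases le_total 0 x with h | h
  · exact hpos x h
  · have h1 := hpos (-x) (by linarith)
    have h2 : ∫ s in (0:ℝ)..(-x), Real.exp (K * |s|) = -∫ s in (0:ℝ)..x, Real.exp (K * |s|) := by
      have := intervalIntegral.integral_comp_neg (a := 0) (b := -x)
        (fun s => Real.exp (K * |s|))
      simp only [abs_neg, neg_neg, neg_zero] at this
      rw [this, intervalIntegral.integral_symm]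
    rw [h2, abs_neg, abs_neg] at h1
    exact h1

/-- global existence for linear ODE -/
lemma global_exists (B : ℝ → E →L[ℂ] E) (hB : Continuous B) (C : ℝ) (hBC : ∀ x, ‖B x‖ ≤ C)
    (f : ℝ →ᵇ E) (p : E) :
    ∃ u : ℝ → E, u 0 = p ∧ ∀ x, HasDerivAt u (B x (u x) + f x) x := by
  have hC0 : 0 ≤ C := (norm_nonneg _).trans (hBC 0)
  set K : ℝ := 2 * C + 1 with hKd
  have hK : 0 < K := by positivity
  let e : ℝ → ℝ := fun s => Real.exp (K * |s|)
  have hec : Continuous e := by fun_prop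
  have hec' : Continuous fun x : ℝ => Real.exp (-(K * |x|)) := by fun_prop
  let V : (ℝ →ᵇ E) → ℝ → E := fun w x =>
    (Real.exp (-(K * |x|))) • ∫ s in (0:ℝ)..x, e s • B s (w s)
  have hic : ∀ w : ℝ →ᵇ E, Continuous fun s => e s • B s (w s) := fun w =>
    hec.smul (hB.clm_apply w.continuous)
  have hVc : ∀ w, Continuous (V w) := fun w =>
    by
    have h := hec'.smul (continuous_primitive (μ := volume) (fun a b => (hic w).intervalIntegrable a b) 0)
    exact h
  have hVb : ∀ w x, ‖V w x‖ ≤ 1 / 2 * ‖w‖ := by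
    intro w x
    have h1 : ‖∫ s in (0:ℝ)..x, e s • B s (w s)‖ ≤ |∫ s in (0:ℝ)..x, e s * (C * ‖w‖)| := by
      refine norm_integral_le_abs_of_norm_le ?_ ((hec.mul continuous_const).intervalIntegrable _ _)
      refine Eventually.of_forall fun s => ?_
      rw [norm_smul, Real.norm_of_nonneg (Real.exp_pos _).le]
      gcongr
      exact ((B s).le_opNorm _).trans (mul_le_mul (hBC s) (w.norm_coe_le_norm s) (norm_nonneg _) hC0)
    rw [intervalIntegral.integral_mul_const, abs_mul, abs_of_nonneg (by positivity : 0 ≤ C * ‖w‖)] at h1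
    have h2 := abs_integral_exp_abs K hK x
    simp only [V]
    rw [norm_smul, Real.norm_of_nonneg (Real.exp_pos _).le]
    calc _ ≤ Real.exp (-(K * |x|)) * (Real.exp (K * |x|) / K * (C * ‖w‖)) := by
          gcongr
          refine h1.trans ?_
          gcongr
      _ = (Real.exp (-(K * |x|)) * Real.exp (K * |x|)) * (C / K * ‖w‖) := by ring
      _ = C / K * ‖w‖ := by rw [← Real.exp_add]; simp
      _ ≤ 1 / 2 * ‖w‖ := by
          refine mul_le_mul_of_nonneg_right ?_ (norm_nonneg _)
          rw [div_le_iff₀ hK]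
          linarith
  let T : (ℝ →ᵇ E) →L[ℝ] (ℝ →ᵇ E) := LinearMap.mkContinuous
    { toFun := fun w => BoundedContinuousFunction.ofNormedAddCommGroup (V w) (hVc w) _ (hVb w)
      map_add' := by
        intro w v
        ext x
        simp only [coe_ofNormedAddCommGroup, BoundedContinuousFunction.coe_add, Pi.add_apply, V,
          map_add, smul_add]
        rw [intervalIntegral.integral_add ((hic w).intervalIntegrable _ _)
          ((hic v).intervalIntegrable _ _), smul_add]
      map_smul' := by
        intro c w
        ext x
        simp only [coe_ofNormedAddCommGroup, BoundedContinuousFunction.coe_smul, V,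
          RingHom.id_apply]
        have hh : ∀ s, e s • B s (c • w s) = c • e s • B s (w s) := by
          intro s
          rw [(B s).map_smul_of_tower, smul_comm]
        simp_rw [hh]
        rw [intervalIntegral.integral_smul, smul_comm] } (1 / 2) (fun w =>
          norm_ofNormedAddCommGroup_le _ (by positivity) (hVb w))
  have hT : ‖T‖ < 1 := lt_of_le_of_lt (LinearMap.mkContinuous_norm_le _ (by norm_num) _) (by norm_num)
  have hFc : Continuous fun x => ∫ s in (0:ℝ)..x, f s :=
    continuous_primitive (fun a b => f.continuous.intervalIntegrable a b) 0
  let w0 : ℝ →ᵇ E := BoundedContinuousFunction.ofNormedAddCommGroup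
    (fun x => (Real.exp (-(K * |x|))) • (p + ∫ s in (0:ℝ)..x, f s))
    (by
      have h := hec'.smul ((continuous_const (y := p)).add hFc)
      exact h) (‖p‖ + ‖f‖ / K) (by
      intro x
      rw [norm_smul, Real.norm_of_nonneg (Real.exp_pos _).le]
      have h1 : ‖∫ s in (0:ℝ)..x, f s‖ ≤ ‖f‖ * |x - 0| :=
        norm_integral_le_of_norm_le_const fun s _ => f.norm_coe_le_norm s
      rw [sub_zero] at h1
      have h2 : |x| * Real.exp (-(K * |x|)) ≤ 1 / K := by
        rw [Real.exp_neg, ← div_eq_mul_inv, div_le_div_iff₀ (Real.exp_pos _) hK]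
        have := Real.add_one_le_exp (K * |x|)
        linarith
      have h3 : Real.exp (-(K * |x|)) ≤ 1 := Real.exp_le_one_iff.2 (by
        have : 0 ≤ K * |x| := by positivity
        linarith)
      calc _ ≤ Real.exp (-(K * |x|)) * (‖p‖ + ‖f‖ * |x|) := by
            gcongr
            exact (norm_add_le _ _).trans (by gcongr)
        _ = Real.exp (-(K * |x|)) * ‖p‖ + ‖f‖ * (|x| * Real.exp (-(K * |x|))) := by ring
        _ ≤ 1 * ‖p‖ + ‖f‖ * (1 / K) := by gcongr
        _ = _ := by ring)
  obtain ⟨U, hU⟩ := isUnit_one_sub_of_norm_lt_one hT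
  let w : ℝ →ᵇ E := (↑U⁻¹ : (ℝ →ᵇ E) →L[ℝ] (ℝ →ᵇ E)) w0
  have hw : w = T w + w0 := by
    have h1 : (1 - T) * ↑U⁻¹ = 1 := by rw [← hU, Units.mul_inv]
    have h2 := congrArg (fun Q : (ℝ →ᵇ E) →L[ℝ] (ℝ →ᵇ E) => Q w0) h1
    have h3 : w - T w = w0 := h2
    rw [← h3]; abel
  let u : ℝ → E := fun x => e x • w x
  have hu : ∀ x, u x = p + ∫ s in (0:ℝ)..x, (B s (u s) + f s) := by
    intro x
    have h1 : w x = V w x + w0 x := congrArg (fun g : ℝ →ᵇ E => g x) hw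
    have h2 : u x = (∫ s in (0:ℝ)..x, e s • B s (w s)) + (p + ∫ s in (0:ℝ)..x, f s) := by
      have h0 : Real.exp (K * |x|) * Real.exp (-(K * |x|)) = 1 := by
        rw [← Real.exp_add]; simp
      simp only [u]
      rw [h1]
      simp only [V, w0, coe_ofNormedAddCommGroup, e, smul_add, smul_smul, h0, one_smul]
    have h3 : ∀ s, B s (u s) = e s • B s (w s) := fun s => (B s).map_smul_of_tower _ _
    simp_rw [h3]
    rw [h2, intervalIntegral.integral_add ((hic w).intervalIntegrable _ _)
      (f.continuous.intervalIntegrable _ _)]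
    abel
  have huc : Continuous u := hec.smul w.continuous
  have hgc : Continuous fun s => B s (u s) + f s := (hB.clm_apply huc).add f.continuous
  refine ⟨u, by rw [hu 0]; simp, fun x => ?_⟩
  have h1 : HasDerivAt (fun x => p + ∫ s in (0:ℝ)..x, (B s (u s) + f s)) (B x (u x) + f x) x :=
    (integral_hasDerivAt_right (hgc.intervalIntegrable _ _)
        (hgc.stronglyMeasurableAtFilter _ _) hgc.continuousAt).const_add _
  have h2 : u = fun x => p + ∫ s in (0:ℝ)..x, (B s (u s) + f s) := funext hu
  rw [h2]
  convert h1 using 1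
  rw [← h2]

lemma global_exists_at (B : ℝ → E →L[ℂ] E) (hB : Continuous B) (C : ℝ) (hBC : ∀ x, ‖B x‖ ≤ C)
    (f : ℝ →ᵇ E) (T : ℝ) (p : E) :
    ∃ u : ℝ → E, u T = p ∧ ∀ x, HasDerivAt u (B x (u x) + f x) x := by
  obtain ⟨v, hv0, hv⟩ := global_exists (fun x => B (x + T))
    (hB.comp (continuous_id.add continuous_const)) C (fun x => hBC _)
    (f.compContinuous ⟨fun x => x + T, continuous_id.add continuous_const⟩) p
  refine ⟨fun x => v (x - T), by simpa using hv0, fun x => ?_⟩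
  have h := (hv (x - T)).comp_sub_const x T
  simpa using h

lemma sol_lip (B : ℝ → E →L[ℂ] E) (C : ℝ) (hBC : ∀ x, ‖B x‖ ≤ C) (f : ℝ → E) (t : ℝ) :
    LipschitzOnWith C.toNNReal (fun y => B t y + f t) univ := by
  refine LipschitzOnWith.of_dist_le_mul fun x _ y _ => ?_
  rw [dist_add_right, dist_eq_norm, dist_eq_norm, ← map_sub]
  refine ((B t).le_opNorm _).trans ?_
  gcongr
  exact (hBC t).trans (Real.le_coe_toNNReal C)

lemma sol_unique (B : ℝ → E →L[ℂ] E) (C : ℝ) (hBC : ∀ x, ‖B x‖ ≤ C) (f : ℝ → E)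
    (u v : ℝ → E) (hu : ∀ x, HasDerivAt u (B x (u x) + f x) x)
    (hv : ∀ x, HasDerivAt v (B x (v x) + f x) x) (T : ℝ) (h : u T = v T) : u = v :=
  ODE_solution_unique_univ (v := fun t y => B t y + f t) (s := fun _ => univ)
    (K := C.toNNReal) (t₀ := T) (sol_lip B C hBC f) (fun t => ⟨hu t, mem_univ _⟩)
    (fun t => ⟨hv t, mem_univ _⟩) h

lemma sol_unique_right (B : ℝ → E →L[ℂ] E) (C : ℝ) (hBC : ∀ x, ‖B x‖ ≤ C) (f : ℝ → E)
    (u v : ℝ → E) (T : ℝ) (hu : ∀ x, T ≤ x → HasDerivAt u (B x (u x) + f x) x)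
    (hv : ∀ x, T ≤ x → HasDerivAt v (B x (v x) + f x) x) (h : u T = v T) :
    ∀ x, T ≤ x → u x = v x := by
  intro x hx
  exact ODE_solution_unique_of_mem_Icc_right (v := fun t y => B t y + f t) (s := fun _ => univ)
    (K := C.toNNReal) (a := T) (b := x) (fun t _ => sol_lip B C hBC f t)
    (fun t ht => (hu t ht.1).continuousAt.continuousWithinAt)
    (fun t ht => (hu t ht.1).hasDerivWithinAt) (fun _ _ => mem_univ _)
    (fun t ht => (hv t ht.1).continuousAt.continuousWithinAt)
    (fun t ht => (hv t ht.1).hasDerivWithinAt) (fun _ _ => mem_univ _) h ⟨hx, le_rfl⟩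

/-- solutions of the homogeneous equation bounded on the positive half line -/
def solSpace (B : ℝ → E →L[ℂ] E) : Submodule ℂ (ℝ → E) where
  carrier := {u | (∀ x, HasDerivAt u (B x (u x)) x) ∧ ∃ C : ℝ, ∀ x, 0 ≤ x → ‖u x‖ ≤ C}
  add_mem' := by
    rintro a b ⟨ha, C, hC⟩ ⟨hb, D, hD⟩
    refine ⟨fun x => ?_, C + D, fun x hx => ?_⟩
    · refine ((ha x).add (hb x)).congr_deriv ?_
      simp
    · exact (norm_add_le _ _).trans (add_le_add (hC x hx) (hD x hx))
  zero_mem' := ⟨fun x => by simp, 0, fun x hx => by simp⟩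
  smul_mem' := by
    rintro c a ⟨ha, C, hC⟩
    refine ⟨fun x => ?_, ‖c‖ * C, fun x hx => ?_⟩
    · refine ((ha x).const_smul c).congr_deriv ?_
      simp
    · rw [Pi.smul_apply, norm_smul]
      exact mul_le_mul_of_nonneg_left (hC x hx) (norm_nonneg _)

/-- evaluation at `t` -/
def evalAt (B : ℝ → E →L[ℂ] E) (t : ℝ) : solSpace B →ₗ[ℂ] E :=
  (LinearMap.proj t).comp (solSpace B).subtype

lemma evalAt_apply (B : ℝ → E →L[ℂ] E) (t : ℝ) (u : solSpace B) :
    evalAt B t u = (u : ℝ → E) t := rfl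

lemma evalAt_inj (B : ℝ → E →L[ℂ] E) (C : ℝ) (hBC : ∀ x, ‖B x‖ ≤ C) (t : ℝ) :
    Function.Injective (evalAt B t) := by
  intro u v huv
  apply Subtype.ext
  exact sol_unique B C hBC 0 u v (fun x => by simpa using u.2.1 x)
    (fun x => by simpa using v.2.1 x) t huv

/-- a function bounded on a final half line and continuous is bounded on `[0,∞)` -/
lemma bdd_extend (u : ℝ → E) (hu : Continuous u) (T C : ℝ) (h : ∀ x, T ≤ x → ‖u x‖ ≤ C) :
    ∃ D : ℝ, ∀ x, 0 ≤ x → ‖u x‖ ≤ D := by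
  obtain ⟨D, hD⟩ := (isCompact_Icc (a := (0:ℝ)) (b := T)).exists_bound_of_continuousOn hu.continuousOn
  refine ⟨max C D, fun x hx => ?_⟩
  rcases le_total T x with h1 | h1
  · exact (h x h1).trans (le_max_left _ _)
  · exact (hD x ⟨hx, h1⟩).trans (le_max_right _ _)

lemma half_line [FiniteDimensional ℂ E] (L : E →L[ℂ] E)
    (hL : ∀ μ : ℂ, Module.End.HasEigenvalue (L : E →ₗ[ℂ] E) μ → μ.re ≠ 0)
    (B : ℝ → E →L[ℂ] E) (hB : Continuous B) (C : ℝ) (hBC : ∀ x, ‖B x‖ ≤ C)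
    (hlim : Tendsto B atTop (𝓝 L)) :
    (∀ f : ℝ →ᵇ E, ∃ u : ℝ → E, (∀ x, HasDerivAt u (B x (u x) + f x) x) ∧
      ∃ D : ℝ, ∀ x, 0 ≤ x → ‖u x‖ ≤ D) ∧
    Module.finrank ℂ (stabE (L : E →ₗ[ℂ] E)) ≤
      Module.finrank ℂ (LinearMap.range (evalAt B 0)) := by
  obtain ⟨ε, hε, hpert⟩ := small_pert L hL
  obtain ⟨T, hT⟩ : ∃ T : ℝ, ∀ x, T ≤ x → ‖B x - L‖ ≤ ε := by
    have := (Metric.tendsto_atTop.1 hlim) ε hε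
    obtain ⟨T, hT⟩ := this
    exact ⟨T, fun x hx => by rw [← dist_eq_norm]; exact (hT x hx).le⟩
  obtain ⟨h1, J, hJ, h2⟩ := hpert (fun x => B (max x 0 + T))
    (hB.comp ((continuous_id.max continuous_const).add continuous_const))
    (fun x => hT _ (by have := le_max_right x 0; linarith))
  constructor
  · intro f
    obtain ⟨w, hw⟩ := h1
      (f.compContinuous ⟨fun x => x + T, continuous_id.add continuous_const⟩)
    obtain ⟨u, hu0, hu⟩ := global_exists_at B hB C hBC f T (w 0)
    refine ⟨u, hu, ?_⟩
    have heq : ∀ x, T ≤ x → u x = w (x - T) := by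
      refine sol_unique_right B C hBC f u (fun x => w (x - T)) T (fun x _ => hu x) ?_ (by simpa using hu0)
      intro x hx
      have h := (hw (x - T)).comp_sub_const x T
      simpa [max_eq_left (sub_nonneg.2 hx)] using h
    refine bdd_extend u (continuous_iff_continuousAt.2 fun x => (hu x).continuousAt) T ‖w‖ ?_
    intro x hx
    rw [heq x hx]
    exact w.norm_coe_le_norm _
  · have hle : LinearMap.range J ≤ LinearMap.range (evalAt B T) := by
      rintro _ ⟨p, rfl⟩
      obtain ⟨v, hv0, hv, D, hD⟩ := h2 p
      obtain ⟨u, hu0, hu⟩ := global_exists_at B hB C hBC 0 T (v 0)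
      have heq : ∀ x, T ≤ x → u x = v (x - T) := by
        refine sol_unique_right B C hBC 0 u (fun x => v (x - T)) T (fun x _ => hu x) ?_ (by simpa using hu0)
        intro x hx
        have h := (hv (x - T) (sub_nonneg.2 hx)).comp_sub_const x T
        simpa [max_eq_left (sub_nonneg.2 hx)] using h
      refine ⟨⟨u, fun x => by simpa using hu x,
        bdd_extend u (continuous_iff_continuousAt.2 fun x => (hu x).continuousAt) T D ?_⟩, ?_⟩
      · intro x hx
        rw [heq x hx]
        exact hD _ (sub_nonneg.2 hx)
      · rw [evalAt_apply, ← hv0]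
        exact hu0
    calc Module.finrank ℂ (stabE (L : E →ₗ[ℂ] E)) = Module.finrank ℂ (LinearMap.range J) :=
          (LinearMap.finrank_range_of_inj hJ).symm
      _ ≤ Module.finrank ℂ (LinearMap.range (evalAt B T)) := Submodule.finrank_mono hle
      _ = Module.finrank ℂ (LinearMap.range (evalAt B 0)) := by
        rw [LinearMap.finrank_range_of_inj (evalAt_inj B C hBC T),
          LinearMap.finrank_range_of_inj (evalAt_inj B C hBC 0)]

/-- the linear algebra -/
lemma lin_alg {F : Type*} [AddCommGroup F] [Module ℂ F] [FiniteDimensional ℂ E]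
    [FiniteDimensional ℂ F] (S U : Submodule ℂ E)
    (l : E →ₗ[ℂ] F) (hdim : Module.finrank ℂ E + Module.finrank ℂ F ≤
      Module.finrank ℂ U + Module.finrank ℂ S)
    (h0 : ∀ p, p ∈ S → p ∈ U → l p = 0 → p = 0) :
    S ⊔ U = ⊤ ∧ ∀ c, ∃ p, p ∈ S ∧ p ∈ U ∧ l p = c := by
  let g : (S ⊓ U : Submodule ℂ E) →ₗ[ℂ] F := l.comp (S ⊓ U).subtype
  have hg : Function.Injective g := by
    rw [injective_iff_map_eq_zero]
    intro p hp
    exact Subtype.ext (h0 p p.2.1 p.2.2 hp)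
  have h1 := LinearMap.finrank_le_finrank_of_injective hg
  have h2 := Submodule.finrank_sup_add_finrank_inf_eq S U
  have h3 := Submodule.finrank_le (S ⊔ U)
  refine ⟨Submodule.eq_top_of_finrank_eq (by omega), fun c => ?_⟩
  have hs : Function.Surjective g :=
    (LinearMap.injective_iff_surjective_of_finrank_eq_finrank (by omega)).1 hg
  obtain ⟨p, hp⟩ := hs c
  exact ⟨p, p.2.1, p.2.2, hp⟩

lemma refl_sol (B : ℝ → E →L[ℂ] E) (f : ℝ → E) (u : ℝ → E)
    (hu : ∀ x, HasDerivAt u (-B (-x) (u x) - f (-x)) x) (x : ℝ) :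
    HasDerivAt (fun x => u (-x)) (B x (u (-x)) + f x) x := by
  have h1 := (hu (-x)).scomp x (hasDerivAt_neg x)
  refine HasDerivAt.congr_deriv (f := fun x => u (-x)) h1 ?_
  simp
  abel

lemma two_sided {F : Type*} [AddCommGroup F] [Module ℂ F] [FiniteDimensional ℂ E]
    [FiniteDimensional ℂ F] (Lp Lm : E →L[ℂ] E)
    (hLp : ∀ μ : ℂ, Module.End.HasEigenvalue (Lp : E →ₗ[ℂ] E) μ → μ.re ≠ 0)
    (hLm : ∀ μ : ℂ, Module.End.HasEigenvalue ((-Lm : E →L[ℂ] E) : E →ₗ[ℂ] E) μ → μ.re ≠ 0)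
    (B : ℝ → E →L[ℂ] E) (hB : Continuous B) (C : ℝ) (hBC : ∀ x, ‖B x‖ ≤ C)
    (hlimp : Tendsto B atTop (𝓝 Lp)) (hlimm : Tendsto B atBot (𝓝 Lm))
    (l : E →ₗ[ℂ] F) (hdim : Module.finrank ℂ E + Module.finrank ℂ F ≤
      Module.finrank ℂ (stabE ((-Lm : E →L[ℂ] E) : E →ₗ[ℂ] E)) +
      Module.finrank ℂ (stabE (Lp : E →ₗ[ℂ] E)))
    (huniq : ∀ u : ℝ → E, (∀ x, HasDerivAt u (B x (u x)) x) → (∃ D : ℝ, ∀ x, ‖u x‖ ≤ D) →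
      l (u 0) = 0 → u = 0) (f : ℝ →ᵇ E) (c : F) :
    ∃ u : ℝ → E, (∀ x, HasDerivAt u (B x (u x) + f x) x) ∧ (∃ D : ℝ, ∀ x, ‖u x‖ ≤ D) ∧
      l (u 0) = c := by
  let B' : ℝ → E →L[ℂ] E := fun x => -B (-x)
  obtain ⟨hp1, hp2⟩ := half_line Lp hLp B hB C hBC hlimp
  obtain ⟨hm1, hm2⟩ := half_line (-Lm) hLm B' (hB.comp continuous_neg).neg C
    (fun x => by simpa [B'] using hBC (-x)) (hlimm.comp tendsto_neg_atTop_atBot).neg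
  have hbdd : ∀ u : ℝ → E, (∃ D : ℝ, ∀ x, 0 ≤ x → ‖u x‖ ≤ D) →
      (∃ D : ℝ, ∀ x, 0 ≤ x → ‖u (-x)‖ ≤ D) → ∃ D : ℝ, ∀ x, ‖u x‖ ≤ D := by
    rintro u ⟨D, hD⟩ ⟨D', hD'⟩
    refine ⟨max D D', fun x => ?_⟩
    rcases le_total 0 x with h | h
    · exact (hD x h).trans (le_max_left _ _)
    · have := hD' (-x) (by linarith)
      rw [neg_neg] at this
      exact this.trans (le_max_right _ _)
  have hrefl : ∀ v : solSpace B', ∀ x,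
      HasDerivAt (fun x => (v : ℝ → E) (-x)) (B x ((v : ℝ → E) (-x))) x := by
    intro v x
    have := refl_sol B 0 (v : ℝ → E) (fun x => by simpa [B'] using v.2.1 x) x
    simpa using this
  have glue : ∀ p, p ∈ LinearMap.range (evalAt B 0) → p ∈ LinearMap.range (evalAt B' 0) →
      ∃ u : ℝ → E, (∀ x, HasDerivAt u (B x (u x)) x) ∧ (∃ D : ℝ, ∀ x, ‖u x‖ ≤ D) ∧ u 0 = p := by
    rintro p ⟨u, rfl⟩ ⟨v, hv⟩
    have heq : (u : ℝ → E) = fun x => (v : ℝ → E) (-x) := by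
      refine sol_unique B C hBC 0 _ _ (fun x => by simpa using u.2.1 x)
        (fun x => by simpa using hrefl v x) 0 ?_
      simpa [evalAt_apply] using hv.symm
    refine ⟨u, u.2.1, hbdd _ u.2.2 ?_, rfl⟩
    obtain ⟨D, hD⟩ := v.2.2
    exact ⟨D, fun x hx => by rw [heq]; simpa using hD x hx⟩
  obtain ⟨htop, hsurj⟩ := lin_alg (LinearMap.range (evalAt B 0)) (LinearMap.range (evalAt B' 0)) l
    (by omega) (by
      intro p h1 h2 h3
      obtain ⟨u, hu, hub, rfl⟩ := glue p h1 h2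
      rw [huniq u hu hub h3]; rfl)
  obtain ⟨up, hup, Dp, hDp⟩ := hp1 f
  obtain ⟨um, hum, Dm, hDm⟩ := hm1 (-(reflB f))
  have hum' := refl_sol B f um (fun x => by
    refine (hum x).congr_deriv ?_
    simp [B', reflB_apply, sub_eq_add_neg])
  obtain ⟨a, ⟨s, rfl⟩, b, ⟨t, rfl⟩, hab⟩ := Submodule.mem_sup.1
    (htop ▸ Submodule.mem_top : up 0 - um 0 ∈ _)
  obtain ⟨Ds, hDs⟩ := s.2.2
  obtain ⟨Dt, hDt⟩ := t.2.2
  let w : ℝ → E := fun x => up x - (s : ℝ → E) x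
  have hw : ∀ x, HasDerivAt w (B x (w x) + f x) x := fun x => by
    refine ((hup x).sub (s.2.1 x)).congr_deriv ?_
    simp only [w, map_sub]
    abel
  have hweq : w = fun x => um (-x) + (t : ℝ → E) (-x) := by
    refine sol_unique B C hBC f _ _ hw (fun x => ?_) 0 ?_
    · refine ((hum' x).add (hrefl t x)).congr_deriv ?_
      simp only [map_add]
      abel
    · simp only [evalAt_apply] at hab
      simp only [w, neg_zero]
      rw [sub_eq_iff_eq_add, add_assoc, add_comm (t.1 0), hab]
      abel
  have hwb : ∃ D : ℝ, ∀ x, ‖w x‖ ≤ D := by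
    refine hbdd w ⟨Dp + Ds, fun x hx => ?_⟩ ⟨Dm + Dt, fun x hx => ?_⟩
    · exact (norm_sub_le _ _).trans (add_le_add (hDp x hx) (hDs x hx))
    · rw [hweq]
      simp only [neg_neg]
      exact (norm_add_le _ _).trans (add_le_add (hDm x hx) (hDt x hx))
  obtain ⟨p, hp1, hp2, hp3⟩ := hsurj (c - l (w 0))
  obtain ⟨z, hz, ⟨Dz, hDz⟩, rfl⟩ := glue p hp1 hp2
  obtain ⟨Dw, hDw⟩ := hwb
  refine ⟨fun x => w x + z x, fun x => ?_, ⟨Dw + Dz, fun x => ?_⟩, ?_⟩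
  · refine ((hw x).add (hz x)).congr_deriv ?_
    simp only [map_add]
    abel
  · exact (norm_add_le _ _).trans (add_le_add (hDw x) (hDz x))
  · rw [map_add, hp3]
    abel

end generic

section concrete
open Set Filter Topology BoundedContinuousFunction

/-- The complexified matrix as a continuous linear map, real-linearly in the matrix. -/
def LamM (n : ℕ) : Matrix (Fin n) (Fin n) ℝ →ₗ[ℝ] ((Fin n → ℂ) →L[ℂ] (Fin n → ℂ)) where
  toFun M := LinearMap.toContinuousLinearMap (endOf M)
  map_add' M N := by
    ext v i
    simp [endOf, Matrix.map_add]
  map_smul' c M := by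
    ext v i
    simp [endOf, Matrix.mulVec, dotProduct, Finset.mul_sum, mul_assoc]

lemma LamM_apply {n : ℕ} (M : Matrix (Fin n) (Fin n) ℝ) (v : Fin n → ℂ) (i : Fin n) :
    LamM n M v i = ∑ j, (M i j : ℂ) * v j := rfl

lemma LamM_coe {n : ℕ} (M : Matrix (Fin n) (Fin n) ℝ) :
    ((LamM n M : (Fin n → ℂ) →L[ℂ] (Fin n → ℂ)) : (Fin n → ℂ) →ₗ[ℂ] (Fin n → ℂ)) = endOf M := rfl

lemma LamM_cont (n : ℕ) : Continuous (LamM n) := LinearMap.continuous_of_finiteDimensional _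

lemma LamM_bdd {n : ℕ} (A : ℝ → Matrix (Fin n) (Fin n) ℝ) (CA : ℝ)
    (h : ∀ (x : ℝ) (i j : Fin n), |A x i j| ≤ CA) : ∃ C : ℝ, ∀ x, ‖LamM n (A x)‖ ≤ C := by
  have hK : IsCompact (Set.pi univ fun _ : Fin n => Set.pi univ fun _ : Fin n => Icc (-CA) CA) :=
    isCompact_univ_pi fun _ => isCompact_univ_pi fun _ => isCompact_Icc
  obtain ⟨C, hC⟩ := hK.exists_bound_of_continuousOn (f := fun M => LamM n M)
    (LamM_cont n).continuousOn
  exact ⟨C, fun x => hC (A x) fun i _ j _ => abs_le.1 (h x i j)⟩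

lemma stab_neg {n : ℕ} (M : Matrix (Fin n) (Fin n) ℝ) :
    stabE (-endOf M) = unstableSubspace M := by
  have hk : ∀ (μ : ℂ) (k : ℕ), LinearMap.ker ((-endOf M - μ • 1) ^ k) =
      LinearMap.ker ((endOf M - (-μ) • 1) ^ k) := by
    intro μ k
    have hN : (-endOf M - μ • 1 : Module.End ℂ (Fin n → ℂ)) = -(endOf M - (-μ) • 1) := by
      refine LinearMap.ext fun v => ?_
      simp only [LinearMap.sub_apply, LinearMap.neg_apply, LinearMap.smul_apply,
        Module.End.one_apply, neg_smul]
      abel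
    have hp := neg_pow (endOf M - (-μ) • 1 : Module.End ℂ (Fin n → ℂ)) k
    have hq : ∀ v, ((-endOf M - μ • 1 : Module.End ℂ (Fin n → ℂ)) ^ k) v =
        (-1 : ℂ) ^ k • ((endOf M - (-μ) • 1 : Module.End ℂ (Fin n → ℂ)) ^ k) v := by
      intro v
      rw [hN]
      refine (LinearMap.congr_fun hp v).trans ?_
      rcases Nat.even_or_odd k with h | h
      · rw [h.neg_one_pow, h.neg_one_pow, one_mul, one_smul]
      · rw [h.neg_one_pow, h.neg_one_pow, neg_one_mul, neg_one_smul]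
        rfl
    ext v
    rw [LinearMap.mem_ker, LinearMap.mem_ker, hq]
    exact smul_eq_zero_iff_right (pow_ne_zero _ (by norm_num))
  apply le_antisymm
  · refine iSup₂_le fun μ hμ => ?_
    have hμ' : 0 < (-μ).re := by
      have : μ.re < 0 := hμ
      simpa using this
    refine le_trans (le_of_eq ?_) (le_iSup₂ (f := fun (μ : ℂ) (_ : μ ∈ {μ : ℂ | 0 < μ.re}) =>
      genEig (endOf M) μ) (-μ) hμ')
    simp_rw [hk]
    rfl
  · refine iSup₂_le fun μ hμ => ?_
    have hμ' : (-μ).re < 0 := by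
      have : 0 < μ.re := hμ
      simpa using this
    refine le_trans (le_of_eq ?_) (le_iSup₂ (f := fun (μ : ℂ) (_ : μ ∈ {μ : ℂ | μ.re < 0}) =>
      ⨆ k : ℕ, LinearMap.ker ((-endOf M - μ • 1) ^ k)) (-μ) hμ')
    simp_rw [hk, neg_neg]
    rfl

lemma hyp_neg {n : ℕ} (M : Matrix (Fin n) (Fin n) ℝ) (h : IsHyperbolicMat M) (μ : ℂ)
    (hμ : Module.End.HasEigenvalue (-endOf M) μ) : μ.re ≠ 0 := by
  obtain ⟨v, hv⟩ := hμ.exists_hasEigenvector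
  have h1 : Module.End.HasEigenvalue (endOf M) (-μ) := by
    refine Module.End.hasEigenvalue_of_hasEigenvector (x := v) ?_
    rw [Module.End.hasEigenvector_iff, Module.End.mem_eigenspace_iff] at hv ⊢
    refine ⟨?_, hv.2⟩
    have := hv.1
    rw [LinearMap.neg_apply] at this
    rw [neg_smul, ← this, neg_neg]
  simpa using h (-μ) h1

/-- Coordinate-wise real functional (real or imaginary part) of a complex solution. -/
lemma proj_sol {n : ℕ} (φ : ℂ →L[ℝ] ℝ) (M : Matrix (Fin n) (Fin n) ℝ) (w : ℝ → Fin n → ℂ)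
    (f : Fin n → ℂ) (x : ℝ) (hw : HasDerivAt w (LamM n M (w x) + f) x) :
    HasDerivAt (fun x i => φ (w x i)) (M *ᵥ (fun i => φ (w x i)) + fun i => φ (f i)) x := by
  rw [hasDerivAt_pi] at hw ⊢
  intro i
  have h := φ.hasFDerivAt.comp_hasDerivAt x (hw i)
  refine HasDerivAt.congr_deriv (f := fun x => φ (w x i)) h ?_
  simp only [Pi.add_apply, map_add, LamM_apply, map_sum, Matrix.mulVec, dotProduct]
  congr 1
  refine Finset.sum_congr rfl fun j _ => ?_
  rw [← smul_eq_mul (M i j), ← map_smul, Complex.real_smul]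

lemma proj_bdd {n : ℕ} (φ : ℂ →L[ℝ] ℝ) (w : ℝ → Fin n → ℂ) (D : ℝ) (hD : ∀ x, ‖w x‖ ≤ D) :
    ∀ x, ‖(fun i => φ (w x i))‖ ≤ ‖φ‖ * D := by
  intro x
  have hD0 : 0 ≤ D := (norm_nonneg _).trans (hD x)
  refine (pi_norm_le_iff_of_nonneg (by positivity)).2 fun i => ?_
  refine (φ.le_opNorm _).trans ?_
  gcongr
  exact (norm_le_pi_norm _ i).trans (hD x)

lemma isBddSol_of_deriv {n : ℕ} (A : ℝ → Matrix (Fin n) (Fin n) ℝ) (hA : Continuous A)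
    (u : ℝ → Fin n → ℝ) (hu : ∀ x, HasDerivAt u (A x *ᵥ u x) x) (D : ℝ) (hD : ∀ x, ‖u x‖ ≤ D) :
    IsBddSol A (fun _ => 0) u := by
  have huc : Continuous u := continuous_iff_continuousAt.2 fun x => (hu x).continuousAt
  refine ⟨huc, ⟨D, hD⟩, fun x => ?_⟩
  simp only [add_zero]
  rw [intervalIntegral.integral_eq_sub_of_hasDerivAt (fun y _ => hu y)
    ((hA.matrix_mulVec huc).intervalIntegrable _ _)]
  abel

lemma tendsto_mat {n : ℕ} (A : ℝ → Matrix (Fin n) (Fin n) ℝ) (M : Matrix (Fin n) (Fin n) ℝ)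
    (F : Filter ℝ) (g : ℝ → ℝ) (hg : Tendsto g F (𝓝 0))
    (h : ∀ᶠ x in F, ∀ i j, |A x i j - M i j| ≤ g x) : Tendsto A F (𝓝 M) := by
  refine tendsto_pi_nhds.2 fun i => tendsto_pi_nhds.2 fun j => ?_
  rw [tendsto_iff_norm_sub_tendsto_zero]
  refine squeeze_zero' (Eventually.of_forall fun x => norm_nonneg _) ?_ hg
  filter_upwards [h] with x hx
  exact hx i j

/-- Removal of a merely measurable forcing: `F` is a primitive of `f`, `G` a smoothing of `F`. -/
lemma smoothing {n : ℕ} (f : ℝ → Fin n → ℝ) (hf : Measurable f) (C : ℝ) (hC : ∀ x, ‖f x‖ ≤ C) :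
    (∀ a b, IntervalIntegrable f volume a b) ∧
    ∃ d g : ℝ → Fin n → ℝ, Continuous d ∧ Continuous g ∧ (∀ x, ‖d x‖ ≤ C) ∧ (∀ x, ‖g x‖ ≤ C) ∧
      ∀ x, d x = d 0 + ∫ s in (0:ℝ)..x, (f s - g s) := by
  have hfi : ∀ a b, IntervalIntegrable f volume a b := by
    intro a b
    refine (intervalIntegrable_const (c := C) (μ := volume) (a := a) (b := b)).mono_fun
      hf.aestronglyMeasurable.restrict ?_
    refine Eventually.of_forall fun x => ?_
    exact (hC x).trans (le_abs_self C)
  refine ⟨hfi, ?_⟩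
  let F : ℝ → Fin n → ℝ := fun x => ∫ s in (0:ℝ)..x, f s
  have hFc : Continuous F := continuous_primitive hfi 0
  have hFi : ∀ a b, IntervalIntegrable F volume a b := fun a b => hFc.intervalIntegrable a b
  have hFsub : ∀ a b, F b - F a = ∫ s in a..b, f s := fun a b =>
    intervalIntegral.integral_interval_sub_left (hfi _ _) (hfi _ _)
  have hFl : ∀ a b, ‖F b - F a‖ ≤ C * |b - a| := fun a b => by
    rw [hFsub]
    exact norm_integral_le_of_norm_le_const fun s _ => hC s
  let P : ℝ → Fin n → ℝ := fun x => ∫ s in (0:ℝ)..x, F s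
  have hP : ∀ x, HasDerivAt P (F x) x := fun x =>
    integral_hasDerivAt_right (hFi _ _) (hFc.stronglyMeasurableAtFilter _ _) hFc.continuousAt
  let G : ℝ → Fin n → ℝ := fun x => P (x + 1) - P x
  have hG : ∀ x, HasDerivAt G (F (x + 1) - F x) x := fun x =>
    ((hP (x + 1)).comp_add_const x 1).sub (hP x)
  have hGc : Continuous G := continuous_iff_continuousAt.2 fun x => (hG x).continuousAt
  have hgc : Continuous fun x => F (x + 1) - F x :=
    (hFc.comp (continuous_id.add continuous_const)).sub hFc
  refine ⟨fun x => F x - G x, fun x => F (x + 1) - F x, hFc.sub hGc, hgc, ?_, ?_, ?_⟩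
  · intro x
    have h1 : F x - G x = ∫ s in x..(x + 1), (F x - F s) := by
      rw [intervalIntegral.integral_sub intervalIntegrable_const (hFi _ _)]
      have : P (x + 1) - P x = ∫ s in x..(x + 1), F s :=
        intervalIntegral.integral_interval_sub_left (hFi _ _) (hFi _ _)
      simp [G, this]
    change ‖F x - G x‖ ≤ C
    rw [h1]
    have h2 : ‖∫ s in x..(x + 1), (F x - F s)‖ ≤ C * |x + 1 - x| := by
      refine norm_integral_le_of_norm_le_const fun s hs => ?_
      rw [uIoc_of_le (by linarith)] at hs
      refine (hFl s x).trans ?_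
      have hC0 : 0 ≤ C := (norm_nonneg _).trans (hC 0)
      refine mul_le_of_le_one_right hC0 ?_
      rw [abs_le]
      constructor <;> linarith [hs.1, hs.2]
    simpa using h2
  · intro x
    simpa using hFl x (x + 1)
  · intro x
    rw [intervalIntegral.integral_sub (hfi _ _) (hgc.intervalIntegrable _ _),
      intervalIntegral.integral_eq_sub_of_hasDerivAt (fun y _ => hG y)
        (hgc.intervalIntegrable _ _)]
    have : F 0 = 0 := intervalIntegral.integral_same
    simp only [this]
    change F x - G x = 0 - G 0 + (F x - (G x - G 0))
    abel

/-- entrywise complexification -/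
def cplx {n : ℕ} (v : Fin n → ℝ) : Fin n → ℂ := fun i => (v i : ℂ)

lemma cplx_cont {n : ℕ} : Continuous (cplx (n := n)) :=
  continuous_pi fun i => Complex.continuous_ofReal.comp (continuous_apply i)

lemma cplx_norm {n : ℕ} (v : Fin n → ℝ) : ‖cplx v‖ ≤ ‖v‖ := by
  refine (pi_norm_le_iff_of_nonneg (norm_nonneg _)).2 fun i => ?_
  simp only [cplx, Complex.norm_real]
  exact norm_le_pi_norm v i

end concrete

/-- **Solvability of linear ODE systems with asymptotically hyperbolic coefficients
and linear constraints.** -/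
theorem linear_ode_solvability
    (n m : ℕ) (hn : 1 ≤ n) (hm : m ≤ n)
    (A : ℝ → Matrix (Fin n) (Fin n) ℝ)
    (hAcont : Continuous A)
    (hAbdd : ∃ CA : ℝ, ∀ (x : ℝ) (i j : Fin n), |A x i j| ≤ CA)
    (ℓ : Fin m → Fin n → ℝ) (hℓ : LinearIndependent ℝ ℓ)
    -- (1) exponential asymptotics to hyperbolic endpoint matrices
    (Am Ap : Matrix (Fin n) (Fin n) ℝ)
    (hAm : IsHyperbolicMat Am) (hAp : IsHyperbolicMat Ap)
    (C₀ η : ℝ) (hC₀ : 0 < C₀) (hη : 0 < η)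
    (hdecm : ∀ x ≤ (0 : ℝ), ∀ i j : Fin n, |A x i j - Am i j| ≤ C₀ * Real.exp (η * x))
    (hdecp : ∀ x : ℝ, 0 ≤ x → ∀ i j : Fin n, |A x i j - Ap i j| ≤ C₀ * Real.exp (-η * x))
    -- (2) dimension counting
    (hdim : Module.finrank ℂ (unstableSubspace Am) + Module.finrank ℂ (stableSubspace Ap)
      = n + m)
    -- (3) uniqueness for the homogeneous constrained problem
    (huniq : ∀ u : ℝ → Fin n → ℝ, IsBddSol A (fun _ => 0) u →
      (∀ i : Fin m, ℓ i ⬝ᵥ u 0 = 0) → u = 0) :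
    -- conclusion: unique bounded solvability of the constrained inhomogeneous problem
    ∀ f : ℝ → Fin n → ℝ, Measurable f → (∃ Cf : ℝ, ∀ x, ‖f x‖ ≤ Cf) →
      ∀ c : Fin m → ℝ,
        ∃! u : ℝ → Fin n → ℝ, IsBddSol A f u ∧ ∀ i : Fin m, ℓ i ⬝ᵥ u 0 = c i := by
  classical
  obtain ⟨CA, hCA⟩ := hAbdd
  obtain ⟨CB, hCB⟩ := LamM_bdd A CA hCA
  have hCB0 : 0 ≤ CB := (norm_nonneg _).trans (hCB 0)
  have hBc : Continuous fun x => LamM n (A x) := (LamM_cont n).comp hAcont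
  have hlimp : Filter.Tendsto (fun x => LamM n (A x)) Filter.atTop (nhds (LamM n Ap)) := by
    refine ((LamM_cont n).tendsto Ap).comp (tendsto_mat A Ap _
      (fun x => C₀ * Real.exp (-η * x)) ?_ ?_)
    · have h1 : Filter.Tendsto (fun x : ℝ => -η * x) Filter.atTop Filter.atBot :=
        Filter.tendsto_id.const_mul_atTop_of_neg (by linarith)
      simpa using (Real.tendsto_exp_atBot.comp h1).const_mul C₀
    · filter_upwards [Filter.eventually_ge_atTop 0] with x hx
      exact hdecp x hx
  have hlimm : Filter.Tendsto (fun x => LamM n (A x)) Filter.atBot (nhds (LamM n Am)) := by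
    refine ((LamM_cont n).tendsto Am).comp (tendsto_mat A Am _
      (fun x => C₀ * Real.exp (η * x)) ?_ ?_)
    · have h1 : Filter.Tendsto (fun x : ℝ => η * x) Filter.atBot Filter.atBot :=
        Filter.tendsto_id.const_mul_atBot hη
      simpa using (Real.tendsto_exp_atBot.comp h1).const_mul C₀
    · filter_upwards [Filter.eventually_le_atBot 0] with x hx
      exact hdecm x hx
  let l : (Fin n → ℂ) →ₗ[ℂ] (Fin m → ℂ) := Matrix.mulVecLin ((Matrix.of ℓ).map Complex.ofReal)
  have hl : ∀ (φ : ℂ →L[ℝ] ℝ) (v : Fin n → ℂ) (i : Fin m),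
      φ (l v i) = ℓ i ⬝ᵥ fun j => φ (v j) := by
    intro φ v i
    have h1 : l v i = ∑ j, (ℓ i j : ℂ) * v j := rfl
    rw [h1, map_sum]
    refine Finset.sum_congr rfl fun j _ => ?_
    rw [← smul_eq_mul (ℓ i j), ← map_smul, Complex.real_smul]
  have hstab : stabE (((-LamM n Am : (Fin n → ℂ) →L[ℂ] (Fin n → ℂ))) :
      (Fin n → ℂ) →ₗ[ℂ] (Fin n → ℂ)) = unstableSubspace Am := stab_neg Am
  have huniqC : ∀ u : ℝ → Fin n → ℂ, (∀ x, HasDerivAt u (LamM n (A x) (u x)) x) →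
      (∃ D : ℝ, ∀ x, ‖u x‖ ≤ D) → l (u 0) = 0 → u = 0 := by
    rintro u hu ⟨D, hD⟩ h0
    have key : ∀ φ : ℂ →L[ℝ] ℝ, (fun x i => φ (u x i)) = (0 : ℝ → Fin n → ℝ) := by
      intro φ
      refine huniq _ (isBddSol_of_deriv A hAcont _ (fun x => ?_) _ (proj_bdd φ u D hD)) ?_
      · have h1 := proj_sol φ (A x) u 0 x (by simpa using hu x)
        refine h1.congr_deriv ?_
        ext i
        simp
      · intro i
        rw [← hl, h0]
        simp
    funext x i
    apply Complex.ext
    · exact congrFun (congrFun (key Complex.reCLM) x) i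
    · exact congrFun (congrFun (key Complex.imCLM) x) i
  intro f hf hfb c
  obtain ⟨Cf, hCf⟩ := hfb
  have hCf0 : 0 ≤ Cf := (norm_nonneg _).trans (hCf 0)
  obtain ⟨hfi, d, g, hdc, hgc, hdb, hgb, hd⟩ := smoothing f hf Cf hCf
  let h : BoundedContinuousFunction ℝ (Fin n → ℂ) :=
    BoundedContinuousFunction.ofNormedAddCommGroup
      (fun x => LamM n (A x) (cplx (d x)) + cplx (g x))
      ((hBc.clm_apply (cplx_cont.comp hdc)).add (cplx_cont.comp hgc)) (CB * Cf + Cf) (by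
        intro x
        refine (norm_add_le _ _).trans (add_le_add ?_ ((cplx_norm _).trans (hgb x)))
        refine ((LamM n (A x)).le_opNorm _).trans ?_
        exact mul_le_mul (hCB x) ((cplx_norm _).trans (hdb x)) (norm_nonneg _) hCB0)
  obtain ⟨w, hw, ⟨D, hD⟩, hwl⟩ := two_sided (LamM n Ap) (LamM n Am) hAp (hyp_neg Am hAm)
    (fun x => LamM n (A x)) hBc CB hCB hlimp hlimm l (by
      rw [hstab, Module.finrank_fin_fun, Module.finrank_fin_fun]
      exact hdim.ge) huniqC h (cplx fun i => c i - ℓ i ⬝ᵥ d 0)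
  let r : ℝ → Fin n → ℝ := fun x i => Complex.reCLM (w x i)
  have hr : ∀ x, HasDerivAt r (A x *ᵥ r x + (A x *ᵥ d x + g x)) x := by
    intro x
    refine (proj_sol Complex.reCLM (A x) w (h x) x (hw x)).congr_deriv ?_
    congr 1
    ext i
    change Complex.re (LamM n (A x) (cplx (d x)) i + cplx (g x) i) = _
    rw [LamM_apply]
    simp [cplx, Matrix.mulVec, dotProduct]
  have hrc : Continuous r := continuous_iff_continuousAt.2 fun x => (hr x).continuousAt
  have hrb := proj_bdd Complex.reCLM w D hD
  have hintA : ∀ u : ℝ → Fin n → ℝ, Continuous u → ∀ a b,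
      IntervalIntegrable (fun s => A s *ᵥ u s + f s) volume a b := fun u hu a b =>
    ((hAcont.matrix_mulVec hu).intervalIntegrable a b).add (hfi a b)
  have hUc : Continuous fun x => r x + d x := hrc.add hdc
  have hU : IsBddSol A f (fun x => r x + d x) ∧ ∀ i : Fin m, ℓ i ⬝ᵥ (r 0 + d 0) = c i := by
   refine ⟨⟨hUc, ⟨‖Complex.reCLM‖ * D + Cf, fun x => ?_⟩, fun x => ?_⟩, fun i => ?_⟩
   · exact (norm_add_le _ _).trans (add_le_add (hrb x) (hdb x))
   · have hc1 : Continuous fun x => A x *ᵥ r x + (A x *ᵥ d x + g x) :=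
       (hAcont.matrix_mulVec hrc).add ((hAcont.matrix_mulVec hdc).add hgc)
     have h1 := intervalIntegral.integral_eq_sub_of_hasDerivAt (a := 0) (b := x)
       (fun y _ => hr y) (hc1.intervalIntegrable _ _)
     have h2 : ∫ s in (0:ℝ)..x, (A s *ᵥ (r s + d s) + f s) =
         (∫ s in (0:ℝ)..x, (A s *ᵥ r s + (A s *ᵥ d s + g s))) + ∫ s in (0:ℝ)..x, (f s - g s) := by
       rw [← intervalIntegral.integral_add (hc1.intervalIntegrable _ _)
         ((hfi _ _).sub (hgc.intervalIntegrable _ _))]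
       refine intervalIntegral.integral_congr fun s _ => ?_
       simp only [Matrix.mulVec_add]
       abel
     have h3 := hd x
     rw [← sub_eq_iff_eq_add'] at h3
     rw [h2, h1, ← h3]
     change r x + d x = r 0 + d 0 + (r x - r 0 + (d x - d 0))
     abel
   · have h1 := hl Complex.reCLM (w 0) i
     rw [hwl] at h1
     have h2 : ℓ i ⬝ᵥ r 0 = c i - ℓ i ⬝ᵥ d 0 := by
       rw [← h1]
       simp [cplx]
     rw [dotProduct_add, h2]
     ring
  refine ⟨fun x => r x + d x, hU, ?_⟩
  obtain ⟨⟨-, ⟨CU, hCU⟩, hUe⟩, hUl⟩ := hU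
  rintro v ⟨⟨hvc, ⟨Cv, hCv⟩, hv⟩, hvl⟩
  have hz := huniq (fun x => v x - (r x + d x)) ⟨hvc.sub hUc, ⟨Cv + CU, fun x =>
    (norm_sub_le _ _).trans (add_le_add (hCv x) (hCU x))⟩, fun x => by
      have h1 : ∫ s in (0:ℝ)..x, (A s *ᵥ (v s - (r s + d s)) + 0) =
          (∫ s in (0:ℝ)..x, (A s *ᵥ v s + f s)) -
            ∫ s in (0:ℝ)..x, (A s *ᵥ (r s + d s) + f s) := by
        rw [← intervalIntegral.integral_sub (hintA v hvc _ _) (hintA _ hUc _ _)]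
        refine intervalIntegral.integral_congr fun s _ => ?_
        simp only [Matrix.mulVec_sub]
        abel
      have h2 := hv x
      have h3 := hUe x
      rw [← sub_eq_iff_eq_add'] at h2 h3
      rw [h1, ← h2, ← h3]
      change v x - (r x + d x) = v 0 - (r 0 + d 0) + (v x - v 0 - (r x + d x - (r 0 + d 0)))
      abel⟩ (fun i => by
        change ℓ i ⬝ᵥ (v 0 - (r 0 + d 0)) = 0
        rw [dotProduct_sub, hvl, hUl, sub_self])
  funext x
  exact sub_eq_zero.1 (congrFun hz x)
end
end

section
/- Kawashima compensator for the nine-moment system of the linearized Landau equation: There exist a linear map K : M₉ → M₉ that is antisymmetric with respect to the L² inner product (⟨Kg, h⟩ = −⟨g, Kh⟩ for all g, h ∈ M₉) and a constant C_K > 0 such that for every g ∈ M₉, ‖P g‖²_{L²} ≤ C_K ( ⟨K P_{≤9}(v₁ g) − v₁ (K g), g⟩ + ‖⟨v⟩^{−100} P^⊥ g‖²_{L²} ), where v₁ g and v₁ (K g) denote pointwise products (which lie in L²(ℝ³) since g, Kg ∈ M₉). -/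
noncomputable section

open MeasureTheory Real

/-- Velocity space `ℝ³`. -/
abbrev V3 : Type := EuclideanSpace ℝ (Fin 3)

/-- The standard Maxwellian `μ₀(v) = (2π)^{-3/2} exp(−|v|²/2)`. -/
def mu0 (v : V3) : ℝ := (2 * π) ^ (-(3 : ℝ) / 2) * Real.exp (-‖v‖ ^ 2 / 2)

/-- The `L²(ℝ³)` inner product `⟨f, g⟩ = ∫ f g dv`. -/
def ip (f g : V3 → ℝ) : ℝ := ∫ v : V3, f v * g v

/-- The nine generating functions of `M₉`:
`√μ₀ · {1, v₁, v₂, v₃, |v|², v₁², v₁v₂, v₁v₃, |v|²v₁}`. -/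
def basis9 : Fin 9 → V3 → ℝ :=
  ![fun v => Real.sqrt (mu0 v),
    fun v => Real.sqrt (mu0 v) * v 0,
    fun v => Real.sqrt (mu0 v) * v 1,
    fun v => Real.sqrt (mu0 v) * v 2,
    fun v => Real.sqrt (mu0 v) * ‖v‖ ^ 2,
    fun v => Real.sqrt (mu0 v) * (v 0) ^ 2,
    fun v => Real.sqrt (mu0 v) * (v 0 * v 1),
    fun v => Real.sqrt (mu0 v) * (v 0 * v 2),
    fun v => Real.sqrt (mu0 v) * (‖v‖ ^ 2 * v 0)]

/-- The five generating functions of `M₅`: `√μ₀ · {1, v₁, v₂, v₃, |v|²}`. -/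
def basis5 : Fin 5 → V3 → ℝ := fun i => basis9 (Fin.castLE (by norm_num) i)

/-- The nine-moment space `M₉`. -/
def M9 : Submodule ℝ (V3 → ℝ) := Submodule.span ℝ (Set.range basis9)

/-- The macroscopic (five-moment) space `M₅`. -/
def M5 : Submodule ℝ (V3 → ℝ) := Submodule.span ℝ (Set.range basis5)

/-- `P` is the orthogonal projection of `L²(ℝ³)` onto the subspace `W`:
`P g ∈ W` and `g − P g ⊥ W` for every `g`. -/
def IsOrthProj (W : Submodule ℝ (V3 → ℝ)) (P : (V3 → ℝ) → (V3 → ℝ)) : Prop :=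
  ∀ g : V3 → ℝ, P g ∈ W ∧ ∀ h ∈ W, ip (fun v => g v - P g v) h = 0

/-! ### Gaussian moments -/

/-- Normalised one-dimensional Gaussian moments. -/
def rmom (b : ℝ) : ℕ → ℝ
  | 0 => 1
  | 1 => 0
  | (n + 2) => ((n : ℝ) + 1) / (2 * b) * rmom b n

lemma integrable_pow_gauss (b : ℝ) (hb : 0 < b) (n : ℕ) :
    Integrable (fun x : ℝ => x ^ n * Real.exp (-b * x ^ 2)) := by
  have h := integrable_rpow_mul_exp_neg_mul_sq hb (s := n) (by
    have : (0 : ℝ) ≤ n := Nat.cast_nonneg n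
    linarith)
  simpa [Real.rpow_natCast] using h

lemma hasDeriv_gauss (b x : ℝ) :
    HasDerivAt (fun x : ℝ => Real.exp (-b * x ^ 2)) (Real.exp (-b * x ^ 2) * (-b * (2 * x))) x := by
  have h := ((hasDerivAt_pow 2 x).const_mul (-b)).exp
  simpa using h

lemma integral_pow_gauss (b : ℝ) (hb : 0 < b) : ∀ n : ℕ,
    ∫ x : ℝ, x ^ n * Real.exp (-b * x ^ 2) = √(π / b) * rmom b n
  | 0 => by simpa [rmom] using integral_gaussian b
  | 1 => by
    have h := integral_eq_zero_of_hasDerivAt_of_integrable (hasDeriv_gauss b)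
      (by
        have := (integrable_pow_gauss b hb 1).const_mul (-2 * b)
        refine this.congr (Filter.Eventually.of_forall fun x => ?_)
        ring)
      (by simpa using integrable_pow_gauss b hb 0)
    have h2 : ∫ x : ℝ, Real.exp (-b * x ^ 2) * (-b * (2 * x))
        = (-2 * b) * ∫ x : ℝ, x ^ 1 * Real.exp (-b * x ^ 2) := by
      rw [← integral_const_mul]
      congr 1; ext x; ring
    rw [h2] at h
    have hb' : (-2 * b) ≠ 0 := by simp [hb.ne']
    simpa [rmom] using (mul_eq_zero.mp h).resolve_left hb'
  | (n + 2) => by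
    have ih := integral_pow_gauss b hb n
    have h := integral_eq_zero_of_hasDerivAt_of_integrable
      (f := fun x : ℝ => x ^ (n + 1) * Real.exp (-b * x ^ 2))
      (f' := fun x : ℝ => ((n : ℝ) + 1) * (x ^ n * Real.exp (-b * x ^ 2))
        - (2 * b) * (x ^ (n + 2) * Real.exp (-b * x ^ 2)))
      (fun x => by
        have := (hasDerivAt_pow (n + 1) x).mul (hasDeriv_gauss b x)
        refine this.congr_deriv ?_
        simp only [Nat.add_sub_cancel, Nat.cast_add, Nat.cast_one]
        ring)
      (((integrable_pow_gauss b hb n).const_mul _).sub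
        ((integrable_pow_gauss b hb (n + 2)).const_mul _))
      (integrable_pow_gauss b hb (n + 1))
    rw [integral_sub ((integrable_pow_gauss b hb n).const_mul _)
        ((integrable_pow_gauss b hb (n + 2)).const_mul _), integral_const_mul,
        integral_const_mul, ih] at h
    simp only [rmom]
    set I := ∫ x : ℝ, x ^ (n + 2) * Real.exp (-b * x ^ 2) with hI
    field_simp
    linarith

/-- Product form of the three-dimensional Gaussian monomials. -/
lemma gauss_mono_prod (b : ℝ) (i j k : ℕ) (v : V3) :
    Real.exp (-b * ‖v‖ ^ 2) * (v 0 ^ i * v 1 ^ j * v 2 ^ k)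
      = ∏ l : Fin 3, (v l) ^ ((![i, j, k] : Fin 3 → ℕ) l) * Real.exp (-b * (v l) ^ 2) := by
  rw [EuclideanSpace.real_norm_sq_eq]
  simp only [Fin.prod_univ_three, Fin.sum_univ_three]
  rw [mul_add, mul_add, Real.exp_add, Real.exp_add]
  simp
  ring

lemma gauss_mono (b : ℝ) (hb : 0 < b) (i j k : ℕ) :
    Integrable (fun v : V3 => Real.exp (-b * ‖v‖ ^ 2) * (v 0 ^ i * v 1 ^ j * v 2 ^ k)) ∧
    ∫ v : V3, Real.exp (-b * ‖v‖ ^ 2) * (v 0 ^ i * v 1 ^ j * v 2 ^ k)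
      = √(π / b) ^ 3 * (rmom b i * rmom b j * rmom b k) := by
  have hmp := PiLp.volume_preserving_ofLp (Fin 3)
  have hme : MeasurableEmbedding (WithLp.ofLp : V3 → (Fin 3 → ℝ)) :=
    (MeasurableEquiv.toLp 2 (Fin 3 → ℝ)).symm.measurableEmbedding
  let f : Fin 3 → ℝ → ℝ := fun l x => x ^ ((![i, j, k] : Fin 3 → ℕ) l) * Real.exp (-b * x ^ 2)
  have hfun : (fun v : V3 => Real.exp (-b * ‖v‖ ^ 2) * (v 0 ^ i * v 1 ^ j * v 2 ^ k))
      = (fun x : Fin 3 → ℝ => ∏ l, f l (x l)) ∘ (WithLp.ofLp : V3 → (Fin 3 → ℝ)) := by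
    ext v
    rw [gauss_mono_prod]
    rfl
  constructor
  · rw [hfun, hmp.integrable_comp_emb hme]
    exact Integrable.fintype_prod (f := f) (fun l => integrable_pow_gauss b hb _)
  · rw [hfun]
    have := hmp.integral_comp hme (fun x : Fin 3 → ℝ => ∏ l, f l (x l))
    simp only [Function.comp_def]
    rw [this, integral_fintype_prod_volume_eq_prod]
    simp only [f, integral_pow_gauss b hb, Fin.prod_univ_three]
    simp
    ring

/-! ### Polynomials as lists of monomials -/

/-- Evaluation of a list of monomials. -/
def ev (L : List (ℝ × ℕ × ℕ × ℕ)) (v : V3) : ℝ :=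
  (L.map fun t => t.1 * (v 0 ^ t.2.1 * v 1 ^ t.2.2.1 * v 2 ^ t.2.2.2)).sum

/-- Gaussian expectation of a list of monomials. -/
def EL (b : ℝ) (L : List (ℝ × ℕ × ℕ × ℕ)) : ℝ :=
  (L.map fun t => t.1 * (rmom b t.2.1 * rmom b t.2.2.1 * rmom b t.2.2.2)).sum

lemma gauss_ev (b : ℝ) (hb : 0 < b) (L : List (ℝ × ℕ × ℕ × ℕ)) :
    Integrable (fun v : V3 => Real.exp (-b * ‖v‖ ^ 2) * ev L v) ∧
    ∫ v : V3, Real.exp (-b * ‖v‖ ^ 2) * ev L v = √(π / b) ^ 3 * EL b L := by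
  induction L with
  | nil => simp [ev, EL]
  | cons t L ih =>
    have h := gauss_mono b hb t.2.1 t.2.2.1 t.2.2.2
    have hfun : (fun v : V3 => Real.exp (-b * ‖v‖ ^ 2) * ev (t :: L) v)
      = fun v : V3 => t.1 * (Real.exp (-b * ‖v‖ ^ 2) *
          (v 0 ^ t.2.1 * v 1 ^ t.2.2.1 * v 2 ^ t.2.2.2)) + Real.exp (-b * ‖v‖ ^ 2) * ev L v := by
      ext v
      simp only [ev, List.map_cons, List.sum_cons]
      ring
    rw [hfun]
    refine ⟨(h.1.const_mul _).add ih.1, ?_⟩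
    rw [integral_add (h.1.const_mul _) ih.1, integral_const_mul, h.2, ih.2]
    simp only [EL, List.map_cons, List.sum_cons]
    ring

/-- Product of two lists of monomials. -/
def mulL (L N : List (ℝ × ℕ × ℕ × ℕ)) : List (ℝ × ℕ × ℕ × ℕ) :=
  L.flatMap fun t => N.map fun s =>
    (t.1 * s.1, t.2.1 + s.2.1, t.2.2.1 + s.2.2.1, t.2.2.2 + s.2.2.2)

lemma ev_append (L N : List (ℝ × ℕ × ℕ × ℕ)) (v : V3) : ev (L ++ N) v = ev L v + ev N v := by
  simp [ev]

lemma ev_mulL (L N : List (ℝ × ℕ × ℕ × ℕ)) (v : V3) : ev (mulL L N) v = ev L v * ev N v := by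
  induction L with
  | nil => simp [ev, mulL]
  | cons t L ih =>
    have h1 : mulL (t :: L) N = (N.map fun s =>
      (t.1 * s.1, t.2.1 + s.2.1, t.2.2.1 + s.2.2.1, t.2.2.2 + s.2.2.2)) ++ mulL L N := by
      simp [mulL]
    have h2 : ∀ N : List (ℝ × ℕ × ℕ × ℕ), ev (N.map fun s =>
      (t.1 * s.1, t.2.1 + s.2.1, t.2.2.1 + s.2.2.1, t.2.2.2 + s.2.2.2)) v
      = t.1 * (v 0 ^ t.2.1 * v 1 ^ t.2.2.1 * v 2 ^ t.2.2.2) * ev N v := by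
      intro N
      induction N with
      | nil => simp [ev]
      | cons s N ihN =>
        simp only [ev, List.map_cons, List.sum_cons] at ihN ⊢
        rw [ihN]
        ring
    rw [h1, ev_append, ih, h2]
    simp only [ev, List.map_cons, List.sum_cons]
    ring

lemma mu0_nonneg (v : V3) : 0 ≤ mu0 v := by unfold mu0; positivity

lemma mu0_ev (L : List (ℝ × ℕ × ℕ × ℕ)) :
    Integrable (fun v : V3 => mu0 v * ev L v) ∧
    ∫ v : V3, mu0 v * ev L v = EL (1 / 2) L := by
  have h := gauss_ev (1 / 2) (by norm_num) L
  have hfun : (fun v : V3 => mu0 v * ev L v) = fun v : V3 =>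
      (2 * π) ^ (-(3 : ℝ) / 2) * (Real.exp (-(1 / 2) * ‖v‖ ^ 2) * ev L v) := by
    ext v
    rw [mu0, show -‖v‖ ^ 2 / 2 = -(1 / 2) * ‖v‖ ^ 2 by ring]
    ring
  rw [hfun]
  refine ⟨h.1.const_mul _, ?_⟩
  rw [integral_const_mul, h.2, ← mul_assoc]
  have : (2 * π) ^ (-(3 : ℝ) / 2) * √(π / (1 / 2)) ^ 3 = 1 := by
    have hp : (0 : ℝ) < 2 * π := by positivity
    rw [show π / (1 / 2) = 2 * π by ring, Real.sqrt_eq_rpow, ← Real.rpow_natCast,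
      ← Real.rpow_mul hp.le, ← Real.rpow_add hp]
    norm_num
  rw [this, one_mul]

/-! ### The orthogonal basis of `M9` -/

/-- The polynomial with coefficients `c` in the orthogonal basis. -/
def polL (c : Fin 9 → ℝ) : List (ℝ × ℕ × ℕ × ℕ) :=
  [(c 0 - 3 * c 4, 0, 0, 0), (c 1 - 5 * c 8, 1, 0, 0), (c 2, 0, 1, 0), (c 3, 0, 0, 1),
   (c 4 + 2 * c 5, 2, 0, 0), (c 4 - c 5, 0, 2, 0), (c 4 - c 5, 0, 0, 2),
   (c 6, 1, 1, 0), (c 7, 1, 0, 1), (c 8, 3, 0, 0), (c 8, 1, 2, 0), (c 8, 1, 0, 2)]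

/-- The parametrisation of `M9` by coefficients in the orthogonal basis. -/
def G : (Fin 9 → ℝ) →ₗ[ℝ] (V3 → ℝ) where
  toFun c := fun v => Real.sqrt (mu0 v) * ev (polL c) v
  map_add' c d := by
    ext v
    simp [ev, polL]
    ring
  map_smul' a c := by
    ext v
    simp [ev, polL]
    ring

lemma G_apply (c : Fin 9 → ℝ) (v : V3) : G c v = Real.sqrt (mu0 v) * ev (polL c) v := rfl

lemma G_mul (c d : Fin 9 → ℝ) :
    (fun v => G c v * G d v) = fun v => mu0 v * ev (mulL (polL c) (polL d)) v := by
  ext v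
  rw [G_apply, G_apply, ev_mulL]
  linear_combination (ev (polL c) v * ev (polL d) v) * Real.mul_self_sqrt (mu0_nonneg v)

lemma xG_mul (c d : Fin 9 → ℝ) :
    (fun v => v 0 * G c v * G d v)
      = fun v => mu0 v * ev (mulL [(1, 1, 0, 0)] (mulL (polL c) (polL d))) v := by
  ext v
  rw [G_apply, G_apply, ev_mulL, ev_mulL]
  have : ev [(1, 1, 0, 0)] v = v 0 := by simp [ev]
  rw [this]
  linear_combination (v 0 * ev (polL c) v * ev (polL d) v) * Real.mul_self_sqrt (mu0_nonneg v)

lemma ip_G (c d : Fin 9 → ℝ) : ip (G c) (G d) =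
    c 0 * d 0 + c 1 * d 1 + c 2 * d 2 + c 3 * d 3 + 6 * (c 4 * d 4) + 12 * (c 5 * d 5)
      + c 6 * d 6 + c 7 * d 7 + 10 * (c 8 * d 8) := by
  rw [ip, G_mul, (mu0_ev _).2]
  simp [EL, mulL, polL, rmom]
  ring

lemma ip_xG (c d : Fin 9 → ℝ) : ip (fun v => v 0 * G c v) (G d) =
    (c 0 * d 1 + c 1 * d 0) + 2 * (c 1 * d 4 + c 4 * d 1) + 4 * (c 1 * d 5 + c 5 * d 1)
      + (c 2 * d 6 + c 6 * d 2) + (c 3 * d 7 + c 7 * d 3) + 10 * (c 4 * d 8 + c 8 * d 4)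
      + 8 * (c 5 * d 8 + c 8 * d 5) := by
  rw [ip, xG_mul, (mu0_ev _).2]
  simp [EL, mulL, polL, rmom]
  ring

lemma integrable_G_mul (c d : Fin 9 → ℝ) : Integrable (fun v => G c v * G d v) := by
  rw [G_mul]; exact (mu0_ev _).1

lemma integrable_xG_mul (c d : Fin 9 → ℝ) : Integrable (fun v => v 0 * G c v * G d v) := by
  rw [xG_mul]; exact (mu0_ev _).1

lemma basis9_eq (i : Fin 9) : ∃ c, G c = basis9 i := by
  have key : ∀ v : V3, ‖v‖ ^ 2 = v 0 ^ 2 + v 1 ^ 2 + v 2 ^ 2 := fun v => by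
    rw [EuclideanSpace.real_norm_sq_eq, Fin.sum_univ_three]
  fin_cases i
  · exact ⟨![1, 0, 0, 0, 0, 0, 0, 0, 0], by
      ext v; simp [G_apply, polL, ev, basis9]⟩
  · exact ⟨![0, 1, 0, 0, 0, 0, 0, 0, 0], by
      ext v; simp [G_apply, polL, ev, basis9]⟩
  · exact ⟨![0, 0, 1, 0, 0, 0, 0, 0, 0], by
      ext v; simp [G_apply, polL, ev, basis9]⟩
  · exact ⟨![0, 0, 0, 1, 0, 0, 0, 0, 0], by
      ext v; simp [G_apply, polL, ev, basis9]⟩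
  · exact ⟨![3, 0, 0, 0, 1, 0, 0, 0, 0], by
      ext v; simp [G_apply, polL, ev, basis9, key]; ring_nf; simp⟩
  · exact ⟨![1, 0, 0, 0, 1 / 3, 1 / 3, 0, 0, 0], by
      ext v; simp [G_apply, polL, ev, basis9]; ring_nf; simp⟩
  · exact ⟨![0, 0, 0, 0, 0, 0, 1, 0, 0], by
      ext v; simp [G_apply, polL, ev, basis9]⟩
  · exact ⟨![0, 0, 0, 0, 0, 0, 0, 1, 0], by
      ext v; simp [G_apply, polL, ev, basis9]⟩
  · exact ⟨![0, 5, 0, 0, 0, 0, 0, 0, 1], by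
      ext v; simp [G_apply, polL, ev, basis9, key]; ring_nf; simp⟩

lemma mem_M9 (g : V3 → ℝ) (hg : g ∈ M9) : ∃ c, G c = g := by
  have : M9 ≤ LinearMap.range G := by
    refine Submodule.span_le.mpr ?_
    rintro _ ⟨i, rfl⟩
    exact basis9_eq i
  exact this hg

lemma G_combo (c : Fin 9 → ℝ) : G c =
    (c 0 - 3 * c 4) • basis9 0 + (c 1 - 5 * c 8) • basis9 1 + c 2 • basis9 2 + c 3 • basis9 3
      + (c 4 - c 5) • basis9 4 + (3 * c 5) • basis9 5 + c 6 • basis9 6 + c 7 • basis9 7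
      + c 8 • basis9 8 := by
  have key : ∀ v : V3, ‖v‖ ^ 2 = v 0 ^ 2 + v 1 ^ 2 + v 2 ^ 2 := fun v => by
    rw [EuclideanSpace.real_norm_sq_eq, Fin.sum_univ_three]
  ext v
  simp [G_apply, polL, ev, basis9, key]
  ring

lemma G_mem_M9 (c : Fin 9 → ℝ) : G c ∈ M9 := by
  have h : ∀ i, basis9 i ∈ M9 := fun i => Submodule.subset_span ⟨i, rfl⟩
  rw [G_combo]
  repeat' apply Submodule.add_mem
  all_goals exact Submodule.smul_mem _ _ (h _)

lemma G_mem_M5 (c : Fin 9 → ℝ) (h5 : c 5 = 0) (h6 : c 6 = 0) (h7 : c 7 = 0) (h8 : c 8 = 0) :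
    G c ∈ M5 := by
  have h : ∀ i, basis5 i ∈ M5 := fun i => Submodule.subset_span ⟨i, rfl⟩
  rw [G_combo, h5, h6, h7, h8]
  simp only [mul_zero, zero_smul, add_zero, sub_zero]
  refine Submodule.add_mem _ (Submodule.add_mem _ (Submodule.add_mem _ (Submodule.add_mem _
    ?_ ?_) ?_) ?_) ?_
  · exact Submodule.smul_mem _ _ (h 0)
  · exact Submodule.smul_mem _ _ (h 1)
  · exact Submodule.smul_mem _ _ (h 2)
  · exact Submodule.smul_mem _ _ (h 3)
  · exact Submodule.smul_mem _ _ (h 4)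

lemma mem_M5 (g : V3 → ℝ) (hg : g ∈ M5) :
    ∃ a : Fin 5 → ℝ, G ![a 0, a 1, a 2, a 3, a 4, 0, 0, 0, 0] = g := by
  have key : ∀ v : V3, ‖v‖ ^ 2 = v 0 ^ 2 + v 1 ^ 2 + v 2 ^ 2 := fun v => by
    rw [EuclideanSpace.real_norm_sq_eq, Fin.sum_univ_three]
  obtain ⟨a, rfl⟩ := (Submodule.mem_span_range_iff_exists_fun ℝ).mp hg
  refine ⟨![a 0 + 3 * a 4, a 1, a 2, a 3, a 4], ?_⟩
  rw [G_combo, Fin.sum_univ_five]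
  simp [basis5]

lemma G_inj (c : Fin 9 → ℝ) (h : G c = 0) : c = 0 := by
  have h1 := ip_G c c
  rw [h] at h1
  simp only [ip, Pi.zero_apply, mul_zero, integral_zero] at h1
  have hz : ∀ i, c i ^ 2 ≤ 0 := by
    have p := fun i => mul_self_nonneg (c i)
    intro i
    fin_cases i <;> simp only [Fin.zero_eta, Fin.mk_one, Fin.reduceFinMk] <;>
      nlinarith [p 0, p 1, p 2, p 3, p 4, p 5, p 6, p 7, p 8]
  ext i
  exact pow_eq_zero_iff (two_ne_zero) |>.mp (le_antisymm (hz i) (sq_nonneg _))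

/-- Coefficients of the compensator (before scaling). -/
def kmap : (Fin 9 → ℝ) →ₗ[ℝ] (Fin 9 → ℝ) where
  toFun c := ![c 1, -c 0 + 12 * c 5, c 6, c 7, 10 * c 8, -c 1, -c 2, -c 3, -(6 * c 4)]
  map_add' c d := by
    ext i; fin_cases i <;> simp <;> ring
  map_smul' a c := by
    ext i; fin_cases i <;> simp <;> ring

lemma kmap_apply (c : Fin 9 → ℝ) :
    kmap c = ![c 1, -c 0 + 12 * c 5, c 6, c 7, 10 * c 8, -c 1, -c 2, -c 3, -(6 * c 4)] := rfl

lemma kmap_antisymm (c d : Fin 9 → ℝ) : ip (G (kmap c)) (G d) = -ip (G c) (G (kmap d)) := by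
  rw [ip_G, ip_G, kmap_apply, kmap_apply]
  simp
  ring

lemma quad_bound (c : Fin 9 → ℝ) :
    c 0 ^ 2 + c 1 ^ 2 + c 2 ^ 2 + c 3 ^ 2 + 6 * c 4 ^ 2
      ≤ -2 * ip (fun v => v 0 * G c v) (G (kmap c))
        + 500 * (c 5 ^ 2 + c 6 ^ 2 + c 7 ^ 2 + c 8 ^ 2) := by
  rw [ip_xG, kmap_apply]
  simp
  nlinarith [sq_nonneg (c 0 + 4 * c 4), sq_nonneg (c 0 - 16 * c 5), sq_nonneg (c 1 - 12 * c 8),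
    sq_nonneg (c 4 + c 5), sq_nonneg (c 1), sq_nonneg (c 4), sq_nonneg (c 5), sq_nonneg (c 8),
    sq_nonneg (c 6), sq_nonneg (c 7), sq_nonneg (c 2), sq_nonneg (c 3)]

lemma weight_bound : ∃ δ > (0 : ℝ), ∀ c : Fin 9 → ℝ, c 0 = 0 → c 1 = 0 → c 2 = 0 → c 3 = 0 →
    c 4 = 0 → δ * (c 5 ^ 2 + c 6 ^ 2 + c 7 ^ 2 + c 8 ^ 2) ≤
      ∫ v : V3, (1 + ‖v‖ ^ 2) ^ (-(100 : ℝ)) * (G c v) ^ 2 := by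
  set Z : ℝ := (2 * π) ^ (-(3 : ℝ) / 2) * √(π / (201 / 2)) ^ 3 with hZ
  have hZ0 : 0 < Z := by positivity
  refine ⟨Z * (1 / 201) ^ 2, by positivity, fun c h0 h1 h2 h3 h4 => ?_⟩
  have hg := gauss_ev (201 / 2) (by norm_num) (mulL (polL c) (polL c))
  have hval : EL (201 / 2) (mulL (polL c) (polL c)) ≥
      (1 / 201) ^ 2 * (c 5 ^ 2 + c 6 ^ 2 + c 7 ^ 2 + c 8 ^ 2) := by
    simp [EL, mulL, polL, rmom, h0, h1, h2, h3, h4]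
    ring_nf
    nlinarith [sq_nonneg (c 5), sq_nonneg (c 8), sq_nonneg (c 6), sq_nonneg (c 7)]
  have hle : ∫ v : V3, (2 * π) ^ (-(3 : ℝ) / 2) *
      (Real.exp (-(201 / 2) * ‖v‖ ^ 2) * ev (mulL (polL c) (polL c)) v) ≤
      ∫ v : V3, (1 + ‖v‖ ^ 2) ^ (-(100 : ℝ)) * (G c v) ^ 2 := by
    have hsq : ∀ v, (G c v) ^ 2 = mu0 v * ev (mulL (polL c) (polL c)) v := fun v => by
      rw [sq]; exact congrFun (G_mul c c) v
    have hsqint : Integrable (fun v : V3 => (G c v) ^ 2) := by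
      simp only [hsq]; exact (mu0_ev _).1
    refine integral_mono (hg.1.const_mul _) ?_ ?_
    · refine hsqint.mono ?_ (Filter.Eventually.of_forall fun v => ?_)
      · refine AEStronglyMeasurable.mul ?_ hsqint.1
        refine Continuous.aestronglyMeasurable ?_
        refine Continuous.rpow_const (by fun_prop) (fun v => Or.inl ?_)
        positivity
      · rw [norm_mul]
        refine mul_le_of_le_one_left (norm_nonneg _) ?_
        rw [Real.norm_of_nonneg (by positivity)]
        exact Real.rpow_le_one_of_one_le_of_nonpos (by nlinarith [sq_nonneg ‖v‖]) (by norm_num)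
    · intro v
      simp only
      rw [hsq, ev_mulL, mu0]
      have hw : Real.exp (-100 * ‖v‖ ^ 2) ≤ (1 + ‖v‖ ^ 2) ^ (-(100 : ℝ)) := by
        have h1 : (1 + ‖v‖ ^ 2) ≤ Real.exp (‖v‖ ^ 2) := by
          have := Real.add_one_le_exp (‖v‖ ^ 2); linarith
        have h2 := Real.rpow_le_rpow_of_nonpos (by positivity) h1
          (show (-(100 : ℝ)) ≤ 0 by norm_num)
        rwa [← Real.exp_mul, mul_comm] at h2
      have he : Real.exp (-(201 / 2) * ‖v‖ ^ 2)
          = Real.exp (-100 * ‖v‖ ^ 2) * Real.exp (-‖v‖ ^ 2 / 2) := by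
        rw [← Real.exp_add]; congr 1; ring
      rw [he]
      have hnn : 0 ≤ (2 * π) ^ (-(3 : ℝ) / 2) * Real.exp (-‖v‖ ^ 2 / 2)
          * (ev (polL c) v * ev (polL c) v) :=
        mul_nonneg (by positivity) (mul_self_nonneg _)
      have := mul_le_mul_of_nonneg_right hw hnn
      linarith
  rw [integral_const_mul, hg.2] at hle
  refine le_trans ?_ hle
  have := mul_le_mul_of_nonneg_left hval hZ0.le
  rw [hZ] at this ⊢
  linarith

/-- **Kawashima compensator for the nine-moment system of the linearized Landau
equation.**  There is an `L²`-antisymmetric linear map `K` with values in `M₉` and a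
constant `C_K > 0` such that for all `g ∈ M₉`,
`‖Pg‖² ≤ C_K (⟨K P₉(v₁g) − v₁(Kg), g⟩ + ‖⟨v⟩^{-100} P^⊥ g‖²)`. -/
theorem nine_moment_kawashima_compensator
    (P P9 : (V3 → ℝ) → (V3 → ℝ))
    (hP : IsOrthProj M5 P) (hP9 : IsOrthProj M9 P9) :
    ∃ K : (V3 → ℝ) →ₗ[ℝ] (V3 → ℝ),
      (∀ g : V3 → ℝ, K g ∈ M9) ∧
      (∀ g ∈ M9, ∀ h ∈ M9, ip (K g) h = -ip g (K h)) ∧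
      ∃ CK > (0 : ℝ), ∀ g : V3 → ℝ, g ∈ M9 →
        ip (P g) (P g) ≤
          CK * (ip (fun v => K (P9 (fun w => w 0 * g w)) v - v 0 * K g v) g
            + ∫ v : V3, (1 + ‖v‖ ^ 2) ^ (-(100 : ℝ)) * (g v - P g v) ^ 2) := by
  obtain ⟨ℓ, hℓ⟩ := LinearMap.exists_leftInverse_of_injective G
    (LinearMap.ker_eq_bot'.mpr G_inj)
  have hℓG : ∀ c, ℓ (G c) = c := fun c => LinearMap.congr_fun hℓ c
  obtain ⟨δ, hδ, hW⟩ := weight_bound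
  set ε : ℝ := δ / 500 with hε
  have hε0 : 0 < ε := by positivity
  have hKG : ∀ c, (G ∘ₗ (ε • kmap) ∘ₗ ℓ) (G c) = ε • G (kmap c) := fun c => by
    simp [hℓG]
  have ips : ∀ (a : ℝ) (f h : V3 → ℝ), ip (a • f) h = a * ip f h := fun a f h => by
    simp only [ip, Pi.smul_apply, smul_eq_mul, mul_assoc, integral_const_mul]
  have ipc : ∀ (f h : V3 → ℝ), ip f h = ip h f := fun f h => by
    simp only [ip, mul_comm]
  refine ⟨G ∘ₗ (ε • kmap) ∘ₗ ℓ, fun g => G_mem_M9 _, ?_, 1 / ε, by positivity, ?_⟩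
  · intro g hg h hh
    obtain ⟨c, rfl⟩ := mem_M9 g hg
    obtain ⟨d, rfl⟩ := mem_M9 h hh
    rw [hKG, hKG, ips, ipc (G c), ips, ipc _ (G c), kmap_antisymm]
    ring
  · intro g hg
    obtain ⟨c, rfl⟩ := mem_M9 g hg
    -- the macroscopic projection
    obtain ⟨a, ha⟩ := mem_M5 _ (hP (G c)).1
    set p : Fin 9 → ℝ := ![a 0, a 1, a 2, a 3, a 4, 0, 0, 0, 0] with hp
    have hsub : (fun v => G c v - P (G c) v) = G (c - p) := by
      rw [← ha, map_sub]; rfl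
    have hort : ∀ d : Fin 9 → ℝ, d 5 = 0 → d 6 = 0 → d 7 = 0 → d 8 = 0 →
        ip (G (c - p)) (G d) = 0 := fun d h5 h6 h7 h8 => by
      rw [← hsub]; exact (hP (G c)).2 _ (G_mem_M5 d h5 h6 h7 h8)
    have e0 : c 0 = a 0 := by
      have := hort ![1, 0, 0, 0, 0, 0, 0, 0, 0] rfl rfl rfl rfl
      rw [ip_G] at this; simp [hp] at this; linarith
    have e1 : c 1 = a 1 := by
      have := hort ![0, 1, 0, 0, 0, 0, 0, 0, 0] rfl rfl rfl rfl
      rw [ip_G] at this; simp [hp] at this; linarith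
    have e2 : c 2 = a 2 := by
      have := hort ![0, 0, 1, 0, 0, 0, 0, 0, 0] rfl rfl rfl rfl
      rw [ip_G] at this; simp [hp] at this; linarith
    have e3 : c 3 = a 3 := by
      have := hort ![0, 0, 0, 1, 0, 0, 0, 0, 0] rfl rfl rfl rfl
      rw [ip_G] at this; simp [hp] at this; linarith
    have e4 : c 4 = a 4 := by
      have := hort ![0, 0, 0, 0, 1, 0, 0, 0, 0] rfl rfl rfl rfl
      rw [ip_G] at this; simp [hp] at this; linarith
    have hPP : ip (P (G c)) (P (G c))
        = c 0 ^ 2 + c 1 ^ 2 + c 2 ^ 2 + c 3 ^ 2 + 6 * c 4 ^ 2 := by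
      rw [← ha, ip_G, e0, e1, e2, e3, e4]
      simp [hp]
      ring
    have hWc := hW (c - p) (by simp [hp, e0]) (by simp [hp, e1]) (by simp [hp, e2])
      (by simp [hp, e3]) (by simp [hp, e4])
    rw [← hsub] at hWc
    have hmic : (c - p) 5 ^ 2 + (c - p) 6 ^ 2 + (c - p) 7 ^ 2 + (c - p) 8 ^ 2
        = c 5 ^ 2 + c 6 ^ 2 + c 7 ^ 2 + c 8 ^ 2 := by simp [hp]
    rw [hmic] at hWc
    -- the nine-moment projection
    obtain ⟨q, hq⟩ := mem_M9 _ (hP9 (fun w => w 0 * G c w)).1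
    have hq2 : ip (fun v => v 0 * G c v) (G (kmap c)) = ip (G q) (G (kmap c)) := by
      have h := (hP9 (fun w => w 0 * G c w)).2 _ (G_mem_M9 (kmap c))
      rw [← hq] at h
      simp only [ip, sub_mul] at h
      rw [integral_sub (integrable_xG_mul _ _) (integrable_G_mul _ _)] at h
      simp only [ip]
      linarith
    have hmain : ip (fun v => (G ∘ₗ (ε • kmap) ∘ₗ ℓ) (P9 (fun w => w 0 * G c w)) v
          - v 0 * (G ∘ₗ (ε • kmap) ∘ₗ ℓ) (G c) v) (G c)
        = ε * (-2 * ip (fun v => v 0 * G c v) (G (kmap c))) := by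
      rw [← hq, hKG, hKG]
      have hsym : ip (fun v => v 0 * G (kmap c) v) (G c)
          = ip (fun v => v 0 * G c v) (G (kmap c)) := by
        rw [ip_xG, ip_xG]; ring
      have hfun : (fun v : V3 => (ε • G (kmap q)) v - v 0 * (ε • G (kmap c)) v)
          = ε • (fun v : V3 => G (kmap q) v - v 0 * G (kmap c) v) := by
        ext v; simp only [Pi.smul_apply, smul_eq_mul]; ring
      have hsplit : ip (fun v : V3 => G (kmap q) v - v 0 * G (kmap c) v) (G c)
          = ip (G (kmap q)) (G c) - ip (fun v => v 0 * G (kmap c) v) (G c) := by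
        simp only [ip, sub_mul]
        exact integral_sub (integrable_G_mul _ _) (integrable_xG_mul _ _)
      rw [hfun, ips, hsplit, hsym, kmap_antisymm, ← hq2]
      ring
    rw [hmain, hPP]
    have hQ := mul_le_mul_of_nonneg_left (quad_bound c) hε0.le
    rw [one_div, inv_mul_eq_div, le_div_iff₀ hε0]
    have h500 : ε * 500 = δ := by rw [hε]; ring
    refine le_trans (le_of_eq (mul_comm _ _)) (hQ.trans ?_)
    rw [mul_add, ← mul_assoc ε 500, h500]
    linarith
end
end

section
/- Weighted coercivity of the hard linearized Landau operator: Let θ > 0. Then there exist δ > 0 and C > 0 such that for every Schwartz function g : ℝ³ → ℝ, ∫_{ℝ³} ⟨v⟩^{2θ} (L^R g)(v) g(v) dv ≥ δ² |g|²_{σ_R,θ} − C |g|²_{σ_R,θ−1/2}. -/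
noncomputable section

open MeasureTheory Real

/-- The Japanese bracket `⟨v⟩ = (1+|v|²)^{1/2}`. -/
def jap (v : V3) : ℝ := Real.sqrt (1 + ‖v‖ ^ 2)

/-- The hard Landau kernel `φ_R^{ij}(z) = (δ^{ij} − z_iz_j/|z|²)|z|`. -/
def kerR (z : V3) (i j : Fin 3) : ℝ :=
  ((if i = j then (1 : ℝ) else 0) - z i * z j / ‖z‖ ^ 2) * ‖z‖

/-- Partial derivative `∂_i` in `v`. -/
def pd (i : Fin 3) (g : V3 → ℝ) (v : V3) : ℝ :=
  fderiv ℝ g v (EuclideanSpace.single i 1)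

/-- The Landau-type collision operator with kernel `ker`. -/
def landauQ (ker : V3 → Fin 3 → Fin 3 → ℝ) (F₁ F₂ : V3 → ℝ) (v : V3) : ℝ :=
  ∑ i, pd i (fun w => ∫ u : V3, ∑ j,
    ker (w - u) i j * (F₁ u * pd j F₂ w - F₂ w * pd j F₁ u)) v

/-- `√μ₀`. -/
def sqmu (v : V3) : ℝ := Real.sqrt (mu0 v)

/-- The hard linearized Landau operator
`L^R g = −μ₀^{-1/2}(Q_R(μ₀, √μ₀ g) + Q_R(√μ₀ g, μ₀))`. -/
def LR (g : V3 → ℝ) (v : V3) : ℝ :=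
  -(sqmu v)⁻¹ * (landauQ kerR mu0 (fun w => sqmu w * g w) v
    + landauQ kerR (fun w => sqmu w * g w) mu0 v)

/-- `σ_R^{ij} = φ_R^{ij} ∗ μ₀`. -/
def sigR (v : V3) (i j : Fin 3) : ℝ := ∫ u : V3, kerR (v - u) i j * mu0 u

/-- The weighted dissipation norm `|g|²_{σ_R,ℓ}`. -/
def sRNormSq (ℓ : ℝ) (g : V3 → ℝ) : ℝ :=
  ∫ v : V3, jap v ^ (2 * ℓ) *
    ∑ i, ∑ j, sigR v i j * (pd i g v * pd j g v + v i * v j * (g v) ^ 2)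


/-! ### Function classes: polynomial growth and rapid decay -/

lemma jap_sq (v : V3) : jap v ^ 2 = 1 + ‖v‖ ^ 2 := by
  unfold jap; rw [Real.sq_sqrt]; positivity

lemma one_le_jap (v : V3) : 1 ≤ jap v := by
  unfold jap; rw [Real.one_le_sqrt]; nlinarith [sq_nonneg ‖v‖]

lemma jap_pos (v : V3) : 0 < jap v := lt_of_lt_of_le one_pos (one_le_jap v)

lemma norm_le_jap (v : V3) : ‖v‖ ≤ jap v := by
  unfold jap; apply Real.le_sqrt_of_sq_le; linarith

lemma coord_le (v : V3) (i : Fin 3) : |v i| ≤ ‖v‖ := by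
  simpa using PiLp.norm_apply_le v i

lemma coord_le_jap (v : V3) (i : Fin 3) : |v i| ≤ jap v := (coord_le v i).trans (norm_le_jap v)

lemma norm_sq_coord (v : V3) : ‖v‖ ^ 2 = ∑ i, v i ^ 2 := by
  rw [EuclideanSpace.norm_sq_eq]; simp

lemma jap_continuous : Continuous jap := by unfold jap; fun_prop

/-- polynomial growth -/
def TG (f : V3 → ℝ) : Prop := Measurable f ∧ ∃ C : ℝ, ∃ k : ℕ, ∀ v, |f v| ≤ C * jap v ^ k

/-- rapid decay -/
def RD (f : V3 → ℝ) : Prop := Measurable f ∧ ∀ k : ℕ, ∃ C : ℝ, ∀ v, |f v| * jap v ^ k ≤ C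

lemma TG.congr {f g : V3 → ℝ} (hf : TG f) (h : ∀ v, g v = f v) : TG g := by
  rwa [show g = f from funext h]

lemma RD.congr {f g : V3 → ℝ} (hf : RD f) (h : ∀ v, g v = f v) : RD g := by
  rwa [show g = f from funext h]

lemma TG.bd {f : V3 → ℝ} (hf : TG f) : ∃ C : ℝ, 0 ≤ C ∧ ∃ k : ℕ, ∀ v, |f v| ≤ C * jap v ^ k := by
  obtain ⟨_, C, k, h⟩ := hf
  refine ⟨|C|, abs_nonneg _, k, fun v => (h v).trans ?_⟩
  have := jap_pos v
  gcongr; exact le_abs_self C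

lemma TG.const (c : ℝ) : TG (fun _ => c) :=
  ⟨measurable_const, |c|, 0, fun v => by simp⟩

lemma TG.add {f g : V3 → ℝ} (hf : TG f) (hg : TG g) : TG (fun v => f v + g v) := by
  obtain ⟨C, hC, k, h⟩ := hf.bd
  obtain ⟨D, hD, l, h'⟩ := hg.bd
  refine ⟨hf.1.add hg.1, C + D, k + l, fun v => (abs_add_le _ _).trans ?_⟩
  have h1 := one_le_jap v
  have e1 : jap v ^ k ≤ jap v ^ (k + l) := pow_le_pow_right₀ h1 (by omega)
  have e2 : jap v ^ l ≤ jap v ^ (k + l) := pow_le_pow_right₀ h1 (by omega)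
  rw [add_mul]
  exact add_le_add ((h v).trans (by gcongr)) ((h' v).trans (by gcongr))

lemma TG.mul {f g : V3 → ℝ} (hf : TG f) (hg : TG g) : TG (fun v => f v * g v) := by
  obtain ⟨C, hC, k, h⟩ := hf.bd
  obtain ⟨D, hD, l, h'⟩ := hg.bd
  refine ⟨hf.1.mul hg.1, C * D, k + l, fun v => ?_⟩
  have h1 := jap_pos v
  rw [abs_mul, pow_add]
  calc |f v| * |g v| ≤ (C * jap v ^ k) * (D * jap v ^ l) := by
        gcongr; exacts [h v, h' v]
    _ = _ := by ring

lemma RD.toTG {f : V3 → ℝ} (hf : RD f) : TG f := by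
  obtain ⟨C, h⟩ := hf.2 0
  exact ⟨hf.1, C, 0, fun v => by simpa using h v⟩

lemma RD.add {f g : V3 → ℝ} (hf : RD f) (hg : RD g) : RD (fun v => f v + g v) := by
  refine ⟨hf.1.add hg.1, fun k => ?_⟩
  obtain ⟨C, h⟩ := hf.2 k
  obtain ⟨D, h'⟩ := hg.2 k
  refine ⟨C + D, fun v => ?_⟩
  have h1 := jap_pos v
  calc |f v + g v| * jap v ^ k ≤ (|f v| + |g v|) * jap v ^ k := by gcongr; exact abs_add_le _ _
    _ ≤ _ := by rw [add_mul]; exact add_le_add (h v) (h' v)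

lemma TG.mulRD {f g : V3 → ℝ} (hf : TG f) (hg : RD g) : RD (fun v => f v * g v) := by
  refine ⟨hf.1.mul hg.1, fun k => ?_⟩
  obtain ⟨C, hC, l, h⟩ := hf.bd
  obtain ⟨D, h'⟩ := hg.2 (l + k)
  refine ⟨C * D, fun v => ?_⟩
  have h1 := jap_pos v
  rw [abs_mul]
  calc |f v| * |g v| * jap v ^ k ≤ (C * jap v ^ l) * |g v| * jap v ^ k := by gcongr; exact h v
    _ = C * (|g v| * jap v ^ (l + k)) := by rw [pow_add]; ring
    _ ≤ _ := by gcongr; exact h' v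

lemma RD.mulTG {f g : V3 → ℝ} (hf : RD f) (hg : TG g) : RD (fun v => f v * g v) :=
  (hg.mulRD hf).congr fun v => mul_comm _ _

lemma RD.mul {f g : V3 → ℝ} (hf : RD f) (hg : RD g) : RD (fun v => f v * g v) := hf.toTG.mulRD hg

lemma RD.const_mul {g : V3 → ℝ} (c : ℝ) (hg : RD g) : RD (fun v => c * g v) :=
  (TG.const c).mulRD hg

lemma RD.neg {f : V3 → ℝ} (hf : RD f) : RD (fun v => - f v) :=
  (hf.const_mul (-1)).congr fun v => by ring

lemma TG.neg {f : V3 → ℝ} (hf : TG f) : TG (fun v => - f v) :=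
  ((TG.const (-1)).mul hf).congr fun v => by ring

lemma RD.sub {f g : V3 → ℝ} (hf : RD f) (hg : RD g) : RD (fun v => f v - g v) :=
  (hf.add hg.neg).congr fun v => by ring

lemma RD.abs {f : V3 → ℝ} (hf : RD f) : RD (fun v => |f v|) :=
  ⟨hf.1.abs, fun k => by simpa using hf.2 k⟩

lemma RD.sum {f : Fin 3 → V3 → ℝ} (hf : ∀ i, RD (f i)) : RD (fun v => ∑ i, f i v) :=
  (((hf 0).add (hf 1)).add (hf 2)).congr fun v => by rw [Fin.sum_univ_three]

lemma TG.sum {f : Fin 3 → V3 → ℝ} (hf : ∀ i, TG (f i)) : TG (fun v => ∑ i, f i v) :=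
  (((hf 0).add (hf 1)).add (hf 2)).congr fun v => by rw [Fin.sum_univ_three]

lemma RD.integrable {f : V3 → ℝ} (hf : RD f) : Integrable f := by
  obtain ⟨C, h⟩ := hf.2 4
  have hi : Integrable (fun v : V3 => (1 + ‖v‖ ^ 2) ^ (-(4 : ℝ) / 2)) :=
    integrable_rpow_neg_one_add_norm_sq (by simp; norm_num)
  refine (hi.const_mul C).mono' hf.1.aestronglyMeasurable (Filter.Eventually.of_forall fun v => ?_)
  have h1 := jap_pos v
  have e : (1 + ‖v‖ ^ 2) ^ (-(4 : ℝ) / 2) = (jap v ^ 4)⁻¹ := by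
    rw [show -(4 : ℝ) / 2 = -(2 : ℕ) by norm_num, Real.rpow_neg (by positivity), Real.rpow_natCast,
      ← jap_sq]
    ring
  rw [e, ← div_eq_mul_inv, le_div_iff₀ (by positivity)]
  exact h v

/-! ### Partial derivatives -/

lemma pd_meas (i : Fin 3) (f : V3 → ℝ) : Measurable (pd i f) :=
  measurable_fderiv_apply_const ℝ f _

lemma pd_mul {f g : V3 → ℝ} (hf : Differentiable ℝ f) (hg : Differentiable ℝ g) (i : Fin 3)
    (v : V3) : pd i (fun w => f w * g w) v = pd i f v * g v + f v * pd i g v := by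
  unfold pd
  rw [show (fun w => f w * g w) = f * g from rfl, fderiv_mul (hf v) (hg v)]
  simp; ring

lemma pd_add {f g : V3 → ℝ} (hf : Differentiable ℝ f) (hg : Differentiable ℝ g) (i : Fin 3)
    (v : V3) : pd i (fun w => f w + g w) v = pd i f v + pd i g v := by
  unfold pd
  rw [show (fun w => f w + g w) = f + g from rfl, fderiv_add (hf v) (hg v)]
  simp

lemma pd_const (c : ℝ) (i : Fin 3) (v : V3) : pd i (fun _ => c) v = 0 := by
  unfold pd; simp

/-- differentiable with polynomial growth of order one -/
def TG1 (f : V3 → ℝ) : Prop := Differentiable ℝ f ∧ TG f ∧ ∀ i, TG (pd i f)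

/-- differentiable with rapid decay of order one -/
def RD1 (f : V3 → ℝ) : Prop := Differentiable ℝ f ∧ RD f ∧ ∀ i, RD (pd i f)

lemma TG1.congr {f g : V3 → ℝ} (hf : TG1 f) (h : ∀ v, g v = f v) : TG1 g := by
  rwa [show g = f from funext h]

lemma RD1.congr {f g : V3 → ℝ} (hf : RD1 f) (h : ∀ v, g v = f v) : RD1 g := by
  rwa [show g = f from funext h]

lemma RD1.toTG1 {f : V3 → ℝ} (hf : RD1 f) : TG1 f := ⟨hf.1, hf.2.1.toTG, fun i => (hf.2.2 i).toTG⟩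

lemma TG1.const (c : ℝ) : TG1 (fun _ => c) :=
  ⟨differentiable_const c, TG.const c, fun i => (TG.const 0).congr fun v => pd_const c i v⟩

lemma TG1.add {f g : V3 → ℝ} (hf : TG1 f) (hg : TG1 g) : TG1 (fun v => f v + g v) :=
  ⟨hf.1.add hg.1, hf.2.1.add hg.2.1, fun i => ((hf.2.2 i).add (hg.2.2 i)).congr
    fun v => pd_add hf.1 hg.1 i v⟩

lemma TG1.mul {f g : V3 → ℝ} (hf : TG1 f) (hg : TG1 g) : TG1 (fun v => f v * g v) :=
  ⟨hf.1.mul hg.1, hf.2.1.mul hg.2.1, fun i => (((hf.2.2 i).mul hg.2.1).add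
    (hf.2.1.mul (hg.2.2 i))).congr fun v => pd_mul hf.1 hg.1 i v⟩

lemma RD1.add {f g : V3 → ℝ} (hf : RD1 f) (hg : RD1 g) : RD1 (fun v => f v + g v) :=
  ⟨hf.1.add hg.1, hf.2.1.add hg.2.1, fun i => ((hf.2.2 i).add (hg.2.2 i)).congr
    fun v => pd_add hf.1 hg.1 i v⟩

lemma TG1.mulRD {f g : V3 → ℝ} (hf : TG1 f) (hg : RD1 g) : RD1 (fun v => f v * g v) :=
  ⟨hf.1.mul hg.1, hf.2.1.mulRD hg.2.1, fun i => (((hf.2.2 i).mulRD hg.2.1).add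
    (hf.2.1.mulRD (hg.2.2 i))).congr fun v => pd_mul hf.1 hg.1 i v⟩

lemma RD1.mul {f g : V3 → ℝ} (hf : RD1 f) (hg : RD1 g) : RD1 (fun v => f v * g v) :=
  hf.toTG1.mulRD hg

lemma RD1.neg {f : V3 → ℝ} (hf : RD1 f) : RD1 (fun v => - f v) :=
  ((TG1.const (-1)).mulRD hf).congr fun v => by ring

lemma RD1.sub {f g : V3 → ℝ} (hf : RD1 f) (hg : RD1 g) : RD1 (fun v => f v - g v) :=
  (hf.add hg.neg).congr fun v => by ring

lemma RD1.sum {f : Fin 3 → V3 → ℝ} (hf : ∀ i, RD1 (f i)) : RD1 (fun v => ∑ i, f i v) :=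
  (((hf 0).add (hf 1)).add (hf 2)).congr fun v => by rw [Fin.sum_univ_three]

lemma TG1.sum {f : Fin 3 → V3 → ℝ} (hf : ∀ i, TG1 (f i)) : TG1 (fun v => ∑ i, f i v) :=
  (((hf 0).add (hf 1)).add (hf 2)).congr fun v => by rw [Fin.sum_univ_three]

lemma ibp {f g : V3 → ℝ} (hf : TG1 f) (hg : RD1 g) (i : Fin 3) :
    ∫ v, f v * pd i g v = - ∫ v, pd i f v * g v :=
  integral_mul_fderiv_eq_neg_fderiv_mul_of_integrable
    ((hf.2.2 i).mulRD hg.2.1).integrable (hf.2.1.mulRD (hg.2.2 i)).integrable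
    (hf.2.1.mulRD hg.2.1).integrable (fun x _ => hf.1 x) (fun x _ => hg.1 x)

/-! ### Basic members -/

lemma pd_coord (i j : Fin 3) (v : V3) : pd i (fun w => w j) v = if i = j then 1 else 0 := by
  unfold pd
  have : (fun w : V3 => w j) = ⇑(EuclideanSpace.proj j : V3 →L[ℝ] ℝ) := rfl
  rw [this, ContinuousLinearMap.fderiv]
  simp [eq_comm]

lemma TG_of_cont {f : V3 → ℝ} (hf : Continuous f) {C : ℝ} {k : ℕ}
    (h : ∀ v, |f v| ≤ C * jap v ^ k) : TG f := ⟨hf.measurable, C, k, h⟩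

lemma coord_diff (j : Fin 3) : Differentiable ℝ (fun w : V3 => w j) :=
  (EuclideanSpace.proj j : V3 →L[ℝ] ℝ).differentiable

lemma TG1_coord (j : Fin 3) : TG1 (fun w : V3 => w j) := by
  refine ⟨coord_diff j, ?_, fun i => (TG.const (if i = j then 1 else 0)).congr (pd_coord i j)⟩
  exact TG_of_cont (C := 1) (k := 1) (coord_diff j).continuous
    fun v => by simpa using coord_le_jap v j

lemma pd_of_hasFDerivAt {f : V3 → ℝ} {f' : V3 →L[ℝ] ℝ} {v : V3} (h : HasFDerivAt f f' v)
    (i : Fin 3) : pd i f v = f' (EuclideanSpace.single i 1) := by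
  unfold pd; rw [h.fderiv]

lemma pd_comp_normsq {φ : ℝ → ℝ} {d : ℝ} {v : V3} (h : HasDerivAt φ d (‖v‖ ^ 2)) :
    DifferentiableAt ℝ (fun w : V3 => φ (‖w‖ ^ 2)) v ∧
    ∀ i, pd i (fun w : V3 => φ (‖w‖ ^ 2)) v = d * (2 * v i) := by
  have h2 := h.comp_hasFDerivAt v (hasStrictFDerivAt_norm_sq v).hasFDerivAt
  refine ⟨h2.differentiableAt, fun i => ?_⟩
  rw [pd_of_hasFDerivAt (f := fun w : V3 => φ (‖w‖ ^ 2)) h2 i]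
  simp [EuclideanSpace.inner_single_right]

lemma jap_rpow_eq (a : ℝ) (v : V3) : jap v ^ a = (1 + ‖v‖ ^ 2) ^ (a / 2) := by
  unfold jap
  rw [Real.sqrt_eq_rpow, ← Real.rpow_mul (by positivity)]
  ring_nf

lemma jap_rpow_deriv (a : ℝ) (v : V3) :
    DifferentiableAt ℝ (fun w : V3 => jap w ^ a) v ∧
    ∀ i, pd i (fun w : V3 => jap w ^ a) v = a * jap v ^ (a - 2) * v i := by
  have h : HasDerivAt (fun s : ℝ => (1 + s) ^ (a / 2)) (1 * (a / 2) * (1 + ‖v‖ ^ 2) ^ (a / 2 - 1))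
      (‖v‖ ^ 2) := by
    apply HasDerivAt.rpow_const
    · exact (hasDerivAt_id _).const_add 1
    · left; positivity
  have := pd_comp_normsq h
  simp only [← jap_rpow_eq] at this
  refine ⟨this.1, fun i => (this.2 i).trans ?_⟩
  rw [jap_rpow_eq (a - 2)]
  ring_nf

lemma TG_jap (a : ℝ) : TG (fun v => jap v ^ a) := by
  obtain ⟨k, hk⟩ := exists_nat_ge a
  refine TG_of_cont (C := 1) (k := k) ?_ fun v => ?_
  · exact jap_continuous.rpow_const fun v => Or.inl (jap_pos v).ne'
  · rw [abs_of_pos (Real.rpow_pos_of_pos (jap_pos v) _), one_mul, ← Real.rpow_natCast]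
    exact Real.rpow_le_rpow_of_exponent_le (one_le_jap v) hk

lemma TG1_jap (a : ℝ) : TG1 (fun v => jap v ^ a) :=
  ⟨fun v => (jap_rpow_deriv a v).1, TG_jap a, fun i =>
    (((TG.const a).mul (TG_jap (a - 2))).mul (TG1_coord i).2.1).congr
      fun v => (jap_rpow_deriv a v).2 i⟩

lemma pd_jap (a : ℝ) (i : Fin 3) (v : V3) :
    pd i (fun w : V3 => jap w ^ a) v = a * jap v ^ (a - 2) * v i := (jap_rpow_deriv a v).2 i

lemma RD_exp {c : ℝ} (hc : 0 < c) : RD (fun v => Real.exp (-c * ‖v‖ ^ 2)) := by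
  refine ⟨by fun_prop, fun k => ⟨(c⁻¹) ^ k * (k.factorial : ℝ) * Real.exp c, fun v => ?_⟩⟩
  rw [abs_of_pos (Real.exp_pos _)]
  have h1 := one_le_jap v
  have h2 : jap v ^ k ≤ (1 + ‖v‖ ^ 2) ^ k := by
    rw [← jap_sq, ← pow_mul]; exact pow_le_pow_right₀ h1 (by omega)
  have h3 := Real.pow_div_factorial_le_exp (c * (1 + ‖v‖ ^ 2)) (by positivity) k
  rw [div_le_iff₀ (by positivity), mul_pow] at h3
  have h4 : (1 + ‖v‖ ^ 2) ^ k ≤ (c⁻¹) ^ k * (Real.exp (c * (1 + ‖v‖ ^ 2)) * k.factorial) := by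
    rw [inv_pow, ← div_eq_inv_mul, le_div_iff₀ (by positivity)]; linarith
  calc _ ≤ Real.exp (-c * ‖v‖ ^ 2) * ((c⁻¹) ^ k * (Real.exp (c * (1 + ‖v‖ ^ 2)) * k.factorial)) := by
        gcongr; exact h2.trans h4
    _ = (c⁻¹) ^ k * (k.factorial : ℝ) * (Real.exp (-c * ‖v‖ ^ 2) * Real.exp (c * (1 + ‖v‖ ^ 2))) := by
        ring
    _ = _ := by rw [← Real.exp_add]; ring_nf

lemma pd_exp (c : ℝ) (v : V3) : DifferentiableAt ℝ (fun w : V3 => Real.exp (-c * ‖w‖ ^ 2)) v ∧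
    ∀ i, pd i (fun w : V3 => Real.exp (-c * ‖w‖ ^ 2)) v
      = -2 * c * v i * Real.exp (-c * ‖v‖ ^ 2) := by
  have h : HasDerivAt (fun s : ℝ => Real.exp (-c * s)) (Real.exp (-c * ‖v‖ ^ 2) * (-c * 1))
      (‖v‖ ^ 2) := ((hasDerivAt_id _).const_mul (-c)).exp
  have := pd_comp_normsq h
  exact ⟨this.1, fun i => (this.2 i).trans (by ring)⟩

lemma RD1_exp {c : ℝ} (hc : 0 < c) : RD1 (fun v => Real.exp (-c * ‖v‖ ^ 2)) :=
  ⟨fun v => (pd_exp c v).1, RD_exp hc, fun i => (((TG.const (-2 * c)).mul (TG1_coord i).2.1).mulRD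
    (RD_exp hc)).congr fun v => (pd_exp c v).2 i⟩

/-- normalisation constant of `sqmu` -/
def csq : ℝ := Real.sqrt ((2 * π) ^ (-(3 : ℝ) / 2))

lemma csq_pos : 0 < csq := by unfold csq; positivity

lemma sqmu_eq (v : V3) : sqmu v = csq * Real.exp (-(1 / 4) * ‖v‖ ^ 2) := by
  unfold sqmu mu0 csq
  rw [Real.sqrt_mul (by positivity)]
  congr 1
  rw [Real.sqrt_eq_iff_mul_self_eq (by positivity) (by positivity), ← Real.exp_add]
  ring_nf

lemma mu0_pos (v : V3) : 0 < mu0 v := by unfold mu0; positivity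

lemma sqmu_pos (v : V3) : 0 < sqmu v := Real.sqrt_pos.2 (mu0_pos v)

lemma sqmu_mul_self (v : V3) : sqmu v * sqmu v = mu0 v := Real.mul_self_sqrt (mu0_pos v).le

lemma RD1_sqmu : RD1 sqmu :=
  ((TG1.const csq).mulRD (RD1_exp (by norm_num : (0 : ℝ) < 1 / 4))).congr sqmu_eq

lemma RD1_mu0 : RD1 mu0 := (RD1_sqmu.mul RD1_sqmu).congr fun v => (sqmu_mul_self v).symm

lemma pd_sqmu (i : Fin 3) (v : V3) : pd i sqmu v = -(1 / 2) * v i * sqmu v := by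
  rw [show sqmu = fun v => csq * Real.exp (-(1 / 4) * ‖v‖ ^ 2) from funext sqmu_eq,
    pd_mul (differentiable_const _) (fun v => (pd_exp _ v).1), pd_const, (pd_exp _ v).2]
  ring

lemma pd_mu0 (i : Fin 3) (v : V3) : pd i mu0 v = - v i * mu0 v := by
  rw [show mu0 = fun v => sqmu v * sqmu v from funext fun v => (sqmu_mul_self v).symm,
    pd_mul RD1_sqmu.1 RD1_sqmu.1, pd_sqmu]
  ring

lemma RD_schwartz (g : SchwartzMap V3 ℝ) : RD g := by
  refine ⟨g.continuous.measurable, fun k => ?_⟩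
  obtain ⟨C, _, hC⟩ := g.decay 0 0
  obtain ⟨D, _, hD⟩ := g.decay (2 * k) 0
  refine ⟨2 ^ k * (C + D), fun v => ?_⟩
  have h1 := hC v
  have h2 := hD v
  simp only [norm_iteratedFDeriv_zero, pow_zero, one_mul, Real.norm_eq_abs] at h1 h2
  have h3 : jap v ^ k ≤ 2 ^ k * (1 + ‖v‖ ^ (2 * k)) := by
    have e1 : jap v ^ k ≤ (1 + ‖v‖ ^ 2) ^ k := by
      rw [← jap_sq, ← pow_mul]; exact pow_le_pow_right₀ (one_le_jap v) (by omega)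
    refine e1.trans ?_
    rw [pow_mul]
    rcases le_total (‖v‖ ^ 2) 1 with h | h
    · calc (1 + ‖v‖ ^ 2) ^ k ≤ 2 ^ k := by gcongr; linarith
        _ ≤ _ := by
          have : 0 ≤ (‖v‖ ^ 2) ^ k := by positivity
          have h2 : (0 : ℝ) < 2 ^ k := by positivity
          nlinarith
    · calc (1 + ‖v‖ ^ 2) ^ k ≤ (2 * ‖v‖ ^ 2) ^ k := by gcongr; linarith
        _ = 2 ^ k * (‖v‖ ^ 2) ^ k := by rw [mul_pow]
        _ ≤ _ := by gcongr; linarith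
  calc |g v| * jap v ^ k ≤ |g v| * (2 ^ k * (1 + ‖v‖ ^ (2 * k))) := by gcongr
    _ = 2 ^ k * (|g v| + ‖v‖ ^ (2 * k) * |g v|) := by ring
    _ ≤ _ := by gcongr

lemma pd_schwartz (g : SchwartzMap V3 ℝ) (i : Fin 3) :
    ∃ h : SchwartzMap V3 ℝ, pd i g = h :=
  ⟨LineDeriv.lineDerivOp (EuclideanSpace.single i 1 : V3) g, by
    ext v; rw [SchwartzMap.lineDerivOp_apply_eq_fderiv]; rfl⟩

lemma RD1_schwartz (g : SchwartzMap V3 ℝ) : RD1 g := by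
  refine ⟨g.differentiable, RD_schwartz g, fun i => ?_⟩
  obtain ⟨h, hh⟩ := pd_schwartz g i
  rw [hh]; exact RD_schwartz h

lemma RD1_pd_schwartz (g : SchwartzMap V3 ℝ) (i : Fin 3) : RD1 (pd i g) := by
  obtain ⟨h, hh⟩ := pd_schwartz g i
  rw [hh]; exact RD1_schwartz h

/-! ### The kernel -/

lemma ker_eq (z : V3) (i j : Fin 3) :
    kerR z i j = (if i = j then (1 : ℝ) else 0) * ‖z‖ - z i * z j / ‖z‖ := by
  unfold kerR
  rcases eq_or_ne z 0 with h | h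
  · subst h; simp
  · have : ‖z‖ ≠ 0 := norm_ne_zero_iff.2 h
    field_simp

lemma ker_zero (i j : Fin 3) : kerR 0 i j = 0 := by simp [kerR]

lemma ker_symm (z : V3) (i j : Fin 3) : kerR z i j = kerR z j i := by
  unfold kerR; simp only [eq_comm (a := i), mul_comm (z i)]

lemma ker_aux (z w : V3) (i j : Fin 3) :
    |z i * z j / ‖z‖ - w i * w j / ‖w‖| ≤ 3 * ‖z - w‖ := by
  have key : ∀ y : V3, |y i * y j / ‖y‖| ≤ ‖y‖ := fun y => by
    rcases eq_or_ne y 0 with h | h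
    · subst h; simp
    have hy : 0 < ‖y‖ := norm_pos_iff.2 h
    rw [abs_div, abs_mul, abs_of_pos hy, div_le_iff₀ hy]
    exact mul_le_mul (coord_le y i) (coord_le y j) (abs_nonneg _) hy.le
  rcases eq_or_ne z 0 with hz | hz
  · subst hz
    have := key w
    simp only [PiLp.zero_apply, zero_mul, zero_div, zero_sub, abs_neg, norm_neg]
    linarith [norm_nonneg w]
  rcases eq_or_ne w 0 with hw | hw
  · subst hw
    have := key z
    simp only [PiLp.zero_apply, zero_mul, zero_div, sub_zero]
    linarith [norm_nonneg z]
  have hz' : 0 < ‖z‖ := norm_pos_iff.2 hz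
  have hw' : 0 < ‖w‖ := norm_pos_iff.2 hw
  have e : z i * z j / ‖z‖ - w i * w j / ‖w‖ = (z i / ‖z‖) * (z j - w j)
      + (w j / ‖w‖) * (z i - w i) + (w j / ‖w‖) * (z i / ‖z‖) * (‖w‖ - ‖z‖) := by
    field_simp; ring
  have u1 : |z i / ‖z‖| ≤ 1 := by
    rw [abs_div, abs_of_pos hz', div_le_one hz']; exact coord_le z i
  have u2 : |w j / ‖w‖| ≤ 1 := by
    rw [abs_div, abs_of_pos hw', div_le_one hw']; exact coord_le w j
  have d1 : |z j - w j| ≤ ‖z - w‖ := by simpa using coord_le (z - w) j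
  have d2 : |z i - w i| ≤ ‖z - w‖ := by simpa using coord_le (z - w) i
  have d3 : |‖w‖ - ‖z‖| ≤ ‖z - w‖ := by
    rw [norm_sub_rev]; exact abs_norm_sub_norm_le w z
  have n := norm_nonneg (z - w)
  rw [e]
  refine (abs_add_three _ _ _).trans ?_
  simp only [abs_mul]
  have t1 : |z i / ‖z‖| * |z j - w j| ≤ 1 * ‖z - w‖ := by gcongr
  have t2 : |w j / ‖w‖| * |z i - w i| ≤ 1 * ‖z - w‖ := by gcongr
  have t3 : |w j / ‖w‖| * |z i / ‖z‖| * |‖w‖ - ‖z‖| ≤ 1 * 1 * ‖z - w‖ := by gcongr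
  linarith

lemma ker_lip (z w : V3) (i j : Fin 3) : |kerR z i j - kerR w i j| ≤ 4 * ‖z - w‖ := by
  rw [ker_eq, ker_eq]
  have h1 := ker_aux z w i j
  have h2 := abs_norm_sub_norm_le z w
  have h3 : |(if i = j then (1 : ℝ) else 0) * (‖z‖ - ‖w‖)| ≤ ‖z - w‖ := by
    split_ifs
    · simpa using h2
    · simp
  have h4 := abs_sub ((if i = j then (1 : ℝ) else 0) * (‖z‖ - ‖w‖))
    (z i * z j / ‖z‖ - w i * w j / ‖w‖)
  calc _ = |(if i = j then (1 : ℝ) else 0) * (‖z‖ - ‖w‖)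
        - (z i * z j / ‖z‖ - w i * w j / ‖w‖)| := by congr 1; ring
    _ ≤ _ := by linarith

lemma ker_bd (z : V3) (i j : Fin 3) : |kerR z i j| ≤ 4 * ‖z‖ := by
  simpa [ker_zero] using ker_lip z 0 i j

lemma ker_cont (i j : Fin 3) : Continuous (fun z => kerR z i j) := by
  have : LipschitzWith 4 (fun z => kerR z i j) := by
    apply LipschitzWith.of_dist_le_mul
    intro z w
    rw [Real.dist_eq, dist_eq_norm]
    simpa using ker_lip z w i j
  exact this.continuous

lemma ker_diff (i j : Fin 3) {z : V3} (hz : z ≠ 0) : DifferentiableAt ℝ (fun z => kerR z i j) z := by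
  have h1 : DifferentiableAt ℝ (fun z : V3 => ‖z‖) z := (differentiableAt_id.norm ℝ hz)
  have h2 := (coord_diff i) z
  have h3 := (coord_diff j) z
  unfold kerR
  have h4 : ‖z‖ ^ 2 ≠ 0 := by simpa using hz
  have h5 : DifferentiableAt ℝ (fun z : V3 => ‖z‖ ^ 2) z := h1.pow 2
  fun_prop (disch := assumption)

lemma ker_null (z : V3) (i : Fin 3) : ∑ j, kerR z i j * z j = 0 := by
  rcases eq_or_ne z 0 with h | h
  · subst h; simp
  have hz : ‖z‖ ≠ 0 := norm_ne_zero_iff.2 h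
  have hs := norm_sq_coord z
  simp only [ker_eq, sub_mul, Finset.sum_sub_distrib]
  have e1 : ∑ j, (if i = j then (1 : ℝ) else 0) * ‖z‖ * z j = ‖z‖ * z i := by
    simp
  have e2 : ∑ j, z i * z j / ‖z‖ * z j = z i / ‖z‖ * ∑ j, z j ^ 2 := by
    rw [Finset.mul_sum]; exact Finset.sum_congr rfl fun j _ => by ring
  rw [e1, e2, ← hs]; field_simp; ring

/-- the quadratic form of the kernel -/
lemma ker_quad (z : V3) (a : Fin 3 → ℝ) : ∑ i, ∑ j, kerR z i j * (a i * a j)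
    = ((z 0 * a 1 - z 1 * a 0) ^ 2 + (z 0 * a 2 - z 2 * a 0) ^ 2
      + (z 1 * a 2 - z 2 * a 1) ^ 2) / ‖z‖ := by
  rcases eq_or_ne z 0 with h | h
  · subst h; simp [ker_zero]
  have hz : ‖z‖ ≠ 0 := norm_ne_zero_iff.2 h
  have hs := norm_sq_coord z
  rw [Fin.sum_univ_three] at hs
  rw [eq_div_iff hz]
  simp only [ker_eq, Fin.sum_univ_three]
  norm_num [Fin.ext_iff]
  field_simp
  rw [hs]; ring

lemma norm_sub_le_jap (v u : V3) : ‖v - u‖ ≤ 2 * jap v * jap u := by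
  have h1 := norm_sub_le v u
  have h2 := norm_le_jap v
  have h3 := norm_le_jap u
  have h4 := one_le_jap v
  have h5 := one_le_jap u
  nlinarith

lemma ker_bd' (v u : V3) (i j : Fin 3) : |kerR (v - u) i j| ≤ 8 * jap v * jap u := by
  have := ker_bd (v - u) i j
  have := norm_sub_le_jap v u
  linarith

lemma ker_TG (v : V3) (i j : Fin 3) : TG (fun u => kerR (v - u) i j) :=
  TG_of_cont (C := 8 * jap v) (k := 1) ((ker_cont i j).comp (by fun_prop))
    fun u => by simpa using ker_bd' v u i j

/-- convolution with the kernel -/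
def cv (i j : Fin 3) (f : V3 → ℝ) (v : V3) : ℝ := ∫ u : V3, kerR (v - u) i j * f u

lemma cv_int (i j : Fin 3) {f : V3 → ℝ} (hf : RD f) (v : V3) :
    Integrable (fun u => kerR (v - u) i j * f u) := ((ker_TG v i j).mulRD hf).integrable

lemma cv_lip (i j : Fin 3) {f : V3 → ℝ} (hf : RD f) (v w : V3) :
    |cv i j f v - cv i j f w| ≤ (4 * ∫ u, |f u|) * ‖v - w‖ := by
  unfold cv
  rw [← integral_sub (cv_int i j hf v) (cv_int i j hf w)]
  rw [← Real.norm_eq_abs]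
  refine (norm_integral_le_of_norm_le (hf.abs.integrable.const_mul (4 * ‖v - w‖))
    (Filter.Eventually.of_forall fun u => ?_)).trans (le_of_eq ?_)
  · rw [← sub_mul, Real.norm_eq_abs, abs_mul]
    gcongr
    simpa using ker_lip (v - u) (w - u) i j
  · rw [integral_const_mul]; ring

lemma cv_diff (i j : Fin 3) {f : V3 → ℝ} (hf : RD f) : Differentiable ℝ (cv i j f) := by
  intro v
  have hae : ∀ᵐ u : V3, v - u ≠ 0 := by
    have : ∀ᵐ u : V3, u ≠ v := Measure.ae_ne volume v
    filter_upwards [this] with u hu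
    exact sub_ne_zero.2 hu.symm
  have hd : ∀ u : V3, v - u ≠ 0 → HasFDerivAt (fun w : V3 => kerR (w - u) i j * f u)
      (f u • fderiv ℝ (fun z => kerR z i j) (v - u)) v := fun u hu => by
    have h1 := (ker_diff i j hu).hasFDerivAt
    have h2 : HasFDerivAt (fun w : V3 => w - u) (ContinuousLinearMap.id ℝ V3) v :=
      (hasFDerivAt_id v).sub_const u
    have h3 := h1.comp v h2
    exact h3.mul_const (f u)
  have h := hasFDerivAt_integral_of_dominated_loc_of_lip' (𝕜 := ℝ) (μ := (volume : Measure V3))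
    (F := fun w u => kerR (w - u) i j * f u)
    (F' := fun u => f u • fderiv ℝ (fun z => kerR z i j) (v - u))
    (x₀ := v) (s := Set.univ) (bound := fun u => 4 * |f u|) Filter.univ_mem
    (fun w _ => (cv_int i j hf w).1) (cv_int i j hf v) ?_
    (Filter.Eventually.of_forall fun u w _ => ?_) (hf.abs.integrable.const_mul 4)
    (hae.mono hd)
  · exact h.2.differentiableAt
  · apply Measurable.aestronglyMeasurable
    exact hf.1.smul ((measurable_fderiv ℝ (fun z => kerR z i j)).comp (by fun_prop))
  · rw [← sub_mul, Real.norm_eq_abs, abs_mul]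
    have := ker_lip (w - u) (v - u) i j
    rw [sub_sub_sub_cancel_right] at this
    nlinarith [abs_nonneg (f u)]

lemma cv_pd_bd (i j k : Fin 3) {f : V3 → ℝ} (hf : RD f) (v : V3) :
    |pd k (cv i j f) v| ≤ 4 * ∫ u, |f u| := by
  have h0 : 0 ≤ 4 * ∫ u, |f u| := by
    have : 0 ≤ ∫ u, |f u| := integral_nonneg fun u => abs_nonneg _
    linarith
  have h := norm_fderiv_le_of_lip' ℝ (f := cv i j f) (x₀ := v) h0
    (Filter.Eventually.of_forall fun w => by
      simpa [Real.norm_eq_abs] using cv_lip i j hf w v)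
  unfold pd
  have h2 := (fderiv ℝ (cv i j f) v).le_opNorm (EuclideanSpace.single k 1)
  simp only [PiLp.norm_single, norm_one, mul_one, Real.norm_eq_abs] at h2
  linarith

lemma cv_bd (i j : Fin 3) {f : V3 → ℝ} (hf : RD f) (v : V3) :
    |cv i j f v| ≤ 8 * jap v * ∫ u, jap u * |f u| := by
  unfold cv
  have hj : RD (fun u => jap u * |f u|) :=
    (TG_jap 1).mulRD hf.abs |>.congr fun u => by rw [Real.rpow_one]
  rw [← Real.norm_eq_abs, ← integral_const_mul]
  refine norm_integral_le_of_norm_le (hj.integrable.const_mul (8 * jap v))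
    (Filter.Eventually.of_forall fun u => ?_)
  rw [Real.norm_eq_abs, abs_mul, ← mul_assoc]
  gcongr
  exact ker_bd' v u i j

lemma TG1_cv (i j : Fin 3) {f : V3 → ℝ} (hf : RD f) : TG1 (cv i j f) := by
  refine ⟨cv_diff i j hf, TG_of_cont (cv_diff i j hf).continuous
    (C := 8 * ∫ u, jap u * |f u|) (k := 1) fun v => ?_, fun k =>
    ⟨pd_meas k _, 4 * ∫ u, |f u|, 0, fun v => by simpa using cv_pd_bd i j k hf v⟩⟩
  have := cv_bd i j hf v
  rw [pow_one]; linarith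

/-! ### The operator in divergence form -/

/-- the vector `σ v` -/
def hh (i : Fin 3) (v : V3) : ℝ := ∑ j, cv i j (fun u => u j * mu0 u) v

lemma RD_coord_mu0 (j : Fin 3) : RD (fun u : V3 => u j * mu0 u) :=
  (TG1_coord j).2.1.mulRD RD1_mu0.2.1

lemma sigR_eq (v : V3) (i j : Fin 3) : sigR v i j = cv i j mu0 v := rfl

lemma sum_cv (i : Fin 3) {f : Fin 3 → V3 → ℝ} (hf : ∀ j, RD (f j)) (v : V3) :
    ∑ j, cv i j (f j) v = ∫ u, ∑ j, kerR (v - u) i j * f j u := by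
  unfold cv
  rw [integral_finsetSum]
  exact fun j _ => cv_int i j (hf j) v

lemma hh_eq (i : Fin 3) (v : V3) : hh i v = ∑ j, sigR v i j * v j := by
  have h1 : ∑ j, sigR v i j * v j = ∑ j, cv i j (fun u => v j * mu0 u) v := by
    refine Finset.sum_congr rfl fun j _ => ?_
    unfold sigR cv
    rw [← integral_mul_const]
    congr 1; ext u; ring
  rw [h1, hh, sum_cv i (fun j => RD_coord_mu0 j), sum_cv i (fun j => RD1_mu0.2.1.const_mul (v j))]
  congr 1; ext u
  have := ker_null (v - u) i
  have e : ∑ j, kerR (v - u) i j * (v j * mu0 u) - ∑ j, kerR (v - u) i j * (u j * mu0 u)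
      = mu0 u * ∑ j, kerR (v - u) i j * (v - u) j := by
    rw [← Finset.sum_sub_distrib, Finset.mul_sum]
    exact Finset.sum_congr rfl fun j _ => by simp; ring
  rw [this, mul_zero] at e
  linarith

lemma TG1_hh (i : Fin 3) : TG1 (hh i) := TG1.sum fun j => TG1_cv i j (RD_coord_mu0 j)

lemma TG1_sigR (i j : Fin 3) : TG1 (fun v => sigR v i j) := TG1_cv i j RD1_mu0.2.1

/-- the local part of the flux -/
def GG (g : V3 → ℝ) (i : Fin 3) (v : V3) : ℝ :=
  ∑ j, sigR v i j * pd j g v + 1 / 2 * g v * hh i v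

/-- the density in the nonlocal flux -/
def mm (g : V3 → ℝ) (j : Fin 3) (u : V3) : ℝ := sqmu u * (pd j g u + 1 / 2 * u j * g u)

/-- the nonlocal part of the flux -/
def MM (g : V3 → ℝ) (i : Fin 3) (v : V3) : ℝ := ∑ j, cv i j (mm g j) v

lemma pd_sqmu_mul {g : V3 → ℝ} (hg : Differentiable ℝ g) (i : Fin 3) (v : V3) :
    pd i (fun w => sqmu w * g w) v = sqmu v * (pd i g v - 1 / 2 * v i * g v) := by
  rw [pd_mul RD1_sqmu.1 hg, pd_sqmu]; ring

lemma RD_mm {g : V3 → ℝ} (hg : RD1 g) (j : Fin 3) : RD (mm g j) :=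
  RD1_sqmu.2.1.mul ((hg.2.2 j).add
    (((TG.const (1 / 2)).mul (TG1_coord j).2.1).mulRD hg.2.1))

lemma TG1_MM {g : V3 → ℝ} (hg : RD1 g) (i : Fin 3) : TG1 (MM g i) :=
  TG1.sum fun j => TG1_cv i j (RD_mm hg j)

lemma flux1 {g : V3 → ℝ} (hg : RD1 g) (i : Fin 3) (w : V3) :
    (∫ u : V3, ∑ j, kerR (w - u) i j *
      (mu0 u * pd j (fun w => sqmu w * g w) w - (sqmu w * g w) * pd j mu0 u))
    = sqmu w * GG g i w := by
  have hP := fun j => pd_sqmu_mul hg.1 j w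
  have e : ∀ u : V3, ∑ j, kerR (w - u) i j *
      (mu0 u * pd j (fun w => sqmu w * g w) w - (sqmu w * g w) * pd j mu0 u)
      = ∑ j, (kerR (w - u) i j * mu0 u * (sqmu w * (pd j g w - 1 / 2 * w j * g w))
        + kerR (w - u) i j * (u j * mu0 u) * (sqmu w * g w)) := fun u => by
    refine Finset.sum_congr rfl fun j _ => ?_
    rw [hP, pd_mu0]; ring
  simp only [e]
  have i1 := fun j => (cv_int i j RD1_mu0.2.1 w).mul_const (sqmu w * (pd j g w - 1 / 2 * w j * g w))
  have i2 := fun j => (cv_int i j (RD_coord_mu0 j) w).mul_const (sqmu w * g w)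
  rw [integral_finsetSum]
  rotate_left
  · exact fun j _ => (i1 j).add (i2 j)
  simp_rw [fun j => integral_add (i1 j) (i2 j), integral_mul_const]
  rw [Finset.sum_add_distrib, ← Finset.sum_mul]
  have h1 : ∑ j, (∫ u, kerR (w - u) i j * (u j * mu0 u)) = hh i w := rfl
  have h2 : ∑ j, (∫ u, kerR (w - u) i j * mu0 u) * (sqmu w * (pd j g w - 1 / 2 * w j * g w))
      = sqmu w * ∑ j, sigR w i j * pd j g w - 1 / 2 * sqmu w * g w * ∑ j, sigR w i j * w j := by
    rw [Finset.mul_sum, Finset.mul_sum, ← Finset.sum_sub_distrib]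
    exact Finset.sum_congr rfl fun j _ => by unfold sigR; ring
  rw [h1, h2, ← hh_eq]
  unfold GG; ring

lemma flux2 {g : V3 → ℝ} (hg : RD1 g) (i : Fin 3) (w : V3) :
    (∫ u : V3, ∑ j, kerR (w - u) i j *
      ((sqmu u * g u) * pd j mu0 w - mu0 w * pd j (fun w => sqmu w * g w) u))
    = - (mu0 w * MM g i w) := by
  unfold MM
  rw [sum_cv i (fun j => RD_mm hg j), ← integral_const_mul, ← integral_neg]
  congr 1; ext u
  have e : ∑ j, kerR (w - u) i j *
      ((sqmu u * g u) * pd j mu0 w - mu0 w * pd j (fun w => sqmu w * g w) u)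
      + mu0 w * ∑ j, kerR (w - u) i j * mm g j u
      = - mu0 w * sqmu u * g u * ∑ j, kerR (w - u) i j * (w - u) j := by
    rw [Finset.mul_sum, Finset.mul_sum, ← Finset.sum_add_distrib]
    refine Finset.sum_congr rfl fun j _ => ?_
    rw [pd_mu0, pd_sqmu_mul hg.1]
    unfold mm; simp; ring
  rw [ker_null, mul_zero] at e
  linarith

/-- the total flux divided by `sqmu` -/
def JJ (g : V3 → ℝ) (i : Fin 3) (v : V3) : ℝ := GG g i v - sqmu v * MM g i v

lemma RD1_GG (g : SchwartzMap V3 ℝ) (i : Fin 3) : RD1 (GG g i) :=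
  (RD1.sum fun j => (TG1_sigR i j).mulRD (RD1_pd_schwartz g j)).add
    (
      ((TG1_hh i).mulRD ((TG1.const (1 / 2)).mulRD (RD1_schwartz g))).congr
        fun _ => mul_comm _ _)

lemma RD1_JJ (g : SchwartzMap V3 ℝ) (i : Fin 3) : RD1 (JJ g i) :=
  (RD1_GG g i).sub (((TG1_MM (RD1_schwartz g) i).mulRD RD1_sqmu).congr fun _ => mul_comm _ _)

lemma LR_eq (g : SchwartzMap V3 ℝ) (v : V3) :
    LR g v = - ∑ i, (pd i (JJ g i) v - 1 / 2 * v i * JJ g i v) := by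
  have hg := RD1_schwartz g
  unfold LR landauQ
  simp only [flux1 hg, flux2 hg]
  rw [← Finset.sum_add_distrib]
  have e : ∀ i, pd i (fun w => sqmu w * GG g i w) v + pd i (fun w => -(mu0 w * MM g i w)) v
      = sqmu v * (pd i (JJ g i) v - 1 / 2 * v i * JJ g i v) := fun i => by
    have h1 := (RD1_sqmu.mul (RD1_GG g i)).1
    have h2 : RD1 (fun w => -(mu0 w * MM g i w)) :=
      (((TG1_MM hg i).mulRD RD1_mu0).neg).congr fun v => by ring
    rw [← pd_add h1 h2.1]
    have : (fun w => sqmu w * GG g i w + -(mu0 w * MM g i w)) = fun w => sqmu w * JJ g i w := by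
      ext w; unfold JJ; rw [← sqmu_mul_self]; ring
    rw [this, pd_mul RD1_sqmu.1 (RD1_JJ g i).1, pd_sqmu]; ring
  simp only [e]
  rw [← Finset.mul_sum]
  rw [neg_mul, inv_mul_cancel_left₀ (sqmu_pos v).ne']

/-! ### Lower bound for the diffusion matrix -/

/-- the auxiliary Gaussian -/
def ee (u : V3) : ℝ := Real.exp (-1 * ‖u‖ ^ 2)

lemma RD1_ee : RD1 ee := RD1_exp one_pos

lemma ee_pos (u : V3) : 0 < ee u := Real.exp_pos _

lemma pd_ee (i : Fin 3) (u : V3) : pd i ee u = -2 * u i * ee u := by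
  have := (pd_exp 1 u).2 i
  unfold ee; rw [this]; ring

lemma ee_mom1 (i : Fin 3) : ∫ u : V3, u i * ee u = 0 := by
  have h := ibp (TG1.const 1) RD1_ee i
  simp only [pd_const, zero_mul, integral_zero, neg_zero, one_mul, pd_ee, mul_assoc] at h
  rw [integral_const_mul] at h
  linarith

lemma ee_mom2 (i j : Fin 3) : ∫ u : V3, u i * u j * ee u
    = (if i = j then 1 else 0) * (1 / 2 * ∫ u : V3, ee u) := by
  have h := ibp (TG1_coord i) RD1_ee j
  simp only [pd_coord, pd_ee] at h
  rw [integral_const_mul] at h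
  have e : ∀ u : V3, u i * (-2 * u j * ee u) = -2 * (u i * u j * ee u) := fun u => by ring
  simp only [e] at h
  rw [integral_const_mul] at h
  simp only [eq_comm (a := j)] at h
  linarith

lemma ee_quad (p : ℝ) (l : Fin 3 → ℝ) (q : Fin 3 → Fin 3 → ℝ) :
    ∫ u : V3, (p * ee u + ∑ i, l i * (u i * ee u) + ∑ i, ∑ j, q i j * (u i * u j * ee u))
      = (p + 1 / 2 * ∑ i, q i i) * ∫ u : V3, ee u := by
  have r0 := RD1_ee.2.1
  have r1 := fun i => (TG1_coord i).2.1.mulRD r0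
  have r2 : ∀ i j, RD (fun u : V3 => u i * u j * ee u) :=
    fun i j => ((TG1_coord i).2.1.mul (TG1_coord j).2.1).mulRD r0
  have a0 := (r0.const_mul p).integrable
  have a1 := (RD.sum fun i => (r1 i).const_mul (l i)).integrable
  have a2 := (RD.sum fun i => RD.sum fun j => (r2 i j).const_mul (q i j)).integrable
  rw [integral_add ((r0.const_mul p).add (RD.sum fun i => (r1 i).const_mul (l i))).integrable a2, integral_add a0 a1, integral_const_mul,
    integral_finsetSum _ (fun i _ => ((r1 i).const_mul (l i)).integrable),
    integral_finsetSum _ (fun i _ => (RD.sum fun j => (r2 i j).const_mul (q i j)).integrable)]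
  have e2 : ∀ i, ∫ u : V3, ∑ j, q i j * (u i * u j * ee u) = q i i * (1 / 2 * ∫ u : V3, ee u) := by
    intro i
    rw [integral_finsetSum _ (fun j _ => ((r2 i j).const_mul (q i j)).integrable)]
    simp only [integral_const_mul, ee_mom2]
    simp
  simp only [e2, integral_const_mul, ee_mom1, mul_zero, Finset.sum_const_zero]
  rw [← Finset.sum_mul]; ring

/-- squared norm of the cross product -/
def crs (z : V3) (a : Fin 3 → ℝ) : ℝ :=
  (z 0 * a 1 - z 1 * a 0) ^ 2 + (z 0 * a 2 - z 2 * a 0) ^ 2 + (z 1 * a 2 - z 2 * a 1) ^ 2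

lemma crs_nonneg (z : V3) (a : Fin 3 → ℝ) : 0 ≤ crs z a := by unfold crs; positivity

/-- quadratic form of `sigR` -/
def sqf (v : V3) (a b : Fin 3 → ℝ) : ℝ := ∑ i, ∑ j, sigR v i j * (a i * b j)

lemma sqf_eq (v : V3) (a : Fin 3 → ℝ) : sqf v a a = ∫ u, crs (v - u) a / ‖v - u‖ * mu0 u := by
  unfold sqf sigR
  have hi := fun i j => (cv_int i j RD1_mu0.2.1 v).mul_const (a i * a j)
  simp only [← integral_mul_const]
  have e : ∀ i, ∑ j, ∫ u, kerR (v - u) i j * mu0 u * (a i * a j)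
      = ∫ u, ∑ j, kerR (v - u) i j * mu0 u * (a i * a j) := fun i => by
    rw [integral_finsetSum _ (fun j _ => hi i j)]
  simp only [e]
  rw [← integral_finsetSum _ (fun i _ => integrable_finsetSum _ (fun j _ => hi i j))]
  congr 1; ext u
  have := ker_quad (v - u) a
  unfold crs
  rw [← this, Finset.sum_mul]
  refine Finset.sum_congr rfl fun i _ => ?_
  rw [Finset.sum_mul]
  exact Finset.sum_congr rfl fun j _ => by ring

lemma crs_int (v : V3) (a : Fin 3 → ℝ) :
    Integrable (fun u => crs (v - u) a / ‖v - u‖ * mu0 u) := by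
  have hi := fun i j => (cv_int i j RD1_mu0.2.1 v).mul_const (a i * a j)
  refine (integrable_finsetSum Finset.univ (fun i _ => integrable_finsetSum Finset.univ
    (fun j _ => hi i j))).congr (Filter.Eventually.of_forall fun u => ?_)
  have := ker_quad (v - u) a
  simp only
  unfold crs
  rw [← this, Finset.sum_mul]
  refine Finset.sum_congr rfl fun i _ => ?_
  rw [Finset.sum_mul]
  exact Finset.sum_congr rfl fun j _ => by ring

lemma sqf_nonneg (v : V3) (a : Fin 3 → ℝ) : 0 ≤ sqf v a a := by
  rw [sqf_eq]
  refine integral_nonneg fun u => ?_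
  have := crs_nonneg (v - u) a
  have := mu0_pos u
  simp only [Pi.zero_apply]
  positivity

lemma jap_mul_ee_le (u : V3) : (2 * π) ^ (-(3 : ℝ) / 2) * (jap u * ee u) ≤ mu0 u := by
  unfold mu0
  have hc : 0 ≤ (2 * π) ^ (-(3 : ℝ) / 2) := by positivity
  refine mul_le_mul_of_nonneg_left ?_ hc
  have h1 : jap u ≤ Real.exp (‖u‖ ^ 2 / 2) := by
    unfold jap
    rw [Real.sqrt_le_left (by positivity), ← Real.exp_nat_mul]
    have := Real.add_one_le_exp (‖u‖ ^ 2)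
    have e : ((2 : ℕ) : ℝ) * (‖u‖ ^ 2 / 2) = ‖u‖ ^ 2 := by push_cast; ring
    rw [e]; linarith
  calc jap u * ee u ≤ Real.exp (‖u‖ ^ 2 / 2) * ee u := by
        have := ee_pos u
        gcongr
    _ = _ := by unfold ee; rw [← Real.exp_add]; congr 1; ring

lemma crs_ee (v : V3) (a : Fin 3 → ℝ) :
    Integrable (fun u => crs (v - u) a * ee u) ∧
    (∑ i, a i ^ 2) * ∫ u : V3, ee u ≤ ∫ u, crs (v - u) a * ee u := by
  set A := ∑ i, a i ^ 2 with hA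
  set w := ∑ i, v i * a i with hw
  have e : ∀ u : V3, crs (v - u) a * ee u = crs v a * ee u
      + ∑ i, (-2 * (A * v i - w * a i)) * (u i * ee u)
      + ∑ i, ∑ j, ((if i = j then A else 0) - a i * a j) * (u i * u j * ee u) := fun u => by
    unfold crs
    rw [hA, hw]
    simp only [Fin.sum_univ_three]
    norm_num [Fin.ext_iff]
    ring
  have r0 := RD1_ee.2.1
  have r1 := fun i => (TG1_coord i).2.1.mulRD r0
  have r2 : ∀ i j, RD (fun u : V3 => u i * u j * ee u) :=
    fun i j => ((TG1_coord i).2.1.mul (TG1_coord j).2.1).mulRD r0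
  simp only [e]
  constructor
  · exact (((r0.const_mul _).add (RD.sum fun i => (r1 i).const_mul _)).add
      (RD.sum fun i => RD.sum fun j => (r2 i j).const_mul _)).integrable
  · rw [ee_quad]
    have h0 : 0 ≤ ∫ u : V3, ee u := integral_nonneg fun u => (ee_pos u).le
    refine mul_le_mul_of_nonneg_right ?_ h0
    have := crs_nonneg v a
    have h3 : ∑ i, ((if i = i then A else 0) - a i * a i) = 2 * A := by
      rw [hA]; simp only [Fin.sum_univ_three, if_true]; ring
    rw [h3]; linarith

lemma sqf_lower : ∃ c > (0 : ℝ), ∀ (v : V3) (a : Fin 3 → ℝ),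
    c * ∑ i, a i ^ 2 ≤ jap v * sqf v a a := by
  set K : ℝ := (2 * π) ^ (-(3 : ℝ) / 2) with hK
  have hKp : 0 < K := by rw [hK]; positivity
  have hm : 0 < ∫ u : V3, ee u := by
    refine integral_pos_of_integrable_nonneg_nonzero (x := 0) RD1_ee.1.continuous
      RD1_ee.2.1.integrable (fun u => (ee_pos u).le) (ee_pos 0).ne'
  refine ⟨K / 2 * ∫ u : V3, ee u, by positivity, fun v a => ?_⟩
  have hj := jap_pos v
  obtain ⟨i1, h1⟩ := crs_ee v a
  have h2 : K / (2 * jap v) * ∫ u, crs (v - u) a * ee u ≤ sqf v a a := by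
    rw [sqf_eq, ← integral_const_mul]
    refine integral_mono (i1.const_mul _) (crs_int v a) fun u => ?_
    simp only
    rcases eq_or_ne (v - u) 0 with h | h
    · rw [h]; simp [crs]
    have hz : 0 < ‖v - u‖ := norm_pos_iff.2 h
    have hju := jap_pos u
    have heu := ee_pos u
    have hc := crs_nonneg (v - u) a
    have hn := norm_sub_le_jap v u
    calc K / (2 * jap v) * (crs (v - u) a * ee u)
        = crs (v - u) a / (2 * jap v * jap u) * (K * (jap u * ee u)) := by field_simp
      _ ≤ crs (v - u) a / ‖v - u‖ * mu0 u := by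
        gcongr
        exact jap_mul_ee_le u
  have h3 : jap v * (K / (2 * jap v) * ∫ u, crs (v - u) a * ee u) ≤ jap v * sqf v a a := by gcongr
  refine le_trans ?_ h3
  have e : jap v * (K / (2 * jap v) * ∫ u, crs (v - u) a * ee u)
      = K / 2 * ∫ u, crs (v - u) a * ee u := by field_simp
  rw [e, mul_assoc]
  gcongr
  linarith

/-! ### Energy estimates -/

/-- squared gradient -/
def DD (g : V3 → ℝ) (v : V3) : ℝ := ∑ i, pd i g v ^ 2

/-- dissipation of the gradient -/
def Qd (g : V3 → ℝ) (v : V3) : ℝ := sqf v (fun i => pd i g v) (fun i => pd i g v)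

/-- dissipation of the velocity -/
def Qv (v : V3) : ℝ := sqf v (fun i => v i) (fun i => v i)

lemma Qd_nonneg (g : V3 → ℝ) (v : V3) : 0 ≤ Qd g v := sqf_nonneg _ _

lemma Qv_nonneg (v : V3) : 0 ≤ Qv v := sqf_nonneg _ _

lemma nrm_eq (ℓ : ℝ) (g : V3 → ℝ) :
    sRNormSq ℓ g = ∫ v, jap v ^ (2 * ℓ) * (Qd g v + Qv v * g v ^ 2) := by
  unfold sRNormSq
  congr 1; ext v
  congr 1
  unfold Qd Qv sqf
  rw [Finset.sum_mul, ← Finset.sum_add_distrib]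
  refine Finset.sum_congr rfl fun i _ => ?_
  rw [Finset.sum_mul, ← Finset.sum_add_distrib]
  exact Finset.sum_congr rfl fun j _ => by ring

lemma RD_Qd {g : V3 → ℝ} (hg : RD1 g) : RD (Qd g) :=
  RD.sum fun i => RD.sum fun j => (TG1_sigR i j).2.1.mulRD ((hg.2.2 i).mul (hg.2.2 j))

lemma TG_Qv : TG Qv :=
  TG.sum fun i => TG.sum fun j => (TG1_sigR i j).2.1.mul ((TG1_coord i).2.1.mul (TG1_coord j).2.1)

lemma RD_sq {g : V3 → ℝ} (hg : RD g) : RD (fun v => g v ^ 2) :=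
  (hg.mul hg).congr fun v => pow_two _

lemma RD_DD {g : V3 → ℝ} (hg : RD1 g) : RD (DD g) := RD.sum fun i => RD_sq (hg.2.2 i)

lemma TG_normsq : TG (fun v : V3 => ‖v‖ ^ 2) :=
  (TG.sum fun i => (TG1_coord i).2.1.mul (TG1_coord i).2.1).congr fun v => by
    rw [norm_sq_coord]; exact Finset.sum_congr rfl fun i _ => pow_two _

lemma RD_nrm {g : V3 → ℝ} (hg : RD1 g) (a : ℝ) :
    RD (fun v => jap v ^ a * (Qd g v + Qv v * g v ^ 2)) :=
  (TG_jap a).mulRD ((RD_Qd hg).add (TG_Qv.mulRD (RD_sq hg.2.1)))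

lemma jap_add_two (a b : ℝ) (h : b = a + 2) (v : V3) : jap v ^ b = jap v ^ a * (1 + ‖v‖ ^ 2) := by
  rw [h, Real.rpow_add (jap_pos v), ← jap_sq]
  norm_num

/-- the Poincare type identity -/
lemma poinc (a : ℝ) {g : V3 → ℝ} (hg : RD1 g) :
    RD (fun v => 3 * (jap v ^ a * g v ^ 2) + a * (‖v‖ ^ 2 * jap v ^ (a - 2) * g v ^ 2)
      + 2 * (jap v ^ a * g v * ∑ i, v i * pd i g v)) ∧
    ∫ v, (3 * (jap v ^ a * g v ^ 2) + a * (‖v‖ ^ 2 * jap v ^ (a - 2) * g v ^ 2)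
      + 2 * (jap v ^ a * g v * ∑ i, v i * pd i g v)) = 0 := by
  have hf := fun i => (TG1_coord i).mul (TG1_jap a)
  have hgg := hg.mul hg
  have h := fun i => ibp (hf i) hgg i
  have r1 : ∀ i, RD (fun v => v i * jap v ^ a * pd i (fun w => g w * g w) v) :=
    fun i => (hf i).2.1.mulRD (hgg.2.2 i)
  have r2 : ∀ i, RD (fun v => pd i (fun w : V3 => w i * jap w ^ a) v * (g v * g v)) :=
    fun i => ((hf i).2.2 i).mulRD hgg.2.1
  have e : ∀ v, 3 * (jap v ^ a * g v ^ 2) + a * (‖v‖ ^ 2 * jap v ^ (a - 2) * g v ^ 2)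
      + 2 * (jap v ^ a * g v * ∑ i, v i * pd i g v)
      = ∑ i, (v i * jap v ^ a * pd i (fun w => g w * g w) v
        + pd i (fun w : V3 => w i * jap w ^ a) v * (g v * g v)) := fun v => by
    simp only [pd_mul hg.1 hg.1, fun i => pd_mul (coord_diff i) (TG1_jap a).1, pd_coord, pd_jap]
    rw [norm_sq_coord]
    simp only [Fin.sum_univ_three, if_true]
    ring
  have r := RD.sum fun i => (r1 i).add (r2 i)
  refine ⟨r.congr e, ?_⟩
  simp only [e]
  rw [integral_finsetSum _ (fun i _ => ((r1 i).add (r2 i)).integrable)]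
  refine Finset.sum_eq_zero fun i _ => ?_
  rw [integral_add (r1 i).integrable (r2 i).integrable, h i]
  ring

lemma energy_alg (J s D x p a : ℝ) (hJ : 0 ≤ J) (hs : 0 ≤ s) (hD : 0 ≤ D) (cs : p ^ 2 ≤ s * D) :
    J * (1 + s) * (1 + s) * (D + (1 + s) * x ^ 2)
      ≤ 1 / 2 * (3 * (J * (1 + s) * x ^ 2) + a * (s * J * x ^ 2) + 2 * (J * (1 + s) * x * p))
        + (|a| + 3) * (J * (1 + s) * (1 + s)) * (D + s * x ^ 2) := by
  have l6 : 0 ≤ x ^ 2 + s * D + 2 * x * p := by nlinarith [sq_nonneg (x + p)]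
  have l7 : 0 ≤ |a| + a := by linarith [neg_le_abs a]
  have hA := abs_nonneg a
  have e : 1 / 2 * (3 * (J * (1 + s) * x ^ 2) + a * (s * J * x ^ 2) + 2 * (J * (1 + s) * x * p))
        + (|a| + 3) * (J * (1 + s) * (1 + s)) * (D + s * x ^ 2)
      - J * (1 + s) * (1 + s) * (D + (1 + s) * x ^ 2)
      = 1 / 2 * (J * (1 + s) * (x ^ 2 + s * D + 2 * x * p)) + 1 / 2 * ((|a| + a) * (s * J * x ^ 2))
        + |a| * (J * s * x ^ 2 * (1 / 2 + 2 * s + s ^ 2)) + |a| * (J * (1 + s) * (1 + s) * D)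
        + J * (1 + s) * D * (2 + 3 / 2 * s)
        + J * x ^ 2 * (s + 3 * s ^ 2 + 2 * s ^ 3) := by ring
  have : 0 ≤ 1 / 2 * (J * (1 + s) * (x ^ 2 + s * D + 2 * x * p)) + 1 / 2 * ((|a| + a) * (s * J * x ^ 2))
        + |a| * (J * s * x ^ 2 * (1 / 2 + 2 * s + s ^ 2)) + |a| * (J * (1 + s) * (1 + s) * D)
        + J * (1 + s) * D * (2 + 3 / 2 * s)
        + J * x ^ 2 * (s + 3 * s ^ 2 + 2 * s ^ 3) := by positivity
  linarith

lemma energy_alg2 (c Qd Qv D s x A K j : ℝ) (hc : 0 < c) (hA : 0 ≤ A) (hK : 0 ≤ K)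
    (l1 : c * D ≤ j * Qd) (l2 : c * s ≤ j * Qv) :
    A * K * (D + s * x ^ 2) ≤ A / c * (K * j * (Qd + Qv * x ^ 2)) := by
  have l3 : D + s * x ^ 2 ≤ 1 / c * (j * (Qd + Qv * x ^ 2)) := by
    rw [div_mul_eq_mul_div, one_mul, le_div_iff₀ hc]
    nlinarith [mul_le_mul_of_nonneg_right l2 (sq_nonneg x)]
  calc _ ≤ A * K * (1 / c * (j * (Qd + Qv * x ^ 2))) := by gcongr
    _ = _ := by ring

lemma energy_pt (θ c : ℝ) (hc : 0 < c) (hl : ∀ v a, c * ∑ i, a i ^ 2 ≤ jap v * sqf v a a)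
    (g : V3 → ℝ) (v : V3) :
    jap v ^ (2 * θ - 2) * (DD g v + jap v ^ 2 * g v ^ 2) ≤
     1 / 2 * (3 * (jap v ^ (2 * θ - 4) * g v ^ 2)
      + (2 * θ - 4) * (‖v‖ ^ 2 * jap v ^ (2 * θ - 4 - 2) * g v ^ 2)
      + 2 * (jap v ^ (2 * θ - 4) * g v * ∑ i, v i * pd i g v))
     + (|2 * θ - 4| + 3) / c * (jap v ^ (2 * (θ - 1 / 2)) * (Qd g v + Qv v * g v ^ 2)) := by
  have hj := jap_pos v
  have e2 := jap_add_two (2 * θ - 4) (2 * θ - 2) (by ring) v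
  have ej : jap v ^ (2 * (θ - 1 / 2)) = jap v ^ (2 * θ - 4) * (1 + ‖v‖ ^ 2) * jap v := by
    rw [← e2, show 2 * (θ - 1 / 2) = (2 * θ - 2) + 1 by ring, Real.rpow_add hj, Real.rpow_one]
  have e4 := jap_add_two (2 * θ - 4 - 2) (2 * θ - 4) (by ring) v
  have hJ : 0 < jap v ^ (2 * θ - 4 - 2) := Real.rpow_pos_of_pos hj _
  rw [ej, e2, e4, jap_sq]
  have l1 : c * DD g v ≤ jap v * Qd g v := hl v (fun i => pd i g v)
  have l2 : c * ‖v‖ ^ 2 ≤ jap v * Qv v := by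
    have := hl v (fun i => v i)
    rwa [← norm_sq_coord] at this
  have hD : 0 ≤ DD g v := Finset.sum_nonneg fun i _ => sq_nonneg _
  have cs : (∑ i, v i * pd i g v) ^ 2 ≤ ‖v‖ ^ 2 * DD g v := by
    rw [norm_sq_coord]
    exact Finset.sum_mul_sq_le_sq_mul_sq _ _ _
  have hs0 : 0 ≤ ‖v‖ ^ 2 := by positivity
  have k1 := energy_alg _ _ _ (g v) _ (2 * θ - 4) hJ.le hs0 hD cs
  have k2 := energy_alg2 c _ _ _ _ (g v) (|2 * θ - 4| + 3)
    (jap v ^ (2 * θ - 4 - 2) * (1 + ‖v‖ ^ 2) * (1 + ‖v‖ ^ 2)) _ hc (by positivity)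
    (by positivity) l1 l2
  exact k1.trans (add_le_add le_rfl k2)

lemma energy (θ : ℝ) : ∃ C > (0 : ℝ), ∀ g : SchwartzMap V3 ℝ,
    ∫ v, jap v ^ (2 * θ - 2) * (DD g v + jap v ^ 2 * g v ^ 2) ≤ C * sRNormSq (θ - 1 / 2) g := by
  obtain ⟨c, hc, hl⟩ := sqf_lower
  refine ⟨(|2 * θ - 4| + 3) / c, by positivity, fun g => ?_⟩
  have hg := RD1_schwartz g
  obtain ⟨rp, ip⟩ := poinc (2 * θ - 4) hg
  rw [nrm_eq, ← integral_const_mul]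
  have rn := (RD_nrm hg (2 * (θ - 1 / 2))).const_mul ((|2 * θ - 4| + 3) / c)
  have rp2 := rp.const_mul (1 / 2)
  have tj : TG (fun v => jap v ^ 2) := (TG_jap 2).congr fun v => by norm_num
  have rl : RD (fun v => jap v ^ (2 * θ - 2) * (DD g v + jap v ^ 2 * g v ^ 2)) :=
    (TG_jap _).mulRD ((RD_DD hg).add (tj.mulRD (RD_sq hg.2.1)))
  have key := integral_mono rl.integrable (rp2.add rn).integrable fun v => ?_
  · rw [integral_add rp2.integrable rn.integrable, integral_const_mul, ip] at key
    simpa using key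
  exact energy_pt θ c hc hl g v

lemma cauchy {f k : V3 → ℝ} (hf : RD f) (hk : RD k) :
    (∫ v, f v * k v) ^ 2 ≤ (∫ v, f v ^ 2) * ∫ v, k v ^ 2 := by
  have h : ∀ t : ℝ, 0 ≤ (∫ v, f v ^ 2) * (t * t) + (2 * ∫ v, f v * k v) * t + ∫ v, k v ^ 2 := by
    intro t
    have a1 := (RD_sq hf).const_mul (t * t)
    have a2 := (hf.mul hk).const_mul (2 * t)
    have a3 := RD_sq hk
    have e : ∫ v, (t * t * f v ^ 2 + 2 * t * (f v * k v) + k v ^ 2)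
        = (∫ v, f v ^ 2) * (t * t) + (2 * ∫ v, f v * k v) * t + ∫ v, k v ^ 2 := by
      rw [integral_add (a1.add a2).integrable a3.integrable,
        integral_add a1.integrable a2.integrable, integral_const_mul, integral_const_mul]
      ring
    rw [← e]
    refine integral_nonneg fun v => ?_
    have : t * t * f v ^ 2 + 2 * t * (f v * k v) + k v ^ 2 = (t * f v + k v) ^ 2 := by ring
    simp only [Pi.zero_apply, this]
    positivity
  have := discrim_le_zero h
  unfold discrim at this
  nlinarith

/-! ### The weighted estimate -/

/-- test coefficient -/
def coef (θ : ℝ) (g : V3 → ℝ) (i : Fin 3) (v : V3) : ℝ :=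
  2 * θ * jap v ^ (2 * θ - 2) * v i * g v + jap v ^ (2 * θ) * pd i g v
    + 1 / 2 * v i * (jap v ^ (2 * θ) * g v)

/-- the cross term -/
def PP (g : V3 → ℝ) (v : V3) : ℝ := ∑ i, hh i v * pd i g v

/-- the divergence of `hh` -/
def dh (v : V3) : ℝ := ∑ i, pd i (hh i) v

lemma sigR_symm (v : V3) (i j : Fin 3) : sigR v i j = sigR v j i := by
  unfold sigR
  simp only [fun z => ker_symm z i j]

lemma RD_coef (θ : ℝ) {g : V3 → ℝ} (hg : RD1 g) (i : Fin 3) : RD (coef θ g i) :=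
  ((((((TG.const (2 * θ)).mul (TG_jap _)).mul (TG1_coord i).2.1).mulRD hg.2.1).add
    ((TG_jap _).mulRD (hg.2.2 i))).add
    (((TG.const (1 / 2)).mul (TG1_coord i).2.1).mulRD ((TG_jap _).mulRD hg.2.1)))

lemma lhs_eq (θ : ℝ) (g : SchwartzMap V3 ℝ) :
    ∫ v, jap v ^ (2 * θ) * (LR g v * g v) = ∫ v, ∑ i, coef θ g i v * JJ g i v := by
  have hg := RD1_schwartz g
  have hf := (TG1_jap (2 * θ)).mulRD hg
  have h := fun i => ibp hf.toTG1 (RD1_JJ g i) i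
  have r1 : ∀ i, RD (fun v => jap v ^ (2 * θ) * g v * pd i (JJ g i) v) :=
    fun i => hf.2.1.mul ((RD1_JJ g i).2.2 i)
  have r2 : ∀ i, RD (fun v => pd i (fun w => jap w ^ (2 * θ) * g w) v * JJ g i v) :=
    fun i => (hf.2.2 i).mul (RD1_JJ g i).2.1
  have r3 : ∀ i, RD (fun v => 1 / 2 * v i * (jap v ^ (2 * θ) * g v) * JJ g i v) :=
    fun i => (((TG.const (1 / 2)).mul (TG1_coord i).2.1).mulRD hf.2.1).mul (RD1_JJ g i).2.1
  have e1 : ∀ v, jap v ^ (2 * θ) * (LR g v * g v) = ∑ i, (1 / 2 * v i * (jap v ^ (2 * θ) * g v)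
      * JJ g i v - jap v ^ (2 * θ) * g v * pd i (JJ g i) v) := fun v => by
    rw [LR_eq]
    simp only [Fin.sum_univ_three]
    ring
  have e2 : ∀ v, ∑ i, coef θ g i v * JJ g i v = ∑ i, (1 / 2 * v i * (jap v ^ (2 * θ) * g v)
      * JJ g i v + pd i (fun w => jap w ^ (2 * θ) * g w) v * JJ g i v) := fun v => by
    refine Finset.sum_congr rfl fun i _ => ?_
    rw [pd_mul (TG1_jap _).1 hg.1, pd_jap]
    unfold coef
    ring
  simp only [e1, e2]
  rw [integral_finsetSum _ (fun i _ => ((r3 i).sub (r1 i)).integrable),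
    integral_finsetSum _ (fun i _ => ((r3 i).add (r2 i)).integrable)]
  refine Finset.sum_congr rfl fun i _ => ?_
  rw [integral_sub (r3 i).integrable (r1 i).integrable,
    integral_add (r3 i).integrable (r2 i).integrable, h i]
  ring

lemma vhh (v : V3) : ∑ i, v i * hh i v = Qv v := by
  simp only [hh_eq, Qv, sqf, Fin.sum_univ_three]
  ring

lemma alg_GG (θ : ℝ) (g : V3 → ℝ) (v : V3) : ∑ i, coef θ g i v * GG g i v
    = jap v ^ (2 * θ) * (Qd g v + g v * PP g v + 1 / 4 * g v ^ 2 * Qv v)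
      + 2 * θ * jap v ^ (2 * θ - 2) * (g v * PP g v + 1 / 2 * g v ^ 2 * Qv v) := by
  simp only [coef, GG, Qd, Qv, PP, hh_eq, sqf, Fin.sum_univ_three]
  rw [sigR_symm v 1 0, sigR_symm v 2 0, sigR_symm v 2 1]
  ring

lemma zero_id (θ : ℝ) {g : V3 → ℝ} (hg : RD1 g) :
    RD (fun v => 2 * (jap v ^ (2 * θ) * (g v * PP g v))
      + 2 * θ * jap v ^ (2 * θ - 2) * (g v ^ 2 * Qv v) + jap v ^ (2 * θ) * (dh v * g v ^ 2)) ∧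
    ∫ v, (2 * (jap v ^ (2 * θ) * (g v * PP g v))
      + 2 * θ * jap v ^ (2 * θ - 2) * (g v ^ 2 * Qv v) + jap v ^ (2 * θ) * (dh v * g v ^ 2)) = 0 := by
  have hf := fun i => (TG1_jap (2 * θ)).mul (TG1_hh i)
  have hgg := hg.mul hg
  have h := fun i => ibp (hf i) hgg i
  have r1 : ∀ i, RD (fun v => jap v ^ (2 * θ) * hh i v * pd i (fun w => g w * g w) v) :=
    fun i => (hf i).2.1.mulRD (hgg.2.2 i)
  have r2 : ∀ i, RD (fun v => pd i (fun w : V3 => jap w ^ (2 * θ) * hh i w) v * (g v * g v)) :=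
    fun i => ((hf i).2.2 i).mulRD hgg.2.1
  have e : ∀ v, 2 * (jap v ^ (2 * θ) * (g v * PP g v))
      + 2 * θ * jap v ^ (2 * θ - 2) * (g v ^ 2 * Qv v) + jap v ^ (2 * θ) * (dh v * g v ^ 2)
      = ∑ i, (jap v ^ (2 * θ) * hh i v * pd i (fun w => g w * g w) v
        + pd i (fun w : V3 => jap w ^ (2 * θ) * hh i w) v * (g v * g v)) := fun v => by
    simp only [pd_mul hg.1 hg.1, fun i => pd_mul (TG1_jap (2 * θ)).1 (TG1_hh i).1, pd_jap, ← vhh,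
      PP, dh]
    simp only [Fin.sum_univ_three]
    ring
  have r := RD.sum fun i => (r1 i).add (r2 i)
  refine ⟨r.congr e, ?_⟩
  simp only [e]
  rw [integral_finsetSum _ (fun i _ => ((r1 i).add (r2 i)).integrable)]
  refine Finset.sum_eq_zero fun i _ => ?_
  rw [integral_add (r1 i).integrable (r2 i).integrable, h i]
  ring

lemma dh_bd : ∃ H : ℝ, 0 ≤ H ∧ ∀ v, |dh v| ≤ H := by
  have hd := fun i j => (TG1_cv i j (RD_coord_mu0 j)).1
  refine ⟨∑ i : Fin 3, ∑ j : Fin 3, 4 * ∫ u : V3, |u j * mu0 u|, by positivity, fun v => ?_⟩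
  unfold dh
  refine (Finset.abs_sum_le_sum_abs _ _).trans (Finset.sum_le_sum fun i _ => ?_)
  have : pd i (hh i) v = ∑ j, pd i (cv i j (fun u => u j * mu0 u)) v := by
    unfold pd hh
    rw [fderiv_fun_sum fun j _ => (hd i j) v]
    simp
  rw [this]
  exact (Finset.abs_sum_le_sum_abs _ _).trans (Finset.sum_le_sum fun j _ =>
    cv_pd_bd i j i (RD_coord_mu0 j) v)

lemma PP_bd (g : V3 → ℝ) (v : V3) : |2 * (g v * PP g v)| ≤ Qd g v + Qv v * g v ^ 2 := by
  have h1 := sqf_nonneg v (fun i => pd i g v + v i * g v)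
  have h2 := sqf_nonneg v (fun i => pd i g v - v i * g v)
  have e1 : sqf v (fun i => pd i g v + v i * g v) (fun i => pd i g v + v i * g v)
      = Qd g v + Qv v * g v ^ 2 + 2 * (g v * PP g v) := by
    simp only [Qd, Qv, PP, hh_eq, sqf, Fin.sum_univ_three]
    rw [sigR_symm v 1 0, sigR_symm v 2 0, sigR_symm v 2 1]
    ring
  have e2 : sqf v (fun i => pd i g v - v i * g v) (fun i => pd i g v - v i * g v)
      = Qd g v + Qv v * g v ^ 2 - 2 * (g v * PP g v) := by
    simp only [Qd, Qv, PP, hh_eq, sqf, Fin.sum_univ_three]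
    rw [sigR_symm v 1 0, sigR_symm v 2 0, sigR_symm v 2 1]
    ring
  rw [abs_le]
  constructor <;> linarith

/-- pointwise size of `g` and its gradient -/
def SS (g : V3 → ℝ) (v : V3) : ℝ := ∑ i, |pd i g v| + jap v * |g v|

lemma SS_nonneg (g : V3 → ℝ) (v : V3) : 0 ≤ SS g v := by
  have := jap_pos v
  unfold SS; positivity

lemma TG_jap1 : TG jap := (TG_jap 1).congr fun v => by simp

lemma RD_SS {g : V3 → ℝ} (hg : RD1 g) : RD (SS g) :=
  (RD.sum fun i => (hg.2.2 i).abs).add (TG_jap1.mulRD hg.2.1.abs)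

lemma pd_le_SS (g : V3 → ℝ) (i : Fin 3) (v : V3) : |pd i g v| + jap v * |g v| ≤ SS g v := by
  unfold SS
  have := Finset.single_le_sum (f := fun i => |pd i g v|) (fun i _ => abs_nonneg _)
    (Finset.mem_univ i)
  linarith

lemma SS_sq (g : V3 → ℝ) (v : V3) : SS g v ^ 2 ≤ 4 * (DD g v + jap v ^ 2 * g v ^ 2) := by
  unfold SS DD
  simp only [Fin.sum_univ_three]
  rw [← sq_abs (pd 0 g v), ← sq_abs (pd 1 g v), ← sq_abs (pd 2 g v), ← sq_abs (g v), ← mul_pow]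
  generalize |pd 0 g v| = a
  generalize |pd 1 g v| = b
  generalize |pd 2 g v| = c
  generalize jap v * |g v| = d
  nlinarith [sq_nonneg (a - b), sq_nonneg (a - c), sq_nonneg (a - d), sq_nonneg (b - c),
    sq_nonneg (b - d), sq_nonneg (c - d)]

lemma mm_bd (g : V3 → ℝ) (j : Fin 3) (u : V3) : |mm g j u| ≤ sqmu u * SS g u := by
  unfold mm
  rw [abs_mul, abs_of_pos (sqmu_pos u)]
  have := sqmu_pos u
  gcongr
  refine le_trans ?_ (pd_le_SS g j u)
  refine (abs_add_le _ _).trans ?_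
  gcongr
  rw [abs_mul, abs_mul]
  gcongr
  have := coord_le_jap u j
  rw [abs_of_pos (by norm_num : (0 : ℝ) < 1 / 2)]
  linarith [abs_nonneg (u j)]

lemma MM_bd {g : V3 → ℝ} (hg : RD1 g) (i : Fin 3) (v : V3) :
    |MM g i v| ≤ 24 * jap v * ∫ u, jap u * (sqmu u * SS g u) := by
  have hj := jap_pos v
  have h : ∀ j, |cv i j (mm g j) v| ≤ 8 * jap v * ∫ u, jap u * (sqmu u * SS g u) := fun j => by
    refine (cv_bd i j (RD_mm hg j) v).trans ?_
    refine mul_le_mul_of_nonneg_left ?_ (by positivity)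
    refine integral_mono (TG_jap1.mulRD (RD_mm hg j).abs).integrable
      (TG_jap1.mulRD (RD1_sqmu.2.1.mul (RD_SS hg))).integrable fun u => ?_
    have := jap_pos u
    have := mm_bd g j u
    simp only
    gcongr
  unfold MM
  refine (Finset.abs_sum_le_sum_abs _ _).trans ((Finset.sum_le_sum fun j _ => h j).trans ?_)
  simp
  linarith

lemma coef_bd (θ : ℝ) (hθ : 0 < θ) (g : V3 → ℝ) (i : Fin 3) (v : V3) :
    |coef θ g i v| ≤ (2 * θ + 1) * (jap v ^ (2 * θ) * SS g v) := by
  have hj := jap_pos v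
  have h1 : jap v ^ (2 * θ - 2) ≤ jap v ^ (2 * θ) :=
    Real.rpow_le_rpow_of_exponent_le (one_le_jap v) (by linarith)
  have hw : 0 < jap v ^ (2 * θ) := Real.rpow_pos_of_pos hj _
  have hw2 : 0 < jap v ^ (2 * θ - 2) := Real.rpow_pos_of_pos hj _
  have hv := coord_le_jap v i
  have hS := pd_le_SS g i v
  have ha := abs_nonneg (pd i g v)
  have hb : jap v * |g v| ≤ SS g v := by linarith
  have t1 : |2 * θ * jap v ^ (2 * θ - 2) * v i * g v| ≤ 2 * θ * (jap v ^ (2 * θ) * SS g v) := by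
    rw [abs_mul, abs_mul, abs_of_pos (by positivity : 0 < 2 * θ * jap v ^ (2 * θ - 2))]
    calc _ ≤ 2 * θ * jap v ^ (2 * θ) * jap v * |g v| := by gcongr
      _ = 2 * θ * (jap v ^ (2 * θ) * (jap v * |g v|)) := by ring
      _ ≤ _ := by gcongr
  have t2 : |jap v ^ (2 * θ) * pd i g v| = jap v ^ (2 * θ) * |pd i g v| := by
    rw [abs_mul, abs_of_pos hw]
  have t3 : |1 / 2 * v i * (jap v ^ (2 * θ) * g v)| ≤ jap v ^ (2 * θ) * (jap v * |g v|) := by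
    rw [abs_mul, abs_mul, abs_mul, abs_of_pos hw, abs_of_pos (by norm_num : (0 : ℝ) < 1 / 2)]
    calc _ ≤ 1 / 2 * jap v * (jap v ^ (2 * θ) * |g v|) := by gcongr
      _ ≤ 1 * jap v * (jap v ^ (2 * θ) * |g v|) := by gcongr; norm_num
      _ = _ := by ring
  have t4 := mul_le_mul_of_nonneg_left hS hw.le
  have := abs_add_three (2 * θ * jap v ^ (2 * θ - 2) * v i * g v) (jap v ^ (2 * θ) * pd i g v)
    (1 / 2 * v i * (jap v ^ (2 * θ) * g v))
  unfold coef
  linarith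

lemma rem_bd (θ : ℝ) (hθ : 0 < θ) : ∃ C : ℝ, 0 ≤ C ∧ ∀ g : SchwartzMap V3 ℝ,
    ∫ v, ∑ i, coef θ g i v * (sqmu v * MM g i v)
      ≤ C * ∫ v, jap v ^ (2 * θ - 2) * (DD g v + jap v ^ 2 * g v ^ 2) := by
  have rf : RD (fun v => jap v ^ (θ + 2) * sqmu v) := (TG_jap _).mulRD RD1_sqmu.2.1
  refine ⟨72 * (2 * θ + 1) * ((∫ v, (jap v ^ (θ + 2) * sqmu v) ^ 2) * 4), by positivity,
    fun g => ?_⟩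
  have hg := RD1_schwartz g
  have rk : RD (fun v => jap v ^ (θ - 1) * SS g v) := (TG_jap _).mulRD (RD_SS hg)
  have tj : TG (fun v => jap v ^ 2) := (TG_jap 2).congr fun v => by norm_num
  have rl : RD (fun v => jap v ^ (2 * θ - 2) * (DD g v + jap v ^ 2 * g v ^ 2)) :=
    (TG_jap _).mulRD ((RD_DD hg).add (tj.mulRD (RD_sq hg.2.1)))
  have rS := RD1_sqmu.2.1.mul (RD_SS hg)
  have hc := cauchy rf rk
  set A := ∫ v, (jap v ^ (θ + 2) * sqmu v) ^ 2 with hA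
  set E := ∫ v, jap v ^ (2 * θ - 2) * (DD g v + jap v ^ 2 * g v ^ 2) with hE
  have hA0 : 0 ≤ A := integral_nonneg fun v => sq_nonneg _
  have k1 : ∫ v, (jap v ^ (θ - 1) * SS g v) ^ 2 ≤ 4 * E := by
    rw [hE, ← integral_const_mul]
    refine integral_mono (RD_sq rk).integrable (rl.const_mul 4).integrable fun v => ?_
    simp only
    have e : (jap v ^ (θ - 1)) ^ 2 = jap v ^ (2 * θ - 2) := by
      rw [← Real.rpow_natCast, ← Real.rpow_mul (jap_pos v).le]
      congr 1; push_cast; ring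
    have hw2 : 0 < jap v ^ (2 * θ - 2) := Real.rpow_pos_of_pos (jap_pos v) _
    rw [mul_pow, e]
    nlinarith [mul_le_mul_of_nonneg_left (SS_sq g v) hw2.le]
  have e1 : ∀ v, jap v ^ (θ + 2) * sqmu v * (jap v ^ (θ - 1) * SS g v)
      = jap v ^ (2 * θ + 1) * (sqmu v * SS g v) := fun v => by
    rw [show 2 * θ + 1 = (θ + 2) + (θ - 1) by ring, Real.rpow_add (jap_pos v) (θ + 2) (θ - 1)]
    ring
  simp only [e1] at hc
  have rN : RD (fun v => jap v ^ (2 * θ + 1) * (sqmu v * SS g v)) := (TG_jap _).mulRD rS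
  have rN0 : RD (fun v => jap v * (sqmu v * SS g v)) := TG_jap1.mulRD rS
  have hpos : ∀ v, 0 ≤ sqmu v * SS g v := fun v => mul_nonneg (sqmu_pos v).le (SS_nonneg g v)
  have hN : ∫ v, jap v * (sqmu v * SS g v) ≤ ∫ v, jap v ^ (2 * θ + 1) * (sqmu v * SS g v) := by
    refine integral_mono rN0.integrable rN.integrable fun v => ?_
    refine mul_le_mul_of_nonneg_right ?_ (hpos v)
    have := Real.rpow_le_rpow_of_exponent_le (one_le_jap v) (by linarith : 1 ≤ 2 * θ + 1)
    rwa [Real.rpow_one] at this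
  have hN0 : 0 ≤ ∫ v, jap v * (sqmu v * SS g v) :=
    integral_nonneg fun v => mul_nonneg (jap_pos v).le (hpos v)
  have hM := MM_bd hg
  set N0 := ∫ v, jap v * (sqmu v * SS g v) with hN0d
  set N := ∫ v, jap v ^ (2 * θ + 1) * (sqmu v * SS g v) with hNd
  have hR : ∫ v, ∑ i, coef θ g i v * (sqmu v * MM g i v) ≤ 72 * (2 * θ + 1) * N0 * N := by
    rw [hNd, ← integral_const_mul]
    refine integral_mono (RD.sum fun i => (RD_coef θ hg i).mul
      (RD1_sqmu.2.1.mulTG (TG1_MM hg i).2.1)).integrable (rN.const_mul _).integrable fun v => ?_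
    have hi : ∀ i, coef θ g i v * (sqmu v * MM g i v)
        ≤ 24 * (2 * θ + 1) * N0 * (jap v ^ (2 * θ + 1) * (sqmu v * SS g v)) := fun i => by
      have hs := sqmu_pos v
      have hw : 0 < jap v ^ (2 * θ) := Real.rpow_pos_of_pos (jap_pos v) _
      have hS := SS_nonneg g v
      calc _ ≤ |coef θ g i v * (sqmu v * MM g i v)| := le_abs_self _
        _ = |coef θ g i v| * (sqmu v * |MM g i v|) := by rw [abs_mul, abs_mul, abs_of_pos hs]
        _ ≤ ((2 * θ + 1) * (jap v ^ (2 * θ) * SS g v)) * (sqmu v * (24 * jap v * N0)) := by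
          gcongr
          · exact coef_bd θ hθ g i v
          · exact hM i v
        _ = _ := by
          rw [Real.rpow_add (jap_pos v), Real.rpow_one]; ring
    have := Finset.sum_le_sum fun i (_ : i ∈ Finset.univ) => hi i
    refine this.trans (le_of_eq ?_)
    simp
    ring
  have h3 : N0 * N ≤ A * (4 * E) := by
    calc N0 * N ≤ N * N := by gcongr; exact hN0.trans hN
      _ = N ^ 2 := by ring
      _ ≤ _ := hc
      _ ≤ _ := by gcongr
  calc _ ≤ _ := hR
    _ = 72 * (2 * θ + 1) * (N0 * N) := by ring
    _ ≤ 72 * (2 * θ + 1) * (A * (4 * E)) := by gcongr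
    _ = _ := by ring

lemma main_pt (θ H : ℝ) (hθ : 0 < θ) (g : V3 → ℝ) (v : V3) (hH : |dh v| ≤ H) :
    1 / 4 * (jap v ^ (2 * θ) * (Qd g v + Qv v * g v ^ 2))
      + 1 / 2 * (2 * (jap v ^ (2 * θ) * (g v * PP g v))
      + 2 * θ * jap v ^ (2 * θ - 2) * (g v ^ 2 * Qv v) + jap v ^ (2 * θ) * (dh v * g v ^ 2))
    ≤ ∑ i, coef θ g i v * GG g i v
      + H / 2 * (jap v ^ (2 * θ - 2) * (DD g v + jap v ^ 2 * g v ^ 2))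
      + θ * (jap v ^ (2 * (θ - 1 / 2)) * (Qd g v + Qv v * g v ^ 2)) := by
  have hj := jap_pos v
  have hH0 : 0 ≤ H := (abs_nonneg _).trans hH
  have h1 : jap v ^ (2 * θ - 2) ≤ jap v ^ (2 * (θ - 1 / 2)) :=
    Real.rpow_le_rpow_of_exponent_le (one_le_jap v) (by linarith)
  have hw : 0 < jap v ^ (2 * θ) := Real.rpow_pos_of_pos hj _
  have hw2 : 0 < jap v ^ (2 * θ - 2) := Real.rpow_pos_of_pos hj _
  have e := jap_add_two (2 * θ - 2) (2 * θ) (by ring) v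
  rw [← jap_sq] at e
  have hQd := Qd_nonneg g v
  have hQv := Qv_nonneg v
  have hD : 0 ≤ DD g v := Finset.sum_nonneg fun i _ => sq_nonneg _
  have hP := abs_le.1 (PP_bd g v)
  have hq : 0 ≤ Qd g v + Qv v * g v ^ 2 := by positivity
  have a1 : jap v ^ (2 * θ - 2) * (-(2 * (g v * PP g v)))
      ≤ jap v ^ (2 * (θ - 1 / 2)) * (Qd g v + Qv v * g v ^ 2) := by
    calc _ ≤ jap v ^ (2 * θ - 2) * (Qd g v + Qv v * g v ^ 2) := by
          gcongr; linarith [hP.1]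
      _ ≤ _ := by gcongr
  have a1' := mul_le_mul_of_nonneg_left a1 hθ.le
  have a2 : jap v ^ (2 * θ) * (dh v * g v ^ 2) ≤ H * (jap v ^ (2 * θ) * g v ^ 2) := by
    have : dh v * g v ^ 2 ≤ H * g v ^ 2 := by gcongr; exact (abs_le.1 hH).2
    nlinarith [mul_le_mul_of_nonneg_left this hw.le]
  have a3 : H * (jap v ^ (2 * θ) * g v ^ 2)
      ≤ H * (jap v ^ (2 * θ - 2) * (DD g v + jap v ^ 2 * g v ^ 2)) := by
    rw [e]
    have : 0 ≤ jap v ^ (2 * θ - 2) * DD g v := by positivity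
    refine mul_le_mul_of_nonneg_left ?_ hH0
    linarith
  have a4 : 0 ≤ jap v ^ (2 * θ) * Qd g v := by positivity
  rw [alg_GG]
  linarith
/-- **Weighted coercivity of the hard linearized Landau operator.** -/
theorem hard_landau_weighted_coercivity (θ : ℝ) (hθ : 0 < θ) :
    ∃ δ > (0 : ℝ), ∃ C > (0 : ℝ), ∀ g : SchwartzMap V3 ℝ,
      (∫ v : V3, jap v ^ (2 * θ) * (LR ⇑g v * g v))
        ≥ δ ^ 2 * sRNormSq θ ⇑g - C * sRNormSq (θ - 1 / 2) ⇑g := by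
  obtain ⟨H, hH0, hH⟩ := dh_bd
  obtain ⟨K, hK0, hK⟩ := rem_bd θ hθ
  obtain ⟨B, hB0, hB⟩ := energy θ
  refine ⟨1 / 2, by norm_num, (H / 2 + K) * B + θ, by positivity, fun g => ?_⟩
  have hg := RD1_schwartz g
  obtain ⟨rz, iz⟩ := zero_id θ hg
  have rG : RD (fun v => ∑ i, coef θ g i v * GG g i v) :=
    RD.sum fun i => (RD_coef θ hg i).mul (RD1_GG g i).2.1
  have rM : RD (fun v => ∑ i, coef θ g i v * (sqmu v * MM g i v)) :=
    RD.sum fun i => (RD_coef θ hg i).mul (RD1_sqmu.2.1.mulTG (TG1_MM hg i).2.1)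
  have tj : TG (fun v => jap v ^ 2) := (TG_jap 2).congr fun v => by norm_num
  have rl : RD (fun v => jap v ^ (2 * θ - 2) * (DD g v + jap v ^ 2 * g v ^ 2)) :=
    (TG_jap _).mulRD ((RD_DD hg).add (tj.mulRD (RD_sq hg.2.1)))
  have e0 : ∫ v, jap v ^ (2 * θ) * (LR g v * g v) = (∫ v, ∑ i, coef θ g i v * GG g i v)
      - ∫ v, ∑ i, coef θ g i v * (sqmu v * MM g i v) := by
    rw [lhs_eq, ← integral_sub rG.integrable rM.integrable]
    congr 1; ext v
    simp only [JJ, Fin.sum_univ_three]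
    ring
  have rn1 := (RD_nrm hg (2 * θ)).const_mul (1 / 4)
  have rn2 := (RD_nrm hg (2 * (θ - 1 / 2))).const_mul θ
  have rz2 := rz.const_mul (1 / 2)
  have rl2 := rl.const_mul (H / 2)
  have key := integral_mono (rn1.add rz2).integrable ((rG.add rl2).add rn2).integrable
    fun v => main_pt θ H hθ g v (hH v)
  rw [integral_add rn1.integrable rz2.integrable, integral_add (rG.add rl2).integrable
    rn2.integrable, integral_add rG.integrable rl2.integrable] at key
  simp only [integral_const_mul] at key
  rw [iz, ← nrm_eq, ← nrm_eq] at key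
  have hr := hK g
  have hb := hB g
  have hb2 := mul_le_mul_of_nonneg_left hb (by positivity : 0 ≤ H / 2 + K)
  rw [e0]
  linarith
end
end
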